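/- Let Γ ≤ Sim_L(ℝ^{m+2}) act freely, properly discontinuously and cocompactly on ℝ^{m+2} (so that ℝ^{m+2}/Γ is a compact complete Lorentzian similarity manifold). Then Γ is virtually solvable. -/

import Mathlib

noncomputable section

/-- `Vec n` is the euclidean space `ℝ^n`. -/
abbrev Vec (n : ℕ) : Type := Fin n → ℝ

/-- The group of invertible affine transformations of `ℝ^n`. -/
abbrev AffGroup (n : ℕ) := Vec n ≃ᵃ[ℝ] Vec n

/-- The standard Lorentz quadratic form `Q(x) = x₁² + ⋯ + x_{m+1}² − x_{m+2}²` on `ℝ^{m+2}`. -/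
def lorentzQ (m : ℕ) (x : Vec (m + 2)) : ℝ :=
  (∑ i : Fin (m + 1), x i.castSucc ^ 2) - x (Fin.last (m + 1)) ^ 2

/-- Membership in the Lorentzian similarity group
`Sim_L(ℝ^{m+2}) = ℝ^{m+2} ⋊ (O(m+1,1) × ℝ^+)`: the linear part is `λ • A` with `λ > 0`
and `A` a linear map preserving the Lorentz form. -/
def InSimL (m : ℕ) (g : AffGroup (m + 2)) : Prop :=
  ∃ (lam : ℝ) (A : Vec (m + 2) →ₗ[ℝ] Vec (m + 2)), 0 < lam ∧
    (∀ v, lorentzQ m (A v) = lorentzQ m v) ∧ ∀ v, g.linear v = lam • A v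

/-- Properly discontinuous action on `ℝ^n`. -/
def ProperlyDisc {n : ℕ} (Γ : Subgroup (AffGroup n)) : Prop :=
  ∀ K : Set (Vec n), IsCompact K →
    {γ : AffGroup n | γ ∈ Γ ∧ (⇑γ '' K ∩ K).Nonempty}.Finite

/-- Free action on `ℝ^n`. -/
def FreeAction {n : ℕ} (Γ : Subgroup (AffGroup n)) : Prop :=
  ∀ γ ∈ Γ, (∃ x : Vec n, γ x = x) → γ = 1

/-- Cocompact action on `ℝ^n`: some compact set meets every orbit. -/
def CocompactAction {n : ℕ} (Γ : Subgroup (AffGroup n)) : Prop :=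
  ∃ K : Set (Vec n), IsCompact K ∧ ∀ x : Vec n, ∃ γ ∈ Γ, γ x ∈ K


namespace LS

/-- virtually solvable -/
def VS (G : Type*) [Group G] : Prop := ∃ H : Subgroup G, H.FiniteIndex ∧ Group.IsSolvable H

theorem solv_of_hom {G K : Type*} [Group G] [Group K] (f : G →* K)
    (h1 : Group.IsSolvable f.ker) (h2 : Group.IsSolvable f.range) : Group.IsSolvable G := by
  refine Group.isSolvable_of_ker_le_range f.ker.subtype f.rangeRestrict ?_
  simp [MonoidHom.ker_rangeRestrict]

theorem VS.of_finiteIndex {G : Type*} [Group G] {H : Subgroup G} (hH : H.FiniteIndex)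
    (h : VS H) : VS G := by
  obtain ⟨S, hS, hs⟩ := h
  refine ⟨S.map H.subtype, ?_, ?_⟩
  · have : (S.map H.subtype).index = S.index * H.index := by
      rw [Subgroup.index_map, Subgroup.range_subtype]
      simp
    exact ⟨by rw [this]; exact mul_ne_zero hS.index_ne_zero hH.index_ne_zero⟩
  · exact Group.isSolvable_of_surjective (f := (H.subtype.subgroupMap S)) (H.subtype.subgroupMap_surjective S)

theorem sup_solv {N : Type*} [Group N] (S T : Subgroup N) [S.Normal] [T.Normal]
    (hS : Group.IsSolvable S) (hT : Group.IsSolvable T) : Group.IsSolvable (S ⊔ T : Subgroup N) := by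
  let f : (S ⊔ T : Subgroup N) →* N ⧸ S := (QuotientGroup.mk' S).comp (S ⊔ T).subtype
  apply solv_of_hom f
  · let i : f.ker →* S :=
      { toFun := fun x => ⟨x.1.1, by
          have := x.2
          rw [MonoidHom.mem_ker] at this
          exact (QuotientGroup.eq_one_iff _).1 this⟩
        map_one' := rfl
        map_mul' := fun _ _ => rfl }
    refine Group.isSolvable_of_isSolvable_injective (f := i) ?_
    intro x y h
    have := congrArg Subtype.val h
    exact Subtype.ext (Subtype.ext this)
  · let g : T →* f.range :=
      { toFun := fun t => ⟨QuotientGroup.mk' S t, ⟨⟨t, Subgroup.mem_sup_right t.2⟩, rfl⟩⟩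
        map_one' := rfl
        map_mul' := fun _ _ => rfl }
    refine Group.isSolvable_of_surjective (f := g) ?_
    rintro ⟨_, ⟨⟨x, hx⟩, rfl⟩⟩
    obtain ⟨s, hs, t, ht, rfl⟩ := Subgroup.mem_sup_of_normal_left.1 hx
    refine ⟨⟨t, ht⟩, ?_⟩
    apply Subtype.ext
    change (QuotientGroup.mk' S) t = (QuotientGroup.mk' S) (s * t)
    rw [map_mul, (QuotientGroup.eq_one_iff s).2 hs |> (fun h => (h : QuotientGroup.mk' S s = 1)), one_mul]

theorem exists_char {N : Type*} [Group N] (h : VS N) :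
    ∃ S : Subgroup N, S.Characteristic ∧ S.FiniteIndex ∧ Group.IsSolvable S := by
  classical
  let P : ℕ → Prop := fun n => ∃ S : Subgroup N, S.Normal ∧ S.FiniteIndex ∧ Group.IsSolvable S ∧ S.index = n
  have hP : ∃ n, P n := by
    obtain ⟨H, hH, hs⟩ := h
    refine ⟨_, H.normalCore, inferInstance, inferInstance, ?_, rfl⟩
    exact Group.isSolvable_of_isSolvable_injective (f := Subgroup.inclusion H.normalCore_le) (Subgroup.inclusion_injective _)
  obtain ⟨S, hn, hf, hs, hi⟩ := Nat.find_spec hP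
  have key : ∀ T : Subgroup N, T.Normal → T.FiniteIndex → Group.IsSolvable T → T ≤ S := by
    intro T hTn hTf hTs
    by_contra hc
    have h1 : S < S ⊔ T := by
      refine lt_of_le_of_ne le_sup_left ?_
      intro h
      exact hc (h ▸ le_sup_right)
    have h2 := Subgroup.index_strictAnti h1
    rw [hi] at h2
    exact Nat.find_min hP h2 ⟨S ⊔ T, inferInstance, Subgroup.finiteIndex_of_le le_sup_left, sup_solv S T hs hTs, rfl⟩
  refine ⟨S, ?_, hf, hs⟩
  rw [Subgroup.characteristic_iff_map_le]
  intro φ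
  apply key
  · exact Subgroup.Normal.map hn _ φ.surjective
  · refine ⟨?_⟩
    rw [Subgroup.index_map_of_injective _ φ.injective]
    have : (φ.toMonoidHom).range = ⊤ := MonoidHom.range_eq_top.2 φ.surjective
    rw [this]
    simpa using hf.index_ne_zero
  · exact Group.isSolvable_of_surjective (f := (φ.toMonoidHom.subgroupMap S)) (φ.toMonoidHom.subgroupMap_surjective S)

theorem VS.of_ker {G K : Type*} [Group G] [Group K] (f : G →* K) (h1 : VS f.ker)
    (h2 : Group.IsSolvable f.range) : VS G := by
  obtain ⟨S, hc, hf, hs⟩ := exists_char h1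
  let N := f.ker
  let T : Subgroup G := S.map N.subtype
  haveI : T.Normal := ConjAct.normal_of_characteristic_of_normal (H := N) (K := S)
  let q := QuotientGroup.mk' T
  let Nb := N.map q
  haveI : Nb.Normal := Subgroup.Normal.map inferInstance _ (QuotientGroup.mk'_surjective T)
  haveI : Finite (N ⧸ S) := Subgroup.finite_quotient_of_finiteIndex
  haveI : Finite Nb := by
    let e : N ⧸ S → Nb := fun x => Quotient.liftOn' x (fun n => (⟨q n, ⟨n, n.2, rfl⟩⟩ : Nb)) (by
      intro a b hab
      apply Subtype.ext
      rw [QuotientGroup.leftRel_apply] at hab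
      change ((a : G) : G ⧸ T) = ((b : G) : G ⧸ T)
      rw [QuotientGroup.eq]
      exact ⟨a⁻¹ * b, hab, rfl⟩)
    refine Finite.of_surjective e ?_
    rintro ⟨_, ⟨n, hn, rfl⟩⟩
    exact ⟨QuotientGroup.mk ⟨n, hn⟩, rfl⟩
  let c : G ⧸ T →* MulAut Nb := MulAut.conjNormal
  haveI : Finite (MulAut Nb) := Finite.of_injective (fun φ : MulAut Nb => (φ : Nb → Nb)) DFunLike.coe_injective
  let D : Subgroup G := (c.comp q).ker
  refine ⟨D, inferInstance, ?_⟩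
  have hD : ∀ d ∈ D, ∀ n ∈ N, q d * q n = q n * q d := by
    intro d hd n hn
    have h3 : c (q d) = 1 := hd
    have h4 := congrArg (fun φ : MulAut Nb => ((φ ⟨q n, ⟨n, hn, rfl⟩⟩ : Nb) : G ⧸ T)) h3
    simp only [c, MulAut.conjNormal_apply, MulAut.one_apply] at h4
    rw [mul_inv_eq_iff_eq_mul] at h4
    exact h4
  let g : D →* K := f.comp D.subtype
  apply solv_of_hom g
  · let r : g.ker →* G ⧸ T := q.comp (D.subtype.comp g.ker.subtype)
    apply solv_of_hom r
    · let i : r.ker →* T :=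
        { toFun := fun x => ⟨x.1.1.1, (QuotientGroup.eq_one_iff _).1 x.2⟩
          map_one' := rfl
          map_mul' := fun _ _ => rfl }
      haveI : Group.IsSolvable T := Group.isSolvable_of_surjective (f := (N.subtype.subgroupMap S)) (N.subtype.subgroupMap_surjective S)
      refine Group.isSolvable_of_isSolvable_injective (f := i) ?_
      intro x y h
      have := congrArg Subtype.val h
      exact Subtype.ext (Subtype.ext (Subtype.ext this))
    · apply Group.isSolvable_of_comm
      rintro ⟨_, ⟨x, rfl⟩⟩ ⟨_, ⟨y, rfl⟩⟩
      apply Subtype.ext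
      exact hD x.1.1 x.1.2 y.1.1 y.2
  · refine Group.isSolvable_of_isSolvable_injective (f := Subgroup.inclusion (H := g.range) (K := f.range) ?_) (Subgroup.inclusion_injective _)
    rintro _ ⟨x, rfl⟩
    exact ⟨x.1, rfl⟩

theorem VS.of_comm {G : Type*} [Group G] (h : ∀ a b : G, a * b = b * a) : VS G :=
  ⟨⊤, inferInstance, haveI := Group.isSolvable_of_comm h; inferInstance⟩

theorem VS.of_solv {G : Type*} [Group G] (h : Group.IsSolvable G) : VS G :=
  ⟨⊤, inferInstance, inferInstance⟩

/-- finite index criterion -/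
theorem finiteIndex_of_color {G α : Type*} [Group G] (H : Subgroup G) (c : G → α)
    (hfin : (Set.range c).Finite) (h : ∀ g g', c g = c g' → g⁻¹ * g' ∈ H) : H.FiniteIndex := by
  haveI : Finite (Set.range c) := hfin
  haveI : Finite (G ⧸ H) := by
    choose! s hs using fun y : Set.range c => y.2
    refine Finite.of_surjective (fun y : Set.range c => (QuotientGroup.mk (s y) : G ⧸ H)) ?_
    intro x
    induction x using QuotientGroup.induction_on with
    | H g =>
      refine ⟨⟨c g, g, rfl⟩, ?_⟩
      rw [QuotientGroup.eq]
      exact h _ _ (hs _)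
  exact Subgroup.finiteIndex_of_finite_quotient

end LS


namespace LS

section lemZ
variable {G 𝒜 : Type*} [Group G] [NormedRing 𝒜]

theorem hom_mul_inv (ρ : G →* 𝒜) (g : G) : ρ g * ρ g⁻¹ = 1 := by rw [← map_mul]; simp
theorem hom_inv_mul (ρ : G →* 𝒜) (g : G) : ρ g⁻¹ * ρ g = 1 := by rw [← map_mul]; simp

theorem comm_sub_one (ρ : G →* 𝒜) (a b : G) :
    ρ (a * b * a⁻¹ * b⁻¹) - 1 = ((ρ a - 1) * (ρ b - 1) - (ρ b - 1) * (ρ a - 1)) * ρ a⁻¹ * ρ b⁻¹ := by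
  have h : ((ρ a - 1) * (ρ b - 1) - (ρ b - 1) * (ρ a - 1)) = ρ a * ρ b - ρ b * ρ a := by noncomm_ring
  rw [h, map_mul, map_mul, map_mul, sub_mul, sub_mul]
  congr 1
  rw [mul_assoc (ρ b), hom_mul_inv, mul_one, hom_mul_inv]

theorem inv_bound (ρ : G →* 𝒜) (h1 : ‖(1 : 𝒜)‖ ≤ 1) (a : G) (ha : ‖ρ a - 1‖ ≤ 1 / 16) :
    ‖ρ a⁻¹‖ ≤ 2 := by
  have h : ρ a⁻¹ = 1 - (ρ a - 1) * ρ a⁻¹ := by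
    rw [sub_mul, hom_mul_inv]; simp
  have h2 : ‖ρ a⁻¹‖ ≤ ‖(1 : 𝒜)‖ + ‖ρ a - 1‖ * ‖ρ a⁻¹‖ := by
    conv_lhs => rw [h]
    exact (norm_sub_le _ _).trans (by gcongr; exact norm_mul_le _ _)
  nlinarith [norm_nonneg (ρ a⁻¹)]

theorem comm_bound (ρ : G →* 𝒜) (h1 : ‖(1 : 𝒜)‖ ≤ 1) (a b : G) (ha : ‖ρ a - 1‖ ≤ 1 / 16)
    (hb : ‖ρ b - 1‖ ≤ 1 / 16) : ‖ρ (a * b * a⁻¹ * b⁻¹) - 1‖ ≤ 8 * ‖ρ a - 1‖ * ‖ρ b - 1‖ := by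
  rw [comm_sub_one]
  have h2 := inv_bound ρ h1 a ha
  have h3 := inv_bound ρ h1 b hb
  calc _ ≤ ‖(ρ a - 1) * (ρ b - 1) - (ρ b - 1) * (ρ a - 1)‖ * ‖ρ a⁻¹‖ * ‖ρ b⁻¹‖ :=
        (norm_mul_le _ _).trans (by gcongr; exact norm_mul_le _ _)
    _ ≤ (‖ρ a - 1‖ * ‖ρ b - 1‖ + ‖ρ b - 1‖ * ‖ρ a - 1‖) * 2 * 2 := by
        gcongr
        exact (norm_sub_le _ _).trans (add_le_add (norm_mul_le _ _) (norm_mul_le _ _))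
    _ = _ := by ring

theorem lemZ (ρ : G →* 𝒜) (h1 : ‖(1 : 𝒜)‖ ≤ 1) {ε : ℝ} (hε : ε ≤ 1 / 16) (bad : G → Prop)
    (hfin : (ρ '' {γ | ‖ρ γ - 1‖ < ε}).Finite) (hbad : ∀ γ, bad γ → ρ γ ≠ 1)
    (h0 : ∃ γ, bad γ ∧ ‖ρ γ - 1‖ < ε) :
    ∃ a, bad a ∧ ‖ρ a - 1‖ < ε ∧ ∀ b, ‖ρ b - 1‖ < ε → ¬ bad (a * b * a⁻¹ * b⁻¹) := by
  have hX : (ρ '' {γ | bad γ ∧ ‖ρ γ - 1‖ < ε}).Finite := hfin.subset (Set.image_mono fun γ h => h.2)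
  have hne : (ρ '' {γ | bad γ ∧ ‖ρ γ - 1‖ < ε}).Nonempty := by
    obtain ⟨γ, h⟩ := h0
    exact ⟨_, γ, h, rfl⟩
  obtain ⟨_, ⟨a, ⟨ha, hae⟩, rfl⟩, hmin⟩ := hX.exists_minimalFor (fun x => ‖x - 1‖) _ hne
  refine ⟨a, ha, hae, fun b hb hc => ?_⟩
  have h2 := comm_bound ρ h1 a b (by linarith) (by linarith)
  have hpos : 0 < ‖ρ a - 1‖ := norm_pos_iff.2 (sub_ne_zero.2 (hbad a ha))
  have h3 : ‖ρ (a * b * a⁻¹ * b⁻¹) - 1‖ < ‖ρ a - 1‖ := by nlinarith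
  have h4 := hmin (j := ρ (a * b * a⁻¹ * b⁻¹)) ⟨_, ⟨hc, h3.trans hae⟩, rfl⟩ h3.le
  simp only at h4
  linarith

theorem eq_one_of_pow_near [NormedAlgebra ℝ 𝒜] {z : 𝒜} (h : ∀ k : ℕ, ‖z ^ k - 1‖ ≤ 1 / 2) : z = 1 := by
  have h1 : ∀ y : 𝒜, ‖y - 1‖ ≤ 1 / 2 → (3 / 2) * ‖y - 1‖ ≤ ‖y ^ 2 - 1‖ := by
    intro y hy
    have h2 : (2 : ℝ) * ‖y - 1‖ ≤ ‖y ^ 2 - 1‖ + ‖y - 1‖ * ‖y - 1‖ := by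
      have e1 : (y - 1) + (y - 1) = (y ^ 2 - 1) - (y - 1) * (y - 1) := by noncomm_ring
      have e3 : ‖(y - 1) + (y - 1)‖ = 2 * ‖y - 1‖ := by
        rw [← two_smul ℝ (y - 1), norm_smul]; norm_num
      rw [← e3, e1]
      exact (norm_sub_le _ _).trans (by gcongr; exact norm_mul_le _ _)
    nlinarith [norm_nonneg (y - 1)]
  have h2 : ∀ k : ℕ, (3 / 2 : ℝ) ^ k * ‖z - 1‖ ≤ ‖z ^ (2 ^ k) - 1‖ := by
    intro k
    induction k with
    | zero => simp
    | succ k ih =>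
      have := h1 (z ^ (2 ^ k)) (h _)
      rw [← pow_mul, ← pow_succ] at this
      calc _ = (3 / 2) * ((3 / 2 : ℝ) ^ k * ‖z - 1‖) := by ring
        _ ≤ (3 / 2) * ‖z ^ (2 ^ k) - 1‖ := by gcongr
        _ ≤ _ := this
  by_contra hz
  have hpos : 0 < ‖z - 1‖ := norm_pos_iff.2 (sub_ne_zero.2 hz)
  obtain ⟨k, hk⟩ := pow_unbounded_of_one_lt (1 / ‖z - 1‖) (show (1 : ℝ) < 3 / 2 by norm_num)
  have h3 := h2 k
  have h4 := h (2 ^ k)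
  rw [div_lt_iff₀ hpos] at hk
  linarith

end lemZ

section unip
variable {𝒜 : Type*} [Ring 𝒜] {r : ℕ} (P : Fin r → 𝒜)

/-- strictly upper triangular filtration -/
def NN (s : ℕ) (x : 𝒜) : Prop := ∀ i j : Fin r, (j : ℕ) < i + s → P i * x * P j = 0

/-- complete orthogonal idempotents -/
structure Blk : Prop where
  idem : ∀ i, P i * P i = P i
  orth : ∀ i j, i ≠ j → P i * P j = 0
  sum : ∑ i, P i = 1

variable {P}

theorem Blk.split (hP : Blk P) (i j : Fin r) (x y : 𝒜) :
    P i * (x * y) * P j = ∑ k, (P i * x * P k) * (P k * y * P j) := by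
  have : ∀ k, (P i * x * P k) * (P k * y * P j) = (P i * x) * P k * (y * P j) := by
    intro k
    calc _ = (P i * x) * (P k * P k) * (y * P j) := by noncomm_ring
      _ = _ := by rw [hP.idem]
  simp_rw [this]
  rw [← Finset.sum_mul, ← Finset.mul_sum, hP.sum]
  noncomm_ring

theorem Blk.NN_mul (hP : Blk P) {s t : ℕ} {x y : 𝒜} (hx : NN P s x) (hy : NN P t y) :
    NN P (s + t) (x * y) := by
  intro i j hij
  rw [hP.split]
  apply Finset.sum_eq_zero
  intro k _
  by_cases hk : (k : ℕ) < i + s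
  · rw [hx i k hk, zero_mul]
  · rw [hy k j (by omega), mul_zero]

theorem NN.add {s : ℕ} {x y : 𝒜} (hx : NN P s x) (hy : NN P s y) : NN P s (x + y) := by
  intro i j h
  rw [mul_add, add_mul, hx i j h, hy i j h, add_zero]

theorem NN.neg {s : ℕ} {x : 𝒜} (hx : NN P s x) : NN P s (-x) := by
  intro i j h
  rw [mul_neg, neg_mul, hx i j h, neg_zero]

theorem NN.sub {s : ℕ} {x y : 𝒜} (hx : NN P s x) (hy : NN P s y) : NN P s (x - y) := by
  rw [sub_eq_add_neg]; exact hx.add hy.neg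

theorem NN.mono {s t : ℕ} (h : t ≤ s) {x : 𝒜} (hx : NN P s x) : NN P t x :=
  fun i j hij => hx i j (by omega)

theorem Blk.NN_one (hP : Blk P) : NN P 0 (1 : 𝒜) := by
  intro i j hij
  rw [mul_one]
  exact hP.orth i j (by rintro rfl; simp at hij)

theorem Blk.eq_zero (hP : Blk P) {x : 𝒜} (hx : NN P r x) : x = 0 := by
  have h : x = ∑ i, ∑ j, P i * x * P j := by
    simp_rw [← Finset.mul_sum, hP.sum, mul_one, ← Finset.sum_mul, hP.sum, one_mul]
  rw [h]
  exact Finset.sum_eq_zero fun i _ => Finset.sum_eq_zero fun j _ => hx i j (by omega)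

theorem solv_of_commutator {X : Type*} [Group X] (Y : Subgroup X) (hY : Group.IsSolvable Y)
    (h : ∀ a b : X, a * b * a⁻¹ * b⁻¹ ∈ Y) : Group.IsSolvable X := by
  have h1 : commutator X ≤ Y := by
    rw [commutator_eq_closure, Subgroup.closure_le]
    rintro _ ⟨a, b, rfl⟩
    exact h a b
  refine Group.isSolvable_of_ker_le_range (Y.subtype) (Abelianization.of (G := X)) ?_
  rw [Abelianization.ker_of]
  simpa using h1

theorem Blk.solv (hP : Blk P) (n s : ℕ) (hs : 1 ≤ s) (hn : r ≤ n + s) (X : Type*) [Group X]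
    (ρ : X →* 𝒜) (hinj : Function.Injective ρ) (h : ∀ x, NN P s (ρ x - 1)) : Group.IsSolvable X := by
  induction n generalizing s X with
  | zero =>
    apply Group.isSolvable_of_comm
    have : ∀ x : X, x = 1 := by
      intro x
      apply hinj
      rw [map_one]
      exact sub_eq_zero.1 (hP.eq_zero ((h x).mono (by omega)))
    intro a b
    rw [this a, this b]
  | succ n ih =>
    have h0 : ∀ x, NN P 0 (ρ x) := by
      intro x
      have := ((h x).mono (Nat.zero_le s)).add hP.NN_one
      simpa using this
    let Y : Subgroup X :=
      { carrier := {x | NN P (s + 1) (ρ x - 1)}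
        one_mem' := by
          simp only [Set.mem_ofPred_eq, map_one, sub_self]
          intro i j _
          simp
        mul_mem' := by
          intro a b ha hb
          have e : ρ (a * b) - 1 = (ρ a - 1) * ρ b + (ρ b - 1) := by rw [map_mul]; noncomm_ring
          simp only [Set.mem_ofPred_eq] at *
          rw [e]
          exact (hP.NN_mul ha (h0 b)).add hb
        inv_mem' := by
          intro a ha
          have e : ρ a⁻¹ - 1 = -((ρ a - 1) * ρ a⁻¹) := by
            rw [sub_mul, ← map_mul]; simp
          simp only [Set.mem_ofPred_eq] at *
          rw [e]
          exact (hP.NN_mul ha (h0 _)).neg }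
    refine solv_of_commutator Y (ih (s + 1) (by omega) (by omega) Y (ρ.comp Y.subtype)
      (hinj.comp Subtype.val_injective) (fun x => x.2)) ?_
    intro a b
    change NN P (s + 1) (ρ (a * b * a⁻¹ * b⁻¹) - 1)
    have e : ρ (a * b * a⁻¹ * b⁻¹) - 1 = ((ρ a - 1) * (ρ b - 1) - (ρ b - 1) * (ρ a - 1)) * ρ a⁻¹ * ρ b⁻¹ := by
      have h : ((ρ a - 1) * (ρ b - 1) - (ρ b - 1) * (ρ a - 1)) = ρ a * ρ b - ρ b * ρ a := by noncomm_ring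
      rw [h, map_mul, map_mul, map_mul, sub_mul, sub_mul]
      congr 1
      rw [mul_assoc (ρ b), ← map_mul, mul_inv_cancel, map_one, mul_one, ← map_mul, mul_inv_cancel, map_one]
    rw [e]
    have h7 : NN P (s + 1) ((ρ a - 1) * (ρ b - 1) - (ρ b - 1) * (ρ a - 1)) :=
      ((hP.NN_mul (h a) (h b)).sub (hP.NN_mul (h b) (h a))).mono (by omega)
    exact hP.NN_mul (s := s + 1) (t := 0) (hP.NN_mul (s := s + 1) (t := 0) h7 (h0 _)) (h0 _)

/-- the diagonal part -/
noncomputable def Blk.dg (_ : Blk P) (x : 𝒜) : 𝒜 := ∑ i, P i * x * P i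

theorem Blk.dg_one (hP : Blk P) : hP.dg 1 = 1 := by
  simp only [Blk.dg, mul_one, hP.idem, hP.sum]

theorem Blk.dg_mul (hP : Blk P) {x y : 𝒜} (hx : NN P 0 x) (hy : NN P 0 y) :
    hP.dg (x * y) = hP.dg x * hP.dg y := by
  classical
  have h1 : ∀ i, P i * (x * y) * P i = (P i * x * P i) * (P i * y * P i) := by
    intro i
    rw [hP.split, Finset.sum_eq_single i]
    · intro k _ hk
      rcases lt_or_gt_of_ne hk with h | h
      · rw [hx i k (by simpa using h), zero_mul]
      · rw [hy k i (by simpa using h), mul_zero]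
    · simp
  simp only [Blk.dg, h1]
  rw [Finset.sum_mul_sum]
  refine Finset.sum_congr rfl fun i _ => ?_
  rw [Finset.sum_eq_single i]
  · intro j _ hj
    calc _ = P i * x * (P i * P j) * (y * P j) := by noncomm_ring
      _ = 0 := by rw [hP.orth i j hj.symm]; simp
  · simp

theorem Blk.P_dg (hP : Blk P) (x : 𝒜) (i : Fin r) : P i * hP.dg x * P i = P i * x * P i := by
  classical
  simp only [Blk.dg]
  rw [Finset.mul_sum, Finset.sum_mul, Finset.sum_eq_single i]
  · calc _ = (P i * P i) * x * (P i * P i) := by noncomm_ring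
      _ = _ := by rw [hP.idem]
  · intro j _ hj
    calc _ = (P i * P j) * x * (P j * P i) := by noncomm_ring
      _ = 0 := by rw [hP.orth i j hj.symm]; simp
  · simp

theorem Blk.solv_of_comm (hP : Blk P) (X : Type*) [Group X]
    (ρ : X →* 𝒜) (hinj : Function.Injective ρ) (h0 : ∀ x, NN P 0 (ρ x))
    (hc : ∀ x y, hP.dg (ρ x) * hP.dg (ρ y) = hP.dg (ρ y) * hP.dg (ρ x)) : Group.IsSolvable X := by
  let σ : X →* 𝒜 :=
    { toFun := fun x => hP.dg (ρ x)
      map_one' := by rw [map_one, hP.dg_one]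
      map_mul' := fun x y => by rw [map_mul, hP.dg_mul (h0 x) (h0 y)] }
  let Y : Subgroup X := σ.ker
  refine solv_of_commutator Y (hP.solv r 1 le_rfl (by omega) Y (ρ.comp Y.subtype)
    (hinj.comp Subtype.val_injective) ?_) ?_
  · rintro ⟨x, hx⟩ i j hij
    have hx' : hP.dg (ρ x) = 1 := hx
    rcases lt_or_eq_of_le (show j ≤ i by rw [Fin.le_def]; omega) with h | rfl
    · exact (show NN P 0 (ρ x - 1) from (sub_eq_add_neg (ρ x) 1) ▸ (h0 x).add hP.NN_one.neg) i j (by simpa using h)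
    · change P j * (ρ x - 1) * P j = 0
      rw [mul_sub, sub_mul, ← hP.P_dg, hx']; simp
  · intro a b
    change σ _ = 1
    have h2 : σ a * σ b = σ b * σ a := hc a b
    rw [map_mul, map_mul, map_mul, h2, mul_assoc (σ b), ← map_mul, mul_inv_cancel, map_one, mul_one, ← map_mul, mul_inv_cancel, map_one]

end unip
end LS


namespace LS
open Filter Topology

theorem VS.of_inj {G K : Type*} [Group G] [Group K] (f : G →* K) (hf : Function.Injective f)
    (h : VS K) : VS G := by
  obtain ⟨H, hH, hs⟩ := h
  refine ⟨H.comap f, ⟨by rw [Subgroup.index_comap]; exact mt Subgroup.index_eq_zero_of_relIndex_eq_zero hH.index_ne_zero⟩, ?_⟩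
  refine Group.isSolvable_of_isSolvable_injective (f := f.subgroupComap H) ?_
  intro x y hxy
  have := congrArg Subtype.val hxy
  exact Subtype.ext (hf this)

/-- a finite subset of a set in a finite dimensional space spanning the same space -/
theorem exists_finite_span {E ι : Type*} [AddCommGroup E] [Module ℝ E] [FiniteDimensional ℝ E]
    (S : Set ι) (f : ι → E) : ∃ F : Set ι, F.Finite ∧ F ⊆ S ∧
      ∀ s ∈ S, f s ∈ Submodule.span ℝ (f '' F) := by
  have h1 : (Submodule.span ℝ (f '' S)).FG := IsNoetherian.noetherian _
  obtain ⟨T, hT, hTs⟩ := Submodule.fg_span_iff_fg_span_finset_subset (f '' S) |>.1 h1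
  rcases isEmpty_or_nonempty ι with hι | hι
  · exact ⟨∅, Set.finite_empty, Set.empty_subset _, fun s => hι.elim s⟩
  choose! g hg using fun (x : E) (hx : x ∈ f '' S) => hx
  refine ⟨g '' T, T.finite_toSet.image g, ?_, ?_⟩
  · rintro _ ⟨x, hx, rfl⟩
    exact (hg x (hT hx)).1
  · intro s hs
    have h2 : f s ∈ Submodule.span ℝ (f '' S) := Submodule.subset_span ⟨s, hs, rfl⟩
    rw [hTs] at h2
    refine Submodule.span_mono ?_ h2
    intro x hx
    exact ⟨g x, ⟨x, hx, rfl⟩, (hg x (hT hx)).2⟩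

theorem closure_comm {G M : Type*} [Group G] [Monoid M] (σ : G →* M) (S : Set G)
    (h : ∀ a ∈ S, ∀ b ∈ S, σ a * σ b = σ b * σ a) :
    ∀ a ∈ Subgroup.closure S, ∀ b ∈ Subgroup.closure S, σ a * σ b = σ b * σ a := by
  have hinv : ∀ x y, σ x * σ y = σ y * σ x → σ x⁻¹ * σ y = σ y * σ x⁻¹ := by
    intro x y hxy
    have h1 : σ x⁻¹ * (σ x * σ y) * σ x⁻¹ = σ x⁻¹ * (σ y * σ x) * σ x⁻¹ := by rw [hxy]
    rw [← mul_assoc, ← map_mul σ x⁻¹ x, inv_mul_cancel, map_one, one_mul, mul_assoc, mul_assoc, ← map_mul σ x x⁻¹, mul_inv_cancel, map_one, mul_one] at h1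
    exact h1.symm
  intro a ha b hb
  induction ha, hb using Subgroup.closure_induction₂ with
  | mem x y hx hy => exact h x hx y hy
  | one_left x hx => simp
  | one_right x hx => simp
  | mul_left x y z _ _ _ h1 h2 => rw [map_mul, mul_assoc, h2, ← mul_assoc, h1, mul_assoc]
  | mul_right y z x _ _ _ h1 h2 => rw [map_mul, ← mul_assoc, h1, mul_assoc, h2, mul_assoc]
  | inv_left x y _ _ h1 => exact hinv x y h1
  | inv_right x y _ _ h1 => exact (hinv y x h1.symm).symm

/-- finite colouring of a bounded set -/
theorem exists_color {G E : Type*} [NormedAddCommGroup E] [NormedSpace ℝ E] [FiniteDimensional ℝ E]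
    (σ : G → E) (S : Set G) (C : ℝ) (hC : ∀ g ∈ S, ‖σ g‖ ≤ C) {δ : ℝ} (hδ : 0 < δ) :
    ∃ c : G → E, (Set.range c).Finite ∧ ∀ g ∈ S, ∀ g' ∈ S, c g = c g' → ‖σ g - σ g'‖ < δ := by
  classical
  have : ProperSpace E := FiniteDimensional.proper ℝ E
  have hcpt : IsCompact (Metric.closedBall (0 : E) C) := isCompact_closedBall _ _
  obtain ⟨t, ht, hcov⟩ := Metric.totallyBounded_iff.1 hcpt.totallyBounded (δ / 2) (by positivity)
  have : ∀ g ∈ S, ∃ y ∈ t, dist (σ g) y < δ / 2 := by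
    intro g hg
    have h1 := hcov (show σ g ∈ Metric.closedBall (0 : E) C by simpa using hC g hg)
    simpa using h1
  choose! c hc using this
  refine ⟨fun g => if g ∈ S then c g else 0, (ht.insert 0).subset ?_, ?_⟩
  · rintro _ ⟨g, rfl⟩
    by_cases hg : g ∈ S
    · simp only [hg, if_true]; exact Or.inr (hc g hg).1
    · simp [hg]
  · intro g hg g' hg' h
    simp only [hg, hg', if_true] at h
    rw [← dist_eq_norm]
    have h1 := (hc g hg).2
    have h2 := (hc g' hg').2
    rw [← h] at h2
    linarith [dist_triangle_right (σ g) (σ g') (c g)]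

section lemE
variable {G 𝒜 : Type*} [Group G] [NormedRing 𝒜] [NormedAlgebra ℝ 𝒜] [FiniteDimensional ℝ 𝒜]
  {r : ℕ} {P : Fin r → 𝒜}

theorem pow_comm_bound (σ : G →* 𝒜) (C : ℝ) (hC : ∀ g, ‖σ g‖ ≤ C) (a b : G)
    (hz : σ (a * b * a⁻¹ * b⁻¹) * σ b = σ b * σ (a * b * a⁻¹ * b⁻¹))
    (hs : 2 * C ^ 3 * ‖σ a - 1‖ ≤ 1 / 2) : σ a * σ b = σ b * σ a := by
  set z := a * b * a⁻¹ * b⁻¹ with hzdef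
  have h1 : ∀ k : ℕ, σ (z ^ k) = σ (a * b ^ k * a⁻¹ * (b ^ k)⁻¹) := by
    intro k
    have e1 : a * b ^ k * a⁻¹ = (z * b) ^ k := by
      have : z * b = a * b * a⁻¹ := by rw [hzdef]; group
      rw [this, conj_pow]
    have e2 : σ ((z * b) ^ k) = σ (z ^ k) * σ (b ^ k) := by
      rw [map_pow, map_mul, Commute.mul_pow hz, map_pow, map_pow]
    rw [map_mul, e1, e2, mul_assoc, ← map_mul, mul_inv_cancel, map_one, mul_one]
  have hC0 : 0 ≤ C := (norm_nonneg _).trans (hC 1)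
  have h2 : σ z = 1 := by
    apply eq_one_of_pow_near
    intro k
    rw [← map_pow, h1, comm_sub_one]
    refine le_trans ?_ hs
    have e : (σ a - 1) * (σ (b ^ k) - 1) - (σ (b ^ k) - 1) * (σ a - 1) = (σ a - 1) * σ (b ^ k) - σ (b ^ k) * (σ a - 1) := by noncomm_ring
    rw [e]
    calc _ ≤ ‖(σ a - 1) * σ (b ^ k) - σ (b ^ k) * (σ a - 1)‖ * ‖σ a⁻¹‖ * ‖σ (b ^ k)⁻¹‖ :=
        (norm_mul_le _ _).trans (by gcongr; exact norm_mul_le _ _)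
      _ ≤ (‖σ a - 1‖ * C + C * ‖σ a - 1‖) * C * C := by
        gcongr
        · refine (norm_sub_le _ _).trans (add_le_add ((norm_mul_le _ _).trans ?_) ((norm_mul_le _ _).trans ?_))
          · gcongr; exact hC _
          · gcongr; exact hC _
        · exact hC _
        · exact hC _
      _ = _ := by ring
  have h3 : σ (z * (b * a)) = σ (b * a) := by rw [map_mul, h2, one_mul]
  have h4 : z * (b * a) = a * b := by rw [hzdef]; group
  rw [h4] at h3
  simpa using h3

theorem lemE_comm (h1 : ‖(1 : 𝒜)‖ ≤ 1) (hP : Blk P) (ρ : G →* 𝒜) (hup : ∀ g, NN P 0 (ρ g))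
    (C : ℝ) (hC : ∀ g, ‖hP.dg (ρ g)‖ ≤ C)
    (hfin : ∀ R : ℝ, (ρ '' {g | ‖ρ g‖ ≤ R}).Finite) :
    ∃ η > 0, ∀ a b, ‖hP.dg (ρ a) - 1‖ < η → ‖hP.dg (ρ b) - 1‖ < η →
      hP.dg (ρ a) * hP.dg (ρ b) = hP.dg (ρ b) * hP.dg (ρ a) := by
  classical
  let σ : G →* 𝒜 :=
    { toFun := fun x => hP.dg (ρ x)
      map_one' := by rw [map_one, hP.dg_one]
      map_mul' := fun x y => by rw [map_mul, hP.dg_mul (hup x) (hup y)] }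
  have hC0 : 0 ≤ C := (norm_nonneg _).trans (hC 1)
  set K : ℝ := ∑ i, ‖P i‖ * ‖P i‖ with hK
  have hK0 : 0 ≤ K := Finset.sum_nonneg fun i _ => by positivity
  obtain ⟨ε, hε0, hε1, hε2⟩ : ∃ ε : ℝ, 0 < ε ∧ ε ≤ 1 / 16 ∧ 2 * C ^ 3 * (K * ε) ≤ 1 / 2 := by
    refine ⟨min (1 / 16) (1 / (4 * C ^ 3 * K + 1)), by positivity, min_le_left _ _, ?_⟩
    calc 2 * C ^ 3 * (K * min (1 / 16) (1 / (4 * C ^ 3 * K + 1))) ≤ 2 * C ^ 3 * (K * (1 / (4 * C ^ 3 * K + 1))) := by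
          gcongr; exact min_le_right _ _
      _ ≤ 1 / 2 := by
          rw [mul_one_div, ← mul_div_assoc, div_le_iff₀ (by positivity)]
          nlinarith
  refine ⟨ε / 2, by positivity, ?_⟩
  by_contra hcon
  push Not at hcon
  obtain ⟨a0, b0, ha0, hb0, hab⟩ := hcon
  let S : Set G := {g | ‖σ g - 1‖ < ε / 2}
  obtain ⟨F, hFfin, hFS, hFspan⟩ := exists_finite_span S σ
  let bad : G → Prop := fun a => ¬ ∀ s ∈ S, σ a * σ s = σ s * σ a
  -- conjugation
  let D : ℝ → 𝒜 := fun t => ∑ i : Fin r, (t ^ (i : ℕ)) • P i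
  have PD : ∀ t i, P i * D t = t ^ (i : ℕ) • P i := by
    intro t i
    simp only [D, Finset.mul_sum]
    rw [Finset.sum_eq_single i]
    · rw [mul_smul_comm, hP.idem]
    · intro j _ hj; rw [mul_smul_comm, hP.orth i j hj.symm, smul_zero]
    · simp
  have DP : ∀ t i, D t * P i = t ^ (i : ℕ) • P i := by
    intro t i
    simp only [D, Finset.sum_mul]
    rw [Finset.sum_eq_single i]
    · rw [smul_mul_assoc, hP.idem]
    · intro j _ hj; rw [smul_mul_assoc, hP.orth j i hj, smul_zero]
    · simp
  have DD : ∀ t : ℝ, t ≠ 0 → D t * D t⁻¹ = 1 := by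
    intro t ht
    conv_lhs => rw [show D t⁻¹ = ∑ i : Fin r, ((t⁻¹) ^ (i : ℕ)) • P i from rfl]
    rw [Finset.mul_sum, ← hP.sum]
    refine Finset.sum_congr rfl fun i _ => ?_
    rw [mul_smul_comm, DP, smul_smul, ← mul_pow, inv_mul_cancel₀ ht, one_pow, one_smul]
  let ρt : ∀ t : ℝ, t ≠ 0 → (G →* 𝒜) := fun t ht =>
    { toFun := fun g => D t⁻¹ * ρ g * D t
      map_one' := by
        have := DD t⁻¹ (inv_ne_zero ht)
        rw [inv_inv] at this
        rw [map_one, mul_one, this]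
      map_mul' := fun g h => by
        calc _ = D t⁻¹ * ρ g * 1 * ρ h * D t := by rw [map_mul]; noncomm_ring
          _ = _ := by rw [← DD t ht]; noncomm_ring }
  have hent : ∀ t ht g i j, P i * ρt t ht g * P j = ((t⁻¹) ^ (i : ℕ) * t ^ (j : ℕ)) • (P i * ρ g * P j) := by
    intro t ht g i j
    calc _ = (P i * D t⁻¹) * ρ g * (D t * P j) := by change P i * (D t⁻¹ * ρ g * D t) * P j = _; noncomm_ring
      _ = _ := by rw [PD, DP]; simp only [smul_mul_assoc, mul_smul_comm, smul_smul]; congr 1; ring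
  have hσt : ∀ t ht g, hP.dg (ρt t ht g) = σ g := by
    intro t ht g
    change hP.dg (ρt t ht g) = hP.dg (ρ g)
    refine Finset.sum_congr rfl fun i _ => ?_
    rw [hent t ht, ← mul_pow, inv_mul_cancel₀ ht, one_pow, one_smul]
  have hσK : ∀ t ht g, ‖σ g - 1‖ ≤ K * ‖ρt t ht g - 1‖ := by
    intro t ht g
    have : σ g - 1 = ∑ i, P i * (ρt t ht g - 1) * P i := by
      simp only [mul_sub, sub_mul, Finset.sum_sub_distrib]
      rw [← hσt t ht g]
      congr 1
      exact hP.dg_one.symm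
    rw [this, hK, Finset.sum_mul]
    refine norm_sum_le_of_le _ fun i _ => ?_
    calc _ ≤ ‖P i‖ * ‖ρt t ht g - 1‖ * ‖P i‖ := (norm_mul_le _ _).trans (by gcongr; exact norm_mul_le _ _)
      _ = _ := by ring
  have hdiff : ∀ t ht g, 0 < t → t ≤ 1 → ‖ρt t ht g - σ g‖ ≤ t * ∑ i, ∑ j, ‖P i * ρ g * P j‖ := by
    intro t ht g ht0 ht1
    have e1 : ρt t ht g = ∑ i, ∑ j, P i * ρt t ht g * P j := by
      simp_rw [← Finset.mul_sum, hP.sum, mul_one, ← Finset.sum_mul, hP.sum, one_mul]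
    have e2 : σ g = ∑ i, ∑ j, if i = j then P i * ρ g * P j else 0 := by
      simp only [Finset.sum_ite_eq, Finset.mem_univ, if_true]; rfl
    rw [e1, e2, ← Finset.sum_sub_distrib, Finset.mul_sum]
    refine norm_sum_le_of_le _ fun i _ => ?_
    rw [← Finset.sum_sub_distrib, Finset.mul_sum]
    refine norm_sum_le_of_le _ fun j _ => ?_
    rw [hent t ht]
    rcases lt_trichotomy i j with h | h | h
    · rw [if_neg h.ne, sub_zero, norm_smul]
      gcongr
      rw [Real.norm_of_nonneg (by positivity)]
      obtain ⟨d, hd⟩ : ∃ d : ℕ, (j : ℕ) = i + (d + 1) := ⟨j - i - 1, by have : (i : ℕ) < j := h; omega⟩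
      rw [hd, pow_add, ← mul_assoc, ← mul_pow, inv_mul_cancel₀ ht, one_pow, one_mul, pow_succ]
      exact mul_le_of_le_one_left ht0.le (pow_le_one₀ ht0.le ht1)
    · subst h
      rw [← mul_pow, inv_mul_cancel₀ ht, one_pow, one_smul, if_pos rfl, sub_self, norm_zero]
      positivity
    · rw [hup g i j (by simpa using h), smul_zero, if_neg h.ne', sub_self, norm_zero]
      positivity
  -- choose t
  let M : G → ℝ := fun g => ∑ i, ∑ j, ‖P i * ρ g * P j‖
  have hM0 : ∀ g, 0 ≤ M g := fun g => Finset.sum_nonneg fun i _ => Finset.sum_nonneg fun j _ => norm_nonneg _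
  obtain ⟨B, hB⟩ : ∃ B : ℝ, ∀ g ∈ insert a0 F, M g ≤ B := by
    have := ((hFfin.insert a0).image M).bddAbove
    obtain ⟨B, hB⟩ := this
    exact ⟨B, fun g hg => hB ⟨g, hg, rfl⟩⟩
  have hB0 : 0 ≤ B := (hM0 a0).trans (hB a0 (Set.mem_insert _ _))
  obtain ⟨t, ht0, ht1, htB⟩ : ∃ t : ℝ, 0 < t ∧ t ≤ 1 ∧ t * B < ε / 2 := by
    refine ⟨min 1 (ε / (4 * (B + 1))), by positivity, min_le_left _ _, ?_⟩
    calc _ ≤ ε / (4 * (B + 1)) * B := by gcongr; exact min_le_right _ _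
      _ < ε / 2 := by
        rw [div_mul_eq_mul_div, div_lt_div_iff₀ (by positivity) (by positivity)]
        nlinarith
  have ht : t ≠ 0 := ht0.ne'
  have hnear : ∀ g ∈ insert a0 F, ‖ρt t ht g - 1‖ < ε := by
    intro g hg
    have hgS : ‖σ g - 1‖ < ε / 2 := by
      rcases hg with rfl | hg
      · exact ha0
      · exact hFS hg
    have h2 := hdiff t ht g ht0 ht1
    have h3 : t * M g ≤ t * B := by gcongr; exact hB g hg
    calc _ = ‖(ρt t ht g - σ g) + (σ g - 1)‖ := by congr 1; abel
      _ ≤ _ := norm_add_le _ _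
      _ < ε := by linarith
  have hfint : ((ρt t ht) '' {γ | ‖ρt t ht γ - 1‖ < ε}).Finite := by
    refine ((hfin (‖D t‖ * 2 * ‖D t⁻¹‖)).image (fun x => D t⁻¹ * x * D t)).subset ?_
    rintro _ ⟨g, hg, rfl⟩
    refine ⟨ρ g, ⟨g, ?_, rfl⟩, rfl⟩
    have e : ρ g = D t * ρt t ht g * D t⁻¹ := by
      calc ρ g = 1 * ρ g * 1 := by simp
        _ = (D t * D t⁻¹) * ρ g * (D t * D t⁻¹) := by rw [DD t ht]
        _ = D t * (D t⁻¹ * ρ g * D t) * D t⁻¹ := by noncomm_ring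
    have h2 : ‖ρt t ht g‖ ≤ 2 := by
      have hg' : ‖ρt t ht g - 1‖ < ε := hg
      calc _ = ‖(ρt t ht g - 1) + 1‖ := by simp
        _ ≤ ‖ρt t ht g - 1‖ + ‖(1 : 𝒜)‖ := norm_add_le _ _
        _ ≤ 2 := by linarith
    change ‖ρ g‖ ≤ _
    rw [e]
    calc _ ≤ ‖D t‖ * ‖ρt t ht g‖ * ‖D t⁻¹‖ := (norm_mul_le _ _).trans (by gcongr; exact norm_mul_le _ _)
      _ ≤ _ := by gcongr
  obtain ⟨a, hbad, hae, hab'⟩ := lemZ (ρt t ht) h1 hε1 bad hfint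
    (by
      intro γ hγ h
      apply hγ
      have : σ γ = 1 := by rw [← hσt t ht γ, h, hP.dg_one]
      intro s _
      rw [this]; simp)
    ⟨a0, fun h => hab (h b0 hb0), hnear a0 (Set.mem_insert _ _)⟩
  apply hbad
  have hF : ∀ b ∈ F, σ a * σ b = σ b * σ a := by
    intro b hb
    have h2 := not_not.1 (hab' b (hnear b (Set.mem_insert_of_mem _ hb)))
    refine pow_comm_bound σ C hC a b (h2 b (hFS hb)) (le_trans ?_ hε2)
    gcongr
    exact (hσK t ht a).trans (by gcongr)
  intro s hs
  have := hFspan s hs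
  refine Submodule.span_induction (p := fun x _ => σ a * x = x * σ a) ?_ ?_ ?_ ?_ this
  · rintro _ ⟨b, hb, rfl⟩
    exact hF b hb
  · simp
  · intro x y _ _ hx hy
    rw [mul_add, add_mul, hx, hy]
  · intro c x _ hx
    rw [mul_smul_comm, smul_mul_assoc, hx]

theorem lemE (h1 : ‖(1 : 𝒜)‖ ≤ 1) (hP : Blk P) (ρ : G →* 𝒜) (hup : ∀ g, NN P 0 (ρ g))
    (C : ℝ) (hC : ∀ g, ‖hP.dg (ρ g)‖ ≤ C)
    (hfin : ∀ R : ℝ, (ρ '' {g | ‖ρ g‖ ≤ R}).Finite) (hker : VS ρ.ker) : VS G := by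
  obtain ⟨η, hη, hcomm⟩ := lemE_comm h1 hP ρ hup C hC hfin
  let σ : G →* 𝒜 :=
    { toFun := fun x => hP.dg (ρ x)
      map_one' := by rw [map_one, hP.dg_one]
      map_mul' := fun x y => by rw [map_mul, hP.dg_mul (hup x) (hup y)] }
  let S : Set G := {g | ‖σ g - 1‖ < η}
  let H := Subgroup.closure S
  have hC0 : 0 ≤ C := (norm_nonneg _).trans (hC 1)
  have hH : H.FiniteIndex := by
    obtain ⟨c, hc, hc'⟩ := exists_color σ Set.univ C (fun g _ => hC g) (show 0 < η / (C + 1) by positivity)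
    refine finiteIndex_of_color H c hc fun g g' h => Subgroup.subset_closure ?_
    have h2 := hc' g' trivial g trivial h.symm
    change ‖σ (g⁻¹ * g') - 1‖ < η
    have e : σ (g⁻¹ * g') - 1 = σ g⁻¹ * (σ g' - σ g) := by
      rw [mul_sub, ← map_mul, ← map_mul, inv_mul_cancel, map_one]
    rw [e]
    rw [lt_div_iff₀ (by positivity)] at h2
    calc _ ≤ ‖σ g⁻¹‖ * ‖σ g' - σ g‖ := norm_mul_le _ _
      _ ≤ C * ‖σ g' - σ g‖ := by gcongr; exact hC _
      _ ≤ (C + 1) * ‖σ g' - σ g‖ := by gcongr; linarith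
      _ < η := by linarith
  refine VS.of_finiteIndex hH ?_
  let ρu : H →* 𝒜ˣ := (ρ.comp H.subtype).toHomUnits
  refine VS.of_ker ρu ?_ ?_
  · let i : ρu.ker →* ρ.ker :=
      { toFun := fun x => ⟨x.1.1, by
          have := congrArg Units.val (show ρu x.1 = 1 from x.2)
          exact this⟩
        map_one' := rfl
        map_mul' := fun _ _ => rfl }
    refine VS.of_inj i ?_ hker
    intro x y h
    have h2 : x.1.1 = y.1.1 := congrArg (fun z : ρ.ker => (z : G)) h
    exact Subtype.ext (Subtype.ext h2)
  · refine hP.solv_of_comm ρu.range ((Units.coeHom 𝒜).comp ρu.range.subtype) ?_ ?_ ?_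
    · intro x y h
      exact Subtype.ext (Units.ext h)
    · rintro ⟨_, ⟨x, rfl⟩⟩
      exact hup x
    · rintro ⟨_, ⟨x, rfl⟩⟩ ⟨_, ⟨y, rfl⟩⟩
      exact closure_comm σ S (fun a ha b hb => hcomm a b ha hb) x.1 x.2 y.1 y.2

end lemE
end LS


namespace LS
open Filter Topology

/-- affine actions -/
structure Aff (G V : Type*) [Group G] [NormedAddCommGroup V] [NormedSpace ℝ V] where
  L : G →* (V →L[ℝ] V)
  a : G → V
  a_mul : ∀ g h, a (g * h) = L g (a h) + a g

namespace Aff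
variable {G V : Type*} [Group G] [NormedAddCommGroup V] [NormedSpace ℝ V] (A : Aff G V)

/-- action -/
def act (g : G) (x : V) : V := A.L g x + A.a g

theorem L_mul (g h : G) (x : V) : A.L (g * h) x = A.L g (A.L h x) := by rw [map_mul]; rfl
theorem L_one (x : V) : A.L 1 x = x := by rw [map_one]; rfl
theorem L_inv_L (g : G) (x : V) : A.L g⁻¹ (A.L g x) = x := by rw [← A.L_mul, inv_mul_cancel, A.L_one]
theorem L_L_inv (g : G) (x : V) : A.L g (A.L g⁻¹ x) = x := by rw [← A.L_mul, mul_inv_cancel, A.L_one]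

theorem a_one : A.a 1 = 0 := by
  have := A.a_mul 1 1
  rw [mul_one, A.L_one] at this
  simpa using this

theorem a_inv (g : G) : A.a g⁻¹ = - A.L g⁻¹ (A.a g) := by
  have := A.a_mul g⁻¹ g
  rw [inv_mul_cancel, A.a_one] at this
  rw [eq_neg_iff_add_eq_zero, add_comm]; exact this.symm

theorem act_mul (g h : G) (x : V) : A.act (g * h) x = A.act g (A.act h x) := by
  simp only [act, A.L_mul, A.a_mul, map_add]; abel
theorem act_one (x : V) : A.act 1 x = x := by simp [act, A.L_one, A.a_one]
theorem act_inv_act (g : G) (x : V) : A.act g⁻¹ (A.act g x) = x := by rw [← A.act_mul, inv_mul_cancel, A.act_one]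
theorem act_act_inv (g : G) (x : V) : A.act g (A.act g⁻¹ x) = x := by rw [← A.act_mul, mul_inv_cancel, A.act_one]
theorem act_sub (g : G) (x y : V) : A.act g x - A.act g y = A.L g (x - y) := by simp [act]
theorem norm_act_le (g : G) (x : V) : ‖A.act g x‖ ≤ ‖A.L g‖ * ‖x‖ + ‖A.a g‖ :=
  (norm_add_le _ _).trans (by gcongr; exact (A.L g).le_opNorm x)
theorem continuous_act (g : G) : Continuous (A.act g) := by unfold act; fun_prop

/-- restriction to a subgroup -/
def restrict (H : Subgroup G) : Aff H V where
  L := A.L.comp H.subtype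
  a := fun h => A.a h
  a_mul := fun g h => A.a_mul g h

@[simp] theorem restrict_L (H : Subgroup G) (h : H) : (A.restrict H).L h = A.L h := rfl
@[simp] theorem restrict_a (H : Subgroup G) (h : H) : (A.restrict H).a h = A.a h := rfl
@[simp] theorem restrict_act (H : Subgroup G) (h : H) (x : V) : (A.restrict H).act h x = A.act h x := rfl

/-- scaling of the translation part -/
def scale (t : ℝ) : Aff G V where
  L := A.L
  a := fun g => t • A.a g
  a_mul := fun g h => by rw [A.a_mul]; simp

/-- linear representation on V × ℝ -/
noncomputable def toEnd : G →* ((V × ℝ) →L[ℝ] (V × ℝ)) where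
  toFun g := ((A.L g).comp (ContinuousLinearMap.fst ℝ V ℝ) +
      (ContinuousLinearMap.snd ℝ V ℝ).smulRight (A.a g)).prod (ContinuousLinearMap.snd ℝ V ℝ)
  map_one' := by
    ext x <;> simp [A.a_one]
  map_mul' g h := by
    ext x <;> simp [A.a_mul]

theorem toEnd_apply (g : G) (x : V) (s : ℝ) : A.toEnd g (x, s) = (A.L g x + s • A.a g, s) := rfl

theorem norm_one_le : ‖(1 : (V × ℝ) →L[ℝ] (V × ℝ))‖ ≤ 1 := ContinuousLinearMap.norm_id_le

theorem norm_L_le (g : G) : ‖A.L g‖ ≤ ‖A.toEnd g‖ := by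
  refine ContinuousLinearMap.opNorm_le_bound _ (norm_nonneg _) fun x => ?_
  have h := (A.toEnd g).le_opNorm (x, 0)
  rw [A.toEnd_apply] at h
  simpa [Prod.norm_mk] using h

theorem norm_a_le (g : G) : ‖A.a g‖ ≤ ‖A.toEnd g‖ := by
  have h := (A.toEnd g).le_opNorm ((0 : V), (1 : ℝ))
  rw [A.toEnd_apply] at h
  simp [Prod.norm_mk] at h
  exact h.1

theorem norm_toEnd_le (g : G) : ‖A.toEnd g‖ ≤ ‖A.L g‖ + ‖A.a g‖ + 1 := by
  refine ContinuousLinearMap.opNorm_le_bound _ (by positivity) fun x => ?_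
  obtain ⟨x, s⟩ := x
  rw [A.toEnd_apply, Prod.norm_mk, Prod.norm_mk]
  have h1 : ‖x‖ ≤ max ‖x‖ ‖s‖ := le_max_left _ _
  have h2 : ‖s‖ ≤ max ‖x‖ ‖s‖ := le_max_right _ _
  set m := max ‖x‖ ‖s‖
  have hm : 0 ≤ m := (norm_nonneg _).trans h1
  apply max_le
  · calc _ ≤ ‖A.L g‖ * ‖x‖ + ‖s‖ * ‖A.a g‖ := (norm_add_le _ _).trans (add_le_add ((A.L g).le_opNorm x) (norm_smul_le _ _))
      _ ≤ ‖A.L g‖ * m + m * ‖A.a g‖ + m := by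
        have : ‖A.L g‖ * ‖x‖ ≤ ‖A.L g‖ * m := by gcongr
        have : ‖s‖ * ‖A.a g‖ ≤ m * ‖A.a g‖ := by gcongr
        linarith
      _ = _ := by ring
  · have : 0 ≤ (‖A.L g‖ + ‖A.a g‖) * m := by positivity
    linarith

theorem norm_L_sub_le (g : G) : ‖A.L g - 1‖ ≤ ‖A.toEnd g - 1‖ := by
  refine ContinuousLinearMap.opNorm_le_bound _ (norm_nonneg _) fun x => ?_
  have h := (A.toEnd g - 1).le_opNorm (x, 0)
  rw [ContinuousLinearMap.sub_apply, A.toEnd_apply] at h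
  simpa [Prod.norm_mk] using h

theorem norm_a_le_sub (g : G) : ‖A.a g‖ ≤ ‖A.toEnd g - 1‖ := by
  have h := (A.toEnd g - 1).le_opNorm ((0 : V), (1 : ℝ))
  rw [ContinuousLinearMap.sub_apply, A.toEnd_apply] at h
  simpa [Prod.norm_mk] using h

theorem norm_toEnd_sub_le (g : G) : ‖A.toEnd g - 1‖ ≤ ‖A.L g - 1‖ + ‖A.a g‖ := by
  refine ContinuousLinearMap.opNorm_le_bound _ (by positivity) fun x => ?_
  obtain ⟨x, s⟩ := x
  have e : (A.toEnd g - 1) (x, s) = ((A.L g - 1) x + s • A.a g, 0) := by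
    rw [ContinuousLinearMap.sub_apply, A.toEnd_apply]
    simp only [ContinuousLinearMap.one_apply, Prod.mk_sub_mk, sub_self, ContinuousLinearMap.sub_apply]
    congr 1; abel
  rw [e, Prod.norm_mk, Prod.norm_mk]
  have h1 : ‖x‖ ≤ max ‖x‖ ‖s‖ := le_max_left _ _
  have h2 : ‖s‖ ≤ max ‖x‖ ‖s‖ := le_max_right _ _
  set m := max ‖x‖ ‖s‖
  have hm : 0 ≤ m := (norm_nonneg _).trans h1
  apply max_le
  · calc _ ≤ ‖A.L g - 1‖ * ‖x‖ + ‖s‖ * ‖A.a g‖ := (norm_add_le _ _).trans (add_le_add ((A.L g - 1).le_opNorm x) (norm_smul_le _ _))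
      _ ≤ ‖A.L g - 1‖ * m + m * ‖A.a g‖ := by
        gcongr
      _ = _ := by ring
  · rw [norm_zero]; positivity

theorem L_of_toEnd_eq_one {g : G} (h : A.toEnd g = 1) : A.L g = 1 ∧ A.a g = 0 := by
  have h1 := A.norm_L_sub_le g
  have h2 := A.norm_a_le_sub g
  rw [h, sub_self, norm_zero] at h1 h2
  exact ⟨sub_eq_zero.1 (norm_le_zero_iff.1 h1), norm_le_zero_iff.1 h2⟩

/-- properly discontinuous -/
def Proper : Prop := ∀ R : ℝ, {g | ∃ x, ‖x‖ ≤ R ∧ ‖A.act g x‖ ≤ R}.Finite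
/-- cocompact -/
def Cocpt : Prop := ∃ R : ℝ, ∀ x, ∃ g, ‖A.act g x‖ ≤ R
/-- free -/
def Free : Prop := ∀ g x, A.act g x = x → g = 1

variable {A}

theorem Proper.restrict (h : A.Proper) (H : Subgroup G) : (A.restrict H).Proper := by
  intro R
  refine ((h R).preimage (Set.injOn_of_injective H.subtype_injective)).subset ?_
  rintro g ⟨x, hx⟩
  exact ⟨x, hx⟩

theorem Free.restrict (h : A.Free) (H : Subgroup G) : (A.restrict H).Free := by
  intro g x hx
  exact Subtype.ext (h g x hx)

theorem Cocpt.restrict (h : A.Cocpt) {H : Subgroup G} (hH : H.FiniteIndex) : (A.restrict H).Cocpt := by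
  obtain ⟨R, hR⟩ := h
  haveI : Finite (G ⧸ H) := Subgroup.finite_quotient_of_finiteIndex
  let f : G ⧸ H → ℝ := fun q => ‖A.L q.out⁻¹‖ * |R| + ‖A.a q.out⁻¹‖
  obtain ⟨M, hM⟩ := (Set.finite_range f).bddAbove
  refine ⟨M, fun x => ?_⟩
  obtain ⟨g, hg⟩ := hR x
  have h1 : (Quotient.out (g : G ⧸ H))⁻¹ * g ∈ H := by
    rw [← QuotientGroup.eq]; exact Quotient.out_eq' _
  refine ⟨⟨_, h1⟩, ?_⟩
  rw [restrict_act]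
  simp only [A.act_mul]
  refine (A.norm_act_le _ _).trans (le_trans ?_ (hM ⟨(g : G ⧸ H), rfl⟩))
  simp only [f]
  gcongr
  exact hg.trans (le_abs_self R)

theorem Proper.finite_of_ball (h : A.Proper) (R : ℝ) : {g | ‖A.a g‖ ≤ R}.Finite := by
  refine (h (max R 0)).subset ?_
  intro g hg
  refine ⟨0, by simp, ?_⟩
  simp only [act, map_zero, zero_add]
  exact le_trans hg (le_max_left _ _)

end Aff
end LS


namespace LS
open Filter Topology

variable {V : Type*} [NormedAddCommGroup V] [NormedSpace ℝ V]

/-- Lorentz form -/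
structure Lor (B : V →L[ℝ] V →L[ℝ] ℝ) : Prop where
  symm : ∀ x y, B x y = B y x
  ex : ∃ e, B e e = -1 ∧ ∀ x, B e x = 0 → x ≠ 0 → 0 < B x x

namespace Lor
variable {B : V →L[ℝ] V →L[ℝ] ℝ}

/-- L1 -/
theorem pos_of_orth (hB : Lor B) {v x : V} (hv : B v v < 0) (hx : B v x = 0) (hx0 : x ≠ 0) : 0 < B x x := by
  obtain ⟨e, he, hpos⟩ := hB.ex
  have hnn : ∀ y, B e y = 0 → 0 ≤ B y y := by
    intro y hy
    by_cases h : y = 0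
    · simp [h]
    · exact (hpos y hy h).le
  -- components
  obtain ⟨α, v', hv', rfl⟩ : ∃ (α : ℝ) (v' : V), B e v' = 0 ∧ v = α • e + v' := by
    refine ⟨-(B e v), v + (B e v) • e, ?_, by simp⟩
    simp [he]
  obtain ⟨β, x', hx', rfl⟩ : ∃ (α : ℝ) (v' : V), B e v' = 0 ∧ x = α • e + v' := by
    refine ⟨-(B e x), x + (B e x) • e, ?_, by simp⟩
    simp [he]
  have hv'' : B v' e = 0 := by rw [hB.symm]; exact hv'
  have hx'' : B x' e = 0 := by rw [hB.symm]; exact hx'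
  have hcs : (B v' x') ^ 2 ≤ B v' v' * B x' x' := by
    by_cases h : x' = 0
    · simp [h]
    · have h1 := hpos x' hx' h
      have h2 := hnn ((B x' x') • v' - (B v' x') • x') (by simp [hv', hx'])
      simp only [map_sub, map_smul, sub_apply, smul_apply, smul_eq_mul, hB.symm x' v'] at h2
      have h3 : 0 ≤ B x' x' * (B v' v' * B x' x' - (B v' x') ^ 2) := by nlinarith
      have := nonneg_of_mul_nonneg_right h3 h1
      linarith
  simp only [map_add, map_smul, add_apply, smul_apply, smul_eq_mul, he, hv', hv'', hx', hx''] at hv hx ⊢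
  have h1 := hnn v' hv'
  have h2 := hnn x' hx'
  by_contra hcon
  have h3 : B v' x' = α * β := by linarith
  rw [h3] at hcs
  have h4 : B x' x' ≤ β * β := by linarith
  by_cases hβ : β = 0
  · subst hβ
    apply hx0
    by_contra hne
    have : x' ≠ 0 := by rintro rfl; simp at hne
    have := hpos x' hx' this
    linarith
  · have h5 : 0 < β * β := mul_self_pos.2 hβ
    have h6 : B v' v' < α * α := by linarith
    nlinarith [mul_le_mul_of_nonneg_left h4 h1]

theorem nonneg_of_orth (hB : Lor B) {v x : V} (hv : B v v < 0) (hx : B v x = 0) : 0 ≤ B x x := by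
  by_cases h : x = 0
  · simp [h]
  · exact (hB.pos_of_orth hv hx h).le

theorem eq_zero_of_orth (hB : Lor B) {v x : V} (hv : B v v < 0) (hx : B v x = 0) (h : B x x ≤ 0) : x = 0 := by
  by_contra hc
  have := hB.pos_of_orth hv hx hc
  linarith

/-- L2 -/
theorem null_orth (hB : Lor B) {u x : V} (hu0 : u ≠ 0) (hu : B u u = 0) (hux : B u x = 0) (hx : B x x ≤ 0) :
    ∃ c : ℝ, x = c • u := by
  obtain ⟨e, he, _⟩ := hB.ex
  have he' : B e e < 0 := by linarith
  have h1 : B e u ≠ 0 := fun h => hu0 (hB.eq_zero_of_orth he' h hu.le)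
  refine ⟨B e x / B e u, ?_⟩
  rw [← sub_eq_zero]
  apply hB.eq_zero_of_orth he'
  · simp [h1]
  · have h2 : B x u = 0 := by rw [hB.symm]; exact hux
    simp [h2, hu, hux, hx]

/-- cone lemma -/
theorem cone (hB : Lor B) {x y w : V} (hx : B x x < 0) (hy : B y y < 0) (hw : B w w < 0)
    (hxw : B w x < 0) (hyw : B w y < 0) : B x y < 0 := by
  have h := hB.nonneg_of_orth hw (x := (B w y) • x - (B w x) • y) (by simp; ring)
  simp only [map_sub, map_smul, sub_apply, smul_apply, smul_eq_mul, hB.symm y x] at h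
  have h1 : 0 < B w x * B w y := mul_pos_of_neg_of_neg hxw hyw
  have h2 : (B w y) ^ 2 * B x x < 0 := mul_neg_of_pos_of_neg (sq_pos_of_neg hyw) hx
  have h3 : (B w x) ^ 2 * B y y < 0 := mul_neg_of_pos_of_neg (sq_pos_of_neg hxw) hy
  by_contra hc
  push Not at hc
  have h4 := mul_nonneg h1.le hc
  nlinarith

/-- orthogonal projection with kernel S -/
theorem exists_proj' [FiniteDimensional ℝ V] (S : Submodule ℝ V)
    (hS : ∀ s ∈ S, (∀ t ∈ S, B s t = 0) → s = 0) :
    ∃ p : V →L[ℝ] V, (∀ x ∈ S, p x = 0) ∧ (∀ x, x - p x ∈ S) ∧ (∀ x, ∀ s ∈ S, B (p x) s = 0) := by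
  let φ : V →ₗ[ℝ] Module.Dual ℝ S :=
    { toFun := fun x => (B x).toLinearMap.comp S.subtype
      map_add' := fun x y => by ext; simp
      map_smul' := fun c x => by ext; simp }
  have hφ : ∀ x (s : S), φ x s = B x s := fun x s => rfl
  have hinj : Function.Injective (φ.comp S.subtype) := by
    rw [← LinearMap.ker_eq_bot, LinearMap.ker_eq_bot']
    rintro ⟨s, hs⟩ h
    have h1 : ∀ t ∈ S, B s t = 0 := fun t ht => by
      have := congrArg (fun f : Module.Dual ℝ S => f ⟨t, ht⟩) h
      simpa [hφ] using this
    exact Subtype.ext (hS s hs h1)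
  let e := LinearEquiv.ofInjectiveOfFinrankEq (φ.comp S.subtype) hinj (Subspace.dual_finrank_eq.symm)
  have he : ∀ s, e s = φ s := fun s => rfl
  let p : V →ₗ[ℝ] V := LinearMap.id - S.subtype.comp (e.symm.toLinearMap.comp φ)
  have hp : ∀ x, p x = x - (e.symm (φ x) : S) := fun x => rfl
  refine ⟨LinearMap.toContinuousLinearMap p, ?_, ?_, ?_⟩
  · intro x hx
    change p x = 0
    rw [hp]
    have : φ x = e ⟨x, hx⟩ := (he ⟨x, hx⟩).symm
    rw [this, e.symm_apply_apply, sub_self]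
  · intro x
    change x - p x ∈ S
    rw [hp]; simp
  · intro x s hs
    change B (p x) s = 0
    rw [hp, map_sub, sub_apply, sub_eq_zero]
    have h1 : φ (e.symm (φ x) : S) = φ x := by rw [← he, e.apply_symm_apply]
    have := congrArg (fun f : Module.Dual ℝ S => f ⟨s, hs⟩) h1
    exact this.symm

theorem exists_proj [FiniteDimensional ℝ V] (hB : Lor B) (S : Submodule ℝ V) (hS : ∃ v ∈ S, B v v < 0) :
    ∃ p : V →L[ℝ] V, (∀ x ∈ S, p x = 0) ∧ (∀ x, x - p x ∈ S) ∧ (∀ x, ∀ s ∈ S, B (p x) s = 0) := by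
  obtain ⟨v, hvS, hv⟩ := hS
  apply exists_proj'
  intro s hs h1
  exact hB.eq_zero_of_orth hv (by rw [hB.symm]; exact h1 v hvS) (h1 s hs).le

/-- L4, lower bound -/
theorem exists_lower [FiniteDimensional ℝ V] (hB : Lor B) (r : ℝ) :
    ∃ c > 0, ∀ h u, B h h = -1 → ‖h‖ ≤ r → c * ‖u‖ ^ 2 ≤ B u u + 2 * (B u h) ^ 2 := by
  have : ProperSpace V := FiniteDimensional.proper ℝ V
  let K : Set (V × V) := {p | B p.1 p.1 = -1} ∩ (Metric.closedBall 0 r ×ˢ Metric.sphere 0 1)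
  have hK : IsCompact K := by
    refine IsCompact.inter_left ((isCompact_closedBall _ _).prod (isCompact_sphere _ _)) ?_
    exact isClosed_eq (by fun_prop) continuous_const
  let f : V × V → ℝ := fun p => B p.2 p.2 + 2 * (B p.2 p.1) ^ 2
  have hf : Continuous f := by fun_prop
  have hpos : ∀ h u, B h h = -1 → u ≠ 0 → 0 < B u u + 2 * (B u h) ^ 2 := by
    intro h u hh hu
    have h1 := hB.nonneg_of_orth (v := h) (x := u + (B h u) • h) (by linarith) (by simp [hh])
    simp only [map_add, map_smul, add_apply, smul_apply, smul_eq_mul, hh, hB.symm h u] at h1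
    by_cases hc : B u h = 0
    · have := hB.pos_of_orth (v := h) (x := u) (by linarith) (by rw [hB.symm]; exact hc) hu
      rw [hc]; simpa
    · have : 0 < (B u h) ^ 2 := by positivity
      nlinarith
  obtain ⟨c, hc, hcK⟩ : ∃ c > 0, ∀ p ∈ K, c ≤ f p := by
    rcases K.eq_empty_or_nonempty with h | h
    · exact ⟨1, one_pos, by simp [h]⟩
    · obtain ⟨p, hp, hmin⟩ := hK.exists_isMinOn h hf.continuousOn
      refine ⟨f p, hpos _ _ hp.1 ?_, fun q hq => hmin hq⟩
      have := hp.2.2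
      rintro h0
      rw [h0] at this
      simp at this
  refine ⟨c, hc, fun h u hh hr => ?_⟩
  by_cases hu : u = 0
  · simp [hu]
  have hu' : 0 < ‖u‖ := norm_pos_iff.2 hu
  have h1 := hcK (h, ‖u‖⁻¹ • u) ⟨hh, by simpa using hr, by simp [norm_smul, hu'.ne']⟩
  simp only [f, map_smul, smul_apply, smul_eq_mul] at h1
  have h2 : ‖u‖⁻¹ * (‖u‖⁻¹ * (B u) u) + 2 * (‖u‖⁻¹ * (B u) h) ^ 2 = (B u u + 2 * (B u h) ^ 2) / ‖u‖ ^ 2 := by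
    field_simp
  rw [h2, le_div_iff₀ (by positivity)] at h1
  exact h1

/-- L4 -/
theorem exists_bound [FiniteDimensional ℝ V] (hB : Lor B) (r : ℝ) :
    ∃ M, 0 < M ∧ ∀ (g : V →L[ℝ] V) (h : V), (∀ x y, B (g x) (g y) = B x y) → B h h = -1 → ‖h‖ ≤ r → ‖g h‖ ≤ r →
      ‖g‖ ≤ M := by
  obtain ⟨c, hc, hlow⟩ := hB.exists_lower r
  let N := ‖B‖ + 2 * (‖B‖ * |r|) ^ 2
  have hN : 0 ≤ N := by positivity
  have hup : ∀ h u, ‖h‖ ≤ r → B u u + 2 * (B u h) ^ 2 ≤ N * ‖u‖ ^ 2 := by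
    intro h u hh
    have h1 : B u u ≤ ‖B‖ * ‖u‖ * ‖u‖ := (le_abs_self _).trans (B.le_opNorm₂ u u)
    have h2 : |B u h| ≤ ‖B‖ * ‖u‖ * |r| := (B.le_opNorm₂ u h).trans (by gcongr; exact hh.trans (le_abs_self r))
    have h3 : (B u h) ^ 2 ≤ (‖B‖ * ‖u‖ * |r|) ^ 2 := by
      rw [← sq_abs]; gcongr
    simp only [N]
    nlinarith
  refine ⟨Real.sqrt (N / c) + 1, by positivity, fun g h hg hh h1 h2 => ?_⟩
  refine ContinuousLinearMap.opNorm_le_bound _ (by positivity) fun u => ?_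
  have h3 := hlow (g h) (g u) (by rw [hg, hh]) h2
  rw [hg, hg] at h3
  have h4 := h3.trans (hup h u h1)
  have h5 : ‖g u‖ ^ 2 ≤ (N / c) * ‖u‖ ^ 2 := by
    rw [div_mul_eq_mul_div, le_div_iff₀ hc]; linarith
  have h6 : ‖g u‖ ≤ Real.sqrt (N / c) * ‖u‖ := by
    apply le_of_sq_le_sq _ (by positivity)
    rw [mul_pow, Real.sq_sqrt (by positivity)]
    exact h5
  nlinarith [norm_nonneg u]

end Lor

section proj
variable {B : V →L[ℝ] V →L[ℝ] ℝ} {S : Submodule ℝ V} {p : V →L[ℝ] V}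

/-- the properties of the orthogonal projection -/
structure IsPr (B : V →L[ℝ] V →L[ℝ] ℝ) (S : Submodule ℝ V) (p : V →L[ℝ] V) : Prop where
  zero : ∀ x ∈ S, p x = 0
  sub : ∀ x, x - p x ∈ S
  orth : ∀ x, ∀ s ∈ S, B (p x) s = 0

theorem IsPr.idem (h : IsPr B S p) (x : V) : p (p x) = p x := by
  have := h.zero _ (h.sub x)
  rw [map_sub, sub_eq_zero] at this
  exact this.symm

theorem IsPr.mem (h : IsPr B S p) {x : V} (hx : p x = 0) : x ∈ S := by
  have := h.sub x
  rwa [hx, sub_zero] at this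

theorem IsPr.pos (h : IsPr B S p) (hB : Lor B) (hS : ∃ v ∈ S, B v v < 0) {x : V} (hx : p x ≠ 0) : 0 < B (p x) (p x) := by
  obtain ⟨v, hv, hv'⟩ := hS
  exact hB.pos_of_orth hv' (by rw [hB.symm]; exact h.orth x v hv) hx

theorem IsPr.comm {G : Type*} [Group G] (h : IsPr B S p) (hB : Lor B) (hS : ∃ v ∈ S, B v v < 0)
    (A : Aff G V) (lam : G → ℝ) (hiso : ∀ g x y, B (A.L g x) (A.L g y) = lam g ^ 2 * B x y)
    (hinv : ∀ g, ∀ s ∈ S, A.L g s ∈ S) (g : G) (x : V) : p (A.L g x) = A.L g (p x) := by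
  have h1 : A.L g (p x) - p (A.L g x) ∈ S := by
    have e : A.L g (p x) - p (A.L g x) = (A.L g x - p (A.L g x)) - A.L g (x - p x) := by
      rw [map_sub]; abel
    rw [e]
    exact S.sub_mem (h.sub _) (hinv g _ (h.sub x))
  have h2 : ∀ s ∈ S, B (A.L g (p x) - p (A.L g x)) s = 0 := by
    intro s hs
    rw [map_sub, sub_apply, h.orth _ s hs, sub_zero]
    rw [← A.L_L_inv g s, hiso, h.orth _ _ (hinv _ s hs), mul_zero]
  obtain ⟨v, hv, hv'⟩ := hS
  have h3 := hB.eq_zero_of_orth hv' (by rw [hB.symm]; exact h2 v hv) (h2 _ h1).le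
  exact (sub_eq_zero.1 h3).symm
end proj
end LS


namespace LS
open Filter Topology

variable {V : Type*} [NormedAddCommGroup V] [NormedSpace ℝ V] [FiniteDimensional ℝ V]
variable {G : Type*} [Group G]

theorem VS.of_ker_comm {M : Type*} [CommMonoid M] (f : G →* M) (h : VS f.toHomUnits.ker) : VS G := by
  refine VS.of_ker f.toHomUnits h ?_
  apply Group.isSolvable_of_comm
  intro a b
  exact mul_comm a b

section blocks
variable {r : ℕ} (P : Fin r → (V →L[ℝ] V))

/-- extended blocks -/
noncomputable def extBlk (i : Fin (r + 1)) : (V × ℝ) →L[ℝ] (V × ℝ) :=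
  Fin.lastCases (motive := fun _ => (V × ℝ) →L[ℝ] (V × ℝ))
    ((ContinuousLinearMap.inr ℝ V ℝ).comp (ContinuousLinearMap.snd ℝ V ℝ))
    (fun i => (ContinuousLinearMap.inl ℝ V ℝ).comp ((P i).comp (ContinuousLinearMap.fst ℝ V ℝ))) i

theorem extBlk_last (x : V) (s : ℝ) : extBlk P (Fin.last r) (x, s) = (0, s) := by
  simp [extBlk]
theorem extBlk_castSucc (i : Fin r) (x : V) (s : ℝ) : extBlk P i.castSucc (x, s) = (P i x, 0) := by
  simp [extBlk]

variable {P}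
theorem extBlk_blk (hP : Blk P) : Blk (extBlk P) where
  idem i := by
    refine Fin.lastCases ?_ (fun i => ?_) i
    · refine ContinuousLinearMap.ext fun ⟨x, s⟩ => ?_
      rw [ContinuousLinearMap.mul_apply, extBlk_last, extBlk_last]
    · refine ContinuousLinearMap.ext fun ⟨x, s⟩ => ?_
      rw [ContinuousLinearMap.mul_apply, extBlk_castSucc, extBlk_castSucc, ← ContinuousLinearMap.mul_apply, hP.idem]
  orth i j := by
    refine Fin.lastCases ?_ (fun i => ?_) i
    · refine Fin.lastCases ?_ (fun j => ?_) j
      · intro h; exact absurd rfl h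
      · intro h
        refine ContinuousLinearMap.ext fun ⟨x, s⟩ => ?_
        rw [ContinuousLinearMap.mul_apply, extBlk_castSucc, extBlk_last]; rfl
    · refine Fin.lastCases ?_ (fun j => ?_) j
      · intro h
        refine ContinuousLinearMap.ext fun ⟨x, s⟩ => ?_
        rw [ContinuousLinearMap.mul_apply, extBlk_last, extBlk_castSucc, map_zero]; rfl
      · intro h
        refine ContinuousLinearMap.ext fun ⟨x, s⟩ => ?_
        rw [ContinuousLinearMap.mul_apply, extBlk_castSucc, extBlk_castSucc, ← ContinuousLinearMap.mul_apply,
          hP.orth i j (by rintro rfl; exact h rfl)]; rfl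
  sum := by
    refine ContinuousLinearMap.ext fun ⟨x, s⟩ => ?_
    rw [Fin.sum_univ_castSucc, add_apply, extBlk_last, sum_apply]
    simp_rw [extBlk_castSucc]
    have h : (∑ i, P i) x = x := by rw [hP.sum]; rfl
    rw [sum_apply] at h
    refine Prod.ext ?_ ?_
    · simp [Prod.fst_sum, h]
    · simp [Prod.snd_sum]

theorem lemE_aff (A : Aff G V) (hP : Blk P) (hup : ∀ g, NN P 0 (A.L g)) (C : ℝ)
    (hC : ∀ g, ‖hP.dg (A.L g)‖ ≤ C)
    (hfin : ∀ R : ℝ, (A.toEnd '' {g | ‖A.toEnd g‖ ≤ R}).Finite) (hker : VS A.toEnd.ker) : VS G := by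
  have hC0 : 0 ≤ C := (norm_nonneg _).trans (hC 1)
  refine lemE Aff.norm_one_le (extBlk_blk hP) A.toEnd ?_ (C + 1) ?_ hfin hker
  · intro g i j
    refine Fin.lastCases ?_ (fun i => ?_) i
    · refine Fin.lastCases ?_ (fun j => ?_) j
      · intro h; simp at h
      · intro h
        refine ContinuousLinearMap.ext fun ⟨x, s⟩ => ?_
        rw [ContinuousLinearMap.mul_apply, ContinuousLinearMap.mul_apply, extBlk_castSucc, A.toEnd_apply, extBlk_last]; rfl
    · refine Fin.lastCases ?_ (fun j => ?_) j
      · intro h; simp at h; omega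
      · intro h
        refine ContinuousLinearMap.ext fun ⟨x, s⟩ => ?_
        rw [ContinuousLinearMap.mul_apply, ContinuousLinearMap.mul_apply, extBlk_castSucc, A.toEnd_apply, extBlk_castSucc,
          zero_smul, add_zero]
        have := congrArg (fun f : V →L[ℝ] V => f x) (hup g i j (by simpa using h))
        simp only [ContinuousLinearMap.mul_apply] at this
        rw [this]; rfl
  · intro g
    have e : ∀ x s, (extBlk_blk hP).dg (A.toEnd g) (x, s) = (hP.dg (A.L g) x, s) := by
      intro x s
      rw [Blk.dg, Fin.sum_univ_castSucc, add_apply, sum_apply]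
      simp only [ContinuousLinearMap.mul_apply, extBlk_castSucc, extBlk_last, A.toEnd_apply, zero_smul, add_zero]
      refine Prod.ext ?_ ?_
      · simp [Prod.fst_sum, Blk.dg]
      · simp [Prod.snd_sum]
    refine ContinuousLinearMap.opNorm_le_bound _ (by positivity) fun ⟨x, s⟩ => ?_
    rw [e, Prod.norm_mk, Prod.norm_mk]
    have h1 : ‖x‖ ≤ max ‖x‖ ‖s‖ := le_max_left _ _
    have h2 : ‖s‖ ≤ max ‖x‖ ‖s‖ := le_max_right _ _
    set m := max ‖x‖ ‖s‖
    have hm : 0 ≤ m := (norm_nonneg _).trans h1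
    apply max_le
    · calc _ ≤ ‖hP.dg (A.L g)‖ * ‖x‖ := ContinuousLinearMap.le_opNorm _ _
        _ ≤ C * m := by gcongr; exact hC g
        _ ≤ _ := by nlinarith
    · nlinarith

theorem blk_one : Blk (fun _ : Fin 1 => (1 : V →L[ℝ] V)) where
  idem i := by simp
  orth i j h := absurd (Subsingleton.elim i j) h
  sum := by simp

/-- one block version -/
theorem lemE_one (A : Aff G V) (C : ℝ) (hC : ∀ g, ‖A.L g‖ ≤ C)
    (hfin : ∀ R : ℝ, (A.toEnd '' {g | ‖A.toEnd g‖ ≤ R}).Finite) (hker : VS A.toEnd.ker) : VS G := by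
  refine lemE_aff A blk_one ?_ C ?_ hfin hker
  · intro g i j h
    exfalso; omega
  · intro g
    simpa [Blk.dg] using hC g

theorem Aff.Proper.toEnd_fin {A : Aff G V} (h : A.Proper) (R : ℝ) : (A.toEnd '' {g | ‖A.toEnd g‖ ≤ R}).Finite :=
  ((h.finite_of_ball R).subset (fun g hg => (A.norm_a_le g).trans hg)).image _

theorem Aff.Free.ker {A : Aff G V} (h : A.Free) : VS A.toEnd.ker := by
  apply VS.of_comm
  have : ∀ x : A.toEnd.ker, x = 1 := by
    intro x
    obtain ⟨h1, h2⟩ := A.L_of_toEnd_eq_one (g := x.1) x.2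
    apply Subtype.ext
    apply h x.1 0
    simp [Aff.act, h2]
  intro a b
  rw [this a, this b]
end blocks

/-- main hypotheses -/
structure Hyp (A : Aff G V) (B : V →L[ℝ] V →L[ℝ] ℝ) (lam : G →* ℝ) : Prop where
  lor : Lor B
  pos : ∀ g, 0 < lam g
  iso : ∀ g x y, B (A.L g x) (A.L g y) = lam g ^ 2 * B x y
  proper : A.Proper
  cocpt : A.Cocpt
  free : A.Free

theorem Hyp.restrict {A : Aff G V} {B : V →L[ℝ] V →L[ℝ] ℝ} {lam : G →* ℝ} (h : Hyp A B lam) {H : Subgroup G}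
    (hH : H.FiniteIndex) : Hyp (A.restrict H) B (lam.comp H.subtype) where
  lor := h.lor
  pos g := h.pos g
  iso g := h.iso g
  proper := h.proper.restrict H
  cocpt := h.cocpt.restrict hH
  free := h.free.restrict H

/-- timelike line, isometric case -/
theorem vs_timelike_iso (A : Aff G V) {B : V →L[ℝ] V →L[ℝ] ℝ} (hB : Lor B)
    (hiso : ∀ g x y, B (A.L g x) (A.L g y) = B x y) (hp : A.Proper) (hf : A.Free) (v : V) (hv : B v v < 0)
    (hline : ∀ g, ∃ c : ℝ, A.L g v = c • v) : VS G := by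
  let h := (Real.sqrt (-B v v))⁻¹ • v
  have hs : 0 < Real.sqrt (-B v v) := Real.sqrt_pos.2 (by linarith)
  have hh : B h h = -1 := by
    simp only [h, map_smul, smul_apply, smul_eq_mul]
    have : Real.sqrt (-B v v) * Real.sqrt (-B v v) = -B v v := Real.mul_self_sqrt (by linarith)
    field_simp
    nlinarith
  have hline' : ∀ g, ‖A.L g h‖ ≤ ‖h‖ := by
    intro g
    obtain ⟨c, hc⟩ := hline g
    have h1 := hiso g v v
    rw [hc] at h1
    simp only [map_smul, smul_apply, smul_eq_mul] at h1
    have h2 : (c * c) = 1 := by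
      have : (c * c - 1) * B v v = 0 := by linarith
      rcases mul_eq_zero.1 this with h | h
      · linarith
      · exact absurd h hv.ne
    have h3 : A.L g h = c • h := by simp only [h, map_smul, hc]; rw [smul_comm]
    rw [h3, norm_smul]
    have : ‖c‖ = 1 := by
      rw [Real.norm_eq_abs]
      have := abs_mul_abs_self c
      nlinarith [abs_nonneg c]
    rw [this, one_mul]
  obtain ⟨M, hM, hb⟩ := hB.exists_bound ‖h‖
  exact lemE_one A M (fun g => hb (A.L g) h (hiso g) hh le_rfl (hline' g)) hp.toEnd_fin hf.ker

theorem vs_timelike {A : Aff G V} {B : V →L[ℝ] V →L[ℝ] ℝ} {lam : G →* ℝ} (h : Hyp A B lam) (v : V) (hv : B v v < 0)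
    (hline : ∀ g, ∃ c : ℝ, A.L g v = c • v) : VS G := by
  refine VS.of_ker_comm lam ?_
  refine vs_timelike_iso (A.restrict _) h.lor ?_ (h.proper.restrict _) (h.free.restrict _) v hv (fun g => hline g)
  intro g x y
  have h1 : lam g = 1 := congrArg Units.val (show lam.toHomUnits g.1 = 1 from g.2)
  rw [Aff.restrict_L, h.iso, h1]; simp

/-- null vector, isometric case -/
theorem vs_null_iso (A : Aff G V) {B : V →L[ℝ] V →L[ℝ] ℝ} (hB : Lor B)
    (hiso : ∀ g x y, B (A.L g x) (A.L g y) = B x y) (hp : A.Proper) (hf : A.Free) (u : V) (hu0 : u ≠ 0) (hu : B u u = 0)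
    (hline : ∀ g, A.L g u = u) : VS G := by
  obtain ⟨u', huu', hu'⟩ : ∃ u', B u u' = 1 ∧ B u' u' = 0 := by
    obtain ⟨e, he, _⟩ := hB.ex
    have he' : B e e < 0 := by linarith
    have h1 : B u e ≠ 0 := fun h => hu0 (hB.eq_zero_of_orth he' (by rw [hB.symm]; exact h) hu.le)
    let y := (B u e)⁻¹ • e
    have hy : B u y = 1 := by simp [y, h1]
    have hy' : B y u = 1 := by rw [hB.symm]; exact hy
    refine ⟨y - (B y y / 2) • u, by simp [hy, hu], ?_⟩
    simp only [map_sub, map_smul, sub_apply, smul_apply, smul_eq_mul, hy, hy', hu]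
    ring
  have hu'u : B u' u = 1 := by rw [hB.symm]; exact huu'
  let P0 : V →L[ℝ] V := (B u').smulRight u
  let P2 : V →L[ℝ] V := (B u).smulRight u'
  have hP0 : ∀ x, P0 x = B u' x • u := fun x => rfl
  have hP2 : ∀ x, P2 x = B u x • u' := fun x => rfl
  let P1 : V →L[ℝ] V := 1 - P0 - P2
  have hP1 : ∀ x, P1 x = x - B u' x • u - B u x • u' := fun x => rfl
  let P : Fin 3 → (V →L[ℝ] V) := ![P0, P1, P2]
  have h00 : P0 * P0 = P0 := by ext x; simp [hP0, hu'u]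
  have h22 : P2 * P2 = P2 := by ext x; simp [hP2, huu']
  have h02 : P0 * P2 = 0 := by ext x; simp [hP0, hP2, hu']
  have h20 : P2 * P0 = 0 := by ext x; simp [hP0, hP2, hu]
  have h01 : P0 * P1 = 0 := by simp only [P1, mul_sub, mul_one, h00, h02]; simp
  have h10 : P1 * P0 = 0 := by simp only [P1, sub_mul, one_mul, h00, h20]; simp
  have h21 : P2 * P1 = 0 := by simp only [P1, mul_sub, mul_one, h22, h20]; simp
  have h12 : P1 * P2 = 0 := by simp only [P1, sub_mul, one_mul, h22, h02]; simp
  have h11 : P1 * P1 = P1 := by conv_lhs => rw [show P1 * P1 = P1 * (1 - P0 - P2) from rfl, mul_sub, mul_sub, h10, h12]; simp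
  have hP : Blk P :=
    { idem := by
        intro i
        fin_cases i
        · exact h00
        · exact h11
        · exact h22
      orth := by
        intro i j h
        fin_cases i <;> fin_cases j
        · exact absurd rfl h
        · exact h01
        · exact h02
        · exact h10
        · exact absurd rfl h
        · exact h12
        · exact h20
        · exact h21
        · exact absurd rfl h
      sum := by
        rw [Fin.sum_univ_three]
        change P0 + P1 + P2 = 1
        simp only [P1]; abel }
  have hBu : ∀ g x, B u (A.L g x) = B u x := fun g x => by
    conv_lhs => rw [← hline g]
    exact hiso g u x
  have c10 : ∀ g, P1 * A.L g * P0 = 0 := by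
    intro g; ext x
    simp only [ContinuousLinearMap.mul_apply, hP0, map_smul, hline]
    simp [hP1, hu'u, hu]
  have c20 : ∀ g, P2 * A.L g * P0 = 0 := by
    intro g; ext x
    simp only [ContinuousLinearMap.mul_apply, hP0, map_smul, hline]
    simp [hP2, hu]
  have hBP1 : ∀ x, B u (P1 x) = 0 := by
    intro x; simp [hP1, huu', hu]
  have hBP1' : ∀ x, B u' (P1 x) = 0 := by
    intro x; simp [hP1, hu'u, hu']
  have c21 : ∀ g, P2 * A.L g * P1 = 0 := by
    intro g; ext x
    simp only [ContinuousLinearMap.mul_apply, hP2, hBu, hBP1]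
    simp
  have c00 : ∀ g, P0 * A.L g * P0 = P0 := by
    intro g; ext x
    simp only [ContinuousLinearMap.mul_apply, hP0, map_smul, hline, hu'u]
    simp
  have c22 : ∀ g, P2 * A.L g * P2 = P2 := by
    intro g; ext x
    simp only [ContinuousLinearMap.mul_apply, hP2, hBu]
    simp [huu']
  -- bound for the middle block
  let v : V := (Real.sqrt 2)⁻¹ • (u - u')
  have hv : B v v = -1 := by
    simp only [v, map_sub, map_smul, sub_apply, smul_apply, smul_eq_mul, hu, huu', hu'u, hu']
    have : Real.sqrt 2 * Real.sqrt 2 = 2 := Real.mul_self_sqrt (by norm_num)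
    field_simp
    nlinarith
  obtain ⟨c, hc, hlow⟩ := hB.exists_lower ‖v‖
  have hQ : ∀ g x, B (P1 (A.L g (P1 x))) (P1 (A.L g (P1 x))) = B (P1 x) (P1 x) := by
    intro g x
    rw [← hiso g (P1 x) (P1 x)]
    set z := A.L g (P1 x) with hz
    have h1 : B u z = 0 := by rw [hz, hBu, hBP1]
    have h1' : B z u = 0 := by rw [hB.symm]; exact h1
    rw [hP1 z, h1]
    simp [h1, h1', hu]
  have hlow' : ∀ x, c * ‖P1 x‖ ^ 2 ≤ B (P1 x) (P1 x) := by
    intro x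
    have := hlow v (P1 x) hv le_rfl
    have h0 : B (P1 x) v = 0 := by
      rw [hB.symm]
      simp [v, hBP1, hBP1']
    rw [h0] at this
    simpa using this
  let M := Real.sqrt (‖B‖ * ‖P1‖ ^ 2 / c)
  have hmid : ∀ g, ‖P1 * A.L g * P1‖ ≤ M := by
    intro g
    refine ContinuousLinearMap.opNorm_le_bound _ (Real.sqrt_nonneg _) fun x => ?_
    change ‖P1 (A.L g (P1 x))‖ ≤ _
    have h1 := hlow' (A.L g (P1 x))
    rw [hQ] at h1
    have h2 : B (P1 x) (P1 x) ≤ ‖B‖ * ‖P1 x‖ * ‖P1 x‖ := (le_abs_self _).trans (B.le_opNorm₂ _ _)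
    have h3 : ‖P1 x‖ ≤ ‖P1‖ * ‖x‖ := P1.le_opNorm x
    have h4 : ‖B‖ * ‖P1 x‖ * ‖P1 x‖ ≤ ‖B‖ * (‖P1‖ * ‖x‖) * (‖P1‖ * ‖x‖) := by gcongr
    apply le_of_sq_le_sq _ (by positivity)
    rw [mul_pow, Real.sq_sqrt (by positivity), div_mul_eq_mul_div, le_div_iff₀ hc]
    nlinarith
  refine lemE_aff A hP ?_ (‖P0‖ + M + ‖P2‖) ?_ hp.toEnd_fin hf.ker
  · intro g i j hij
    fin_cases i <;> fin_cases j <;> simp at hij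
    · exact c10 g
    · exact c20 g
    · exact c21 g
  · intro g
    rw [Blk.dg, Fin.sum_univ_three]
    change ‖P0 * A.L g * P0 + P1 * A.L g * P1 + P2 * A.L g * P2‖ ≤ _
    rw [c00, c22]
    refine (norm_add_le _ _).trans (add_le_add ((norm_add_le _ _).trans (add_le_add le_rfl (hmid g))) le_rfl)

theorem vs_null {A : Aff G V} {B : V →L[ℝ] V →L[ℝ] ℝ} {lam : G →* ℝ} (h : Hyp A B lam) (u : V) (hu0 : u ≠ 0) (hu : B u u = 0)
    (hline : ∀ g, ∃ c : ℝ, A.L g u = c • u) : VS G := by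
  choose α hα using hline
  have hinj : ∀ c d : ℝ, c • u = d • u → c = d := fun c d hcd => smul_left_injective ℝ hu0 hcd
  let f : G →* ℝ × ℝ :=
    { toFun := fun g => (lam g, α g)
      map_one' := by
        refine Prod.ext (map_one lam) (hinj _ _ ?_)
        rw [← hα, A.L_one]; simp
      map_mul' := fun x y => by
        refine Prod.ext (map_mul lam x y) (hinj _ _ ?_)
        rw [← hα, A.L_mul, hα y, map_smul, hα x, smul_smul, mul_comm]; rfl }
  refine VS.of_ker_comm f ?_
  have hk : ∀ g : f.toHomUnits.ker, lam g = 1 ∧ α g = 1 := by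
    intro g
    have h1 : f g = 1 := congrArg Units.val (show f.toHomUnits g.1 = 1 from g.2)
    exact ⟨congrArg Prod.fst h1, congrArg Prod.snd h1⟩
  refine vs_null_iso (A.restrict _) h.lor ?_ (h.proper.restrict _) (h.free.restrict _) u hu0 hu ?_
  · intro g x y
    rw [Aff.restrict_L, h.iso, (hk g).1]; simp
  · intro g
    rw [Aff.restrict_L, hα, (hk g).2, one_smul]

end LS


namespace LS
open Filter Topology

variable {V : Type*} [NormedAddCommGroup V] [NormedSpace ℝ V] [FiniteDimensional ℝ V]
variable {G : Type*} [Group G]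

/-- invariant subspace for a subgroup -/
def Inv (A : Aff G V) (K : Subgroup G) (W : Submodule ℝ V) : Prop := ∀ k ∈ K, ∀ w ∈ W, A.L k w ∈ W

/-- strongly irreducible Lorentzian subspace -/
structure SI (A : Aff G V) (B : V →L[ℝ] V →L[ℝ] ℝ) (W : Submodule ℝ V) : Prop where
  tl : ∃ v ∈ W, B v v < 0
  inv : ∀ g, ∀ w ∈ W, A.L g w ∈ W
  irr : ∀ K : Subgroup G, K.FiniteIndex → ∀ W' ≤ W, Inv A K W' → W' = ⊥ ∨ W' = W
  dim : 2 ≤ Module.finrank ℝ W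

theorem reduction {A : Aff G V} {B : V →L[ℝ] V →L[ℝ] ℝ} {lam : G →* ℝ} (h : Hyp A B lam) :
    VS G ∨ ∃ (K : Subgroup G) (W : Submodule ℝ V), K.FiniteIndex ∧ SI (A.restrict K) B W := by
  classical
  have hB := h.lor
  obtain ⟨e, he, _⟩ := h.lor.ex
  let Pn : ℕ → Prop := fun n => ∃ (K : Subgroup G) (W : Submodule ℝ V), K.FiniteIndex ∧ Inv A K W ∧
    (∃ v ∈ W, B v v < 0) ∧ Module.finrank ℝ W = n
  have hPn : ∃ n, Pn n := ⟨_, ⊤, ⊤, inferInstance, fun _ _ _ _ => trivial, ⟨e, trivial, by linarith⟩, rfl⟩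
  obtain ⟨K, W, hK, hInv, ⟨v, hvW, hv⟩, hn⟩ := Nat.find_spec hPn
  have hmin : ∀ (K' : Subgroup G) (W' : Submodule ℝ V), K'.FiniteIndex → Inv A K' W' → (∃ v ∈ W', B v v < 0) →
      Module.finrank ℝ W ≤ Module.finrank ℝ W' := by
    intro K' W' h1 h2 h3
    rw [hn]
    exact Nat.find_min' hPn ⟨K', W', h1, h2, h3, rfl⟩
  have hv0 : v ≠ 0 := by rintro rfl; simp at hv
  have hpos : 0 < Module.finrank ℝ W := by
    rw [Module.finrank_pos_iff_exists_ne_zero]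
    exact ⟨⟨v, hvW⟩, fun hc => hv0 (congrArg Subtype.val hc)⟩
  by_cases h1 : Module.finrank ℝ W = 1
  · left
    refine VS.of_finiteIndex hK (vs_timelike (h.restrict hK) v hv ?_)
    intro g
    have h2 := (finrank_eq_one_iff_of_nonzero' (⟨v, hvW⟩ : W) (fun hc => hv0 (congrArg Subtype.val hc))).1 h1
    obtain ⟨c, hc⟩ := h2 ⟨A.L g v, hInv g g.2 v hvW⟩
    exact ⟨c, (congrArg Subtype.val hc).symm⟩
  by_cases hirr : ∀ K' : Subgroup G, K'.FiniteIndex → ∀ W' ≤ W, Inv A K' W' → W' = ⊥ ∨ W' = W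
  · right
    refine ⟨K, W, hK, ⟨v, hvW, hv⟩, fun g w hw => hInv g g.2 w hw, ?_, by omega⟩
    intro K' hK' W' hW' hI
    refine hirr (K'.map K.subtype) ?_ W' hW' ?_
    · refine ⟨?_⟩
      rw [Subgroup.index_map, Subgroup.range_subtype]
      simp only [Subgroup.ker_subtype, sup_bot_eq]
      exact mul_ne_zero hK'.index_ne_zero hK.index_ne_zero
    · rintro _ ⟨k, hk, rfl⟩ w hw
      exact hI k hk w hw
  left
  push Not at hirr
  obtain ⟨K', hK', W', hW'W, hI, hbot, hne⟩ := hirr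
  let K2 : Subgroup G := K ⊓ K'
  have hK2 : K2.FiniteIndex := inferInstance
  have hlt : Module.finrank ℝ W' < Module.finrank ℝ W := Submodule.finrank_lt_finrank_of_lt (lt_of_le_of_ne hW'W hne)
  have hnn : ∀ x ∈ W', 0 ≤ B x x := by
    intro x hx
    by_contra hc
    push Not at hc
    have := hmin K' W' hK' hI ⟨x, hx, hc⟩
    omega
  have hrad : ∀ x ∈ W', B x x = 0 → ∀ y ∈ W', B x y = 0 := by
    intro x hx hx0 y hy
    by_contra hc
    obtain ⟨t, ht⟩ : ∃ t : ℝ, t * B x y = (B y y + 1) / 2 := ⟨(B y y + 1) / 2 / B x y, by field_simp⟩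
    have h3 := hnn (y - t • x) (W'.sub_mem hy (W'.smul_mem _ hx))
    simp only [map_sub, map_smul, sub_apply, smul_apply, smul_eq_mul, hx0, hB.symm y x] at h3
    linarith
  by_cases hnull : ∃ x ∈ W', x ≠ 0 ∧ B x x = 0
  · obtain ⟨u, huW, hu0, hu⟩ := hnull
    refine VS.of_finiteIndex hK' (vs_null (h.restrict hK') u hu0 hu ?_)
    intro g
    have h3 : A.L g u ∈ W' := hI g g.2 u huW
    exact hB.null_orth hu0 hu (hrad u huW hu _ h3) (by rw [Aff.restrict_L, h.iso, hu, mul_zero])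
  exfalso
  push Not at hnull
  obtain ⟨p, hp1, hp2, hp3⟩ := Lor.exists_proj' (B := B) W' (by
    intro s hs hs'
    by_contra hc
    exact hnull s hs hc (hs' s hs))
  let W'' : Submodule ℝ V :=
    { carrier := {x | x ∈ W ∧ ∀ y ∈ W', B x y = 0}
      add_mem' := by
        rintro a b ⟨ha, ha'⟩ ⟨hb, hb'⟩
        exact ⟨W.add_mem ha hb, fun y hy => by rw [map_add, add_apply, ha' y hy, hb' y hy, add_zero]⟩
      zero_mem' := ⟨W.zero_mem, fun y _ => by simp⟩
      smul_mem' := by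
        rintro c a ⟨ha, ha'⟩
        exact ⟨W.smul_mem c ha, fun y hy => by rw [map_smul, smul_apply, ha' y hy, smul_zero]⟩ }
  have hW''W : W'' ≤ W := fun x hx => hx.1
  have hI'' : Inv A K2 W'' := by
    rintro k ⟨hk, hk'⟩ w ⟨hw, hw'⟩
    refine ⟨hInv k hk w hw, fun y hy => ?_⟩
    rw [← A.L_L_inv k y, h.iso, hw' _ (hI _ (K'.inv_mem hk') y hy), mul_zero]
  have htl : ∃ x ∈ W'', B x x < 0 := by
    refine ⟨p v, ⟨?_, hp3 v⟩, ?_⟩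
    · have := W.sub_mem hvW (hW'W (hp2 v))
      simpa using this
    · have h3 := hnn _ (hp2 v)
      have h4 := hp3 v _ (hp2 v)
      have h5 : B v v = B (p v) (p v) + B (v - p v) (v - p v) := by
        have h4' : B (v - p v) (p v) = 0 := by rw [hB.symm]; exact h4
        have e : v = p v + (v - p v) := by abel
        conv_lhs => rw [e]
        rw [map_add, map_add, add_apply, add_apply, h4, h4']; ring
      linarith
  have h6 := hmin K2 W'' hK2 hI'' htl
  have h7 : W'' = W := Submodule.eq_of_le_of_finrank_le hW''W h6
  apply hbot
  rw [Submodule.eq_bot_iff]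
  intro x hx
  by_contra hc
  have h8 : x ∈ W'' := by rw [h7]; exact hW'W hx
  exact hnull x hx hc (h8.2 x hx)

theorem Lor.nondeg {B : V →L[ℝ] V →L[ℝ] ℝ} (hB : Lor B) {x : V} (h : ∀ y, B x y = 0) : x = 0 := by
  obtain ⟨e, he, _⟩ := hB.ex
  exact hB.eq_zero_of_orth (v := e) (by linarith) (by rw [hB.symm]; exact h e) (h x).le

theorem Lor.exists_orth {B : V →L[ℝ] V →L[ℝ] ℝ} (hB : Lor B) (S : Submodule ℝ V) (hS : S ≠ ⊤) :
    ∃ w ≠ 0, ∀ s ∈ S, B w s = 0 := by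
  obtain ⟨f, hf0, hf⟩ := Submodule.exists_le_ker_of_lt_top S (lt_top_iff_ne_top.2 hS)
  let φ : V →ₗ[ℝ] Module.Dual ℝ V :=
    { toFun := fun x => (B x).toLinearMap
      map_add' := fun x y => by ext; simp
      map_smul' := fun c x => by ext; simp }
  have hinj : Function.Injective φ := by
    rw [← LinearMap.ker_eq_bot, LinearMap.ker_eq_bot']
    intro x hx
    apply hB.nondeg
    intro y
    exact congrArg (fun f : Module.Dual ℝ V => f y) hx
  have hsurj : Function.Surjective φ :=
    (LinearMap.injective_iff_surjective_of_finrank_eq_finrank (Subspace.dual_finrank_eq.symm)).1 hinj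
  obtain ⟨w, hw⟩ := hsurj f
  refine ⟨w, ?_, fun s hs => ?_⟩
  · rintro rfl; apply hf0; rw [← hw]; simp
  · have : f s = 0 := hf hs
    rw [← hw] at this
    exact this

theorem Aff.Free.fixed {A : Aff G V} (h : A.Free) [Nontrivial V] (g : G) : ∃ x ≠ 0, A.L g x = x := by
  by_cases hg : g = 1
  · obtain ⟨x, hx⟩ := exists_ne (0 : V)
    exact ⟨x, hx, by rw [hg, A.L_one]⟩
  by_contra hc
  push Not at hc
  have hinj : Function.Injective ((A.L g - 1 : V →L[ℝ] V) : V →ₗ[ℝ] V) := by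
    rw [← LinearMap.ker_eq_bot, LinearMap.ker_eq_bot']
    intro x hx
    by_contra h0
    exact hc x h0 (sub_eq_zero.1 hx)
  obtain ⟨x, hx⟩ := LinearMap.injective_iff_surjective.1 hinj (- A.a g)
  apply hg
  apply h g x
  have hx' : A.L g x - x = - A.a g := hx
  rw [Aff.act, ← sub_eq_zero, show A.L g x + A.a g - x = (A.L g x - x) + A.a g by abel, hx']
  simp

/-- no contractions -/
theorem lam_not_lt {A : Aff G V} {B : V →L[ℝ] V →L[ℝ] ℝ} {lam : G →* ℝ} (h : Hyp A B lam) {W : Submodule ℝ V}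
    (hW : SI A B W) (γ : G) : ¬ lam γ < 1 := by
  intro hlt
  have hB := h.lor
  have hpos := h.pos γ
  set l := lam γ with hl
  have hl2 : l ^ 2 < 1 := by nlinarith
  have hl0 : 0 < l ^ 2 := by positivity
  obtain ⟨v0, hv0W, hv0⟩ := hW.tl
  have : Nontrivial V := ⟨v0, 0, by rintro rfl; simp at hv0⟩
  obtain ⟨v, hvne, hv⟩ := h.free.fixed γ
  have hvQ : B v v = 0 := by
    have := h.iso γ v v
    rw [hv, ← hl] at this
    have h3 : (1 - l ^ 2) * B v v = 0 := by linarith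
    rcases mul_eq_zero.1 h3 with h4 | h4
    · linarith
    · exact h4
  -- the dual vector
  obtain ⟨w, hwne, hw⟩ : ∃ w ≠ 0, ∀ x, B w (A.L γ x) = B w x := by
    obtain ⟨w, hw0, hw⟩ := hB.exists_orth (LinearMap.range ((A.L γ - 1 : V →L[ℝ] V) : V →ₗ[ℝ] V)) (by
      intro hc
      rw [LinearMap.range_eq_top] at hc
      have hinj := LinearMap.injective_iff_surjective.2 hc
      apply hvne
      apply hinj
      change A.L γ v - v = A.L γ 0 - 0
      rw [hv]; simp)
    refine ⟨w, hw0, fun x => ?_⟩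
    have := hw (A.L γ x - x) ⟨x, rfl⟩
    rw [map_sub, sub_eq_zero] at this
    exact this
  have hMw : A.L γ w = l ^ 2 • w := by
    rw [← sub_eq_zero]
    apply hB.nondeg
    intro y
    rw [← A.L_L_inv γ y, map_sub, sub_apply, h.iso, map_smul, smul_apply, hw, ← hl, smul_eq_mul, sub_self]
  have hwQ : B w w = 0 := by
    have h1 := hw w
    rw [hMw, map_smul, smul_eq_mul] at h1
    have h3 : (1 - l ^ 2) * B w w = 0 := by linarith
    rcases mul_eq_zero.1 h3 with h4 | h4
    · linarith
    · exact h4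
  have hvw : B v w ≠ 0 := by
    intro hc
    obtain ⟨c, rfl⟩ := hB.null_orth hvne hvQ hc hwQ.le
    rw [map_smul, hv] at hMw
    have h3 : (1 - l ^ 2) • (c • v) = 0 := by rw [sub_smul, one_smul, ← hMw, sub_self]
    rcases smul_eq_zero.1 h3 with h4 | h4
    · linarith
    · exact hwne h4
  -- powers
  have hvk : ∀ k : ℕ, A.L (γ ^ k) v = v := by
    intro k
    induction k with
    | zero => rw [pow_zero, A.L_one]
    | succ k ih => rw [pow_succ, A.L_mul, hv, ih]
  have hwk : ∀ k : ℕ, ∀ x, B w (A.L (γ ^ k) x) = B w x := by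
    intro k
    induction k with
    | zero => intro x; rw [pow_zero, A.L_one]
    | succ k ih => intro x; rw [pow_succ, A.L_mul, ih, hw]
  have hisok : ∀ (k : ℕ) x y, B (A.L (γ ^ k) x) (A.L (γ ^ k) y) = (l ^ 2) ^ k * B x y := by
    intro k x y
    rw [h.iso, map_pow, ← hl, ← pow_mul, ← pow_mul, mul_comm k 2]
  have key : ∀ η, B (A.L η v) w = B v w := by
    intro η
    have hx : ∀ k : ℕ, ∃ x, ‖x‖ = 1 ∧ A.L (γ ^ k) (A.L η x) = x := by
      intro k
      obtain ⟨x, hx0, hx⟩ := h.free.fixed (γ ^ k * η)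
      refine ⟨‖x‖⁻¹ • x, by simp [norm_smul, hx0], ?_⟩
      rw [map_smul, map_smul, ← A.L_mul, hx]
    choose x hx1 hx2 using hx
    have : ProperSpace V := FiniteDimensional.proper ℝ V
    obtain ⟨y, hy, φ, hφ, hlim⟩ := (isCompact_sphere (0 : V) 1).tendsto_subseq (x := x) (fun k => by simpa using hx1 k)
    have hlk : Tendsto (fun k => (l ^ 2) ^ (φ k)) atTop (𝓝 0) :=
      (tendsto_pow_atTop_nhds_zero_of_lt_one hl0.le hl2).comp hφ.tendsto_atTop
    have e1 : B y y = 0 := by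
      have h1 : Tendsto (fun k => B (x (φ k)) (x (φ k))) atTop (𝓝 (B y y)) :=
        ((by fun_prop : Continuous fun z => B z z).tendsto y).comp hlim
      have h2 : Tendsto (fun k => (l ^ 2) ^ (φ k) * B (A.L η (x (φ k))) (A.L η (x (φ k)))) atTop (𝓝 (0 * B (A.L η y) (A.L η y))) :=
        hlk.mul (((by fun_prop : Continuous fun z => B (A.L η z) (A.L η z)).tendsto y).comp hlim)
      rw [zero_mul] at h2
      refine tendsto_nhds_unique h1 (h2.congr fun k => ?_)
      rw [← hisok, hx2]
    have e2 : B v y = 0 := by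
      have h1 : Tendsto (fun k => B v (x (φ k))) atTop (𝓝 (B v y)) :=
        ((by fun_prop : Continuous fun z => B v z).tendsto y).comp hlim
      have h2 : Tendsto (fun k => (l ^ 2) ^ (φ k) * B v (A.L η (x (φ k)))) atTop (𝓝 (0 * B v (A.L η y))) :=
        hlk.mul (((by fun_prop : Continuous fun z => B v (A.L η z)).tendsto y).comp hlim)
      rw [zero_mul] at h2
      refine tendsto_nhds_unique h1 (h2.congr fun k => ?_)
      rw [← hisok, hx2, hvk]
    have e3 : B w (A.L η y) = B w y := by
      have h1 : Tendsto (fun k => B w (x (φ k))) atTop (𝓝 (B w y)) :=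
        ((by fun_prop : Continuous fun z => B w z).tendsto y).comp hlim
      have h2 : Tendsto (fun k => B w (A.L η (x (φ k)))) atTop (𝓝 (B w (A.L η y))) :=
        ((by fun_prop : Continuous fun z => B w (A.L η z)).tendsto y).comp hlim
      refine tendsto_nhds_unique h2 (h1.congr fun k => ?_)
      rw [← hwk (φ k) (A.L η _), hx2]
    obtain ⟨c, rfl⟩ := hB.null_orth hvne hvQ e2 e1.le
    have hc : c ≠ 0 := by
      rintro rfl
      simp at hy
    rw [map_smul, map_smul, map_smul] at e3
    have := smul_right_injective ℝ hc e3
    rw [hB.symm, this, hB.symm]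
  -- v in W
  obtain ⟨p, hp1, hp2, hp3⟩ := hB.exists_proj W hW.tl
  have hpr : IsPr B W p := ⟨hp1, hp2, hp3⟩
  have hvW : v ∈ W := by
    apply hpr.mem
    by_contra hc
    have h1 := hpr.pos hB hW.tl hc
    have h2 := hpr.comm hB hW.tl A lam h.iso hW.inv γ v
    rw [hv] at h2
    have h3 := h.iso γ (p v) (p v)
    rw [← h2, ← hl] at h3
    nlinarith
  let D : Submodule ℝ V := Submodule.span ℝ (Set.range fun q : G × G => A.L q.1 v - A.L q.2 v)
  have hDW : D ≤ W := by
    rw [Submodule.span_le]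
    rintro _ ⟨q, rfl⟩
    exact W.sub_mem (hW.inv _ _ hvW) (hW.inv _ _ hvW)
  have hDinv : Inv A ⊤ D := by
    intro k _ x hx
    refine Submodule.span_induction (p := fun x _ => A.L k x ∈ D) ?_ ?_ ?_ ?_ hx
    · rintro _ ⟨q, rfl⟩
      refine Submodule.subset_span ⟨(k * q.1, k * q.2), ?_⟩
      simp [A.L_mul]
    · simp
    · intro x y _ _ h1 h2
      rw [map_add]; exact D.add_mem h1 h2
    · intro c x _ h1
      rw [map_smul]; exact D.smul_mem c h1
  have hDw : ∀ x ∈ D, B x w = 0 := by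
    intro x hx
    refine Submodule.span_induction (p := fun x _ => B x w = 0) ?_ ?_ ?_ ?_ hx
    · rintro _ ⟨q, rfl⟩
      simp only [map_sub, sub_apply, key, sub_self]
    · simp
    · intro x y _ _ h1 h2
      rw [map_add, add_apply, h1, h2, add_zero]
    · intro c x _ h1
      rw [map_smul, smul_apply, h1, smul_zero]
  rcases hW.irr ⊤ inferInstance D hDW hDinv with h1 | h1
  · have hfix : ∀ η, A.L η v = v := by
      intro η
      have : A.L η v - A.L 1 v ∈ D := Submodule.subset_span ⟨(η, 1), rfl⟩
      rw [h1, Submodule.mem_bot, A.L_one, sub_eq_zero] at this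
      exact this
    have h2 := hW.irr ⊤ inferInstance (Submodule.span ℝ {v}) (by simpa using hvW) (by
      intro k _ x hx
      obtain ⟨c, rfl⟩ := Submodule.mem_span_singleton.1 hx
      rw [map_smul, hfix]
      exact hx)
    rcases h2 with h2 | h2
    · exact hvne (by simpa using h2)
    · have := hW.dim
      rw [← h2, finrank_span_singleton hvne] at this
      omega
  · exact hvw (hDw v (h1 ▸ hvW))

theorem lam_eq_one {A : Aff G V} {B : V →L[ℝ] V →L[ℝ] ℝ} {lam : G →* ℝ} (h : Hyp A B lam) {W : Submodule ℝ V}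
    (hW : SI A B W) (γ : G) : lam γ = 1 := by
  have h1 := lam_not_lt h hW γ
  have h2 := lam_not_lt h hW γ⁻¹
  have h3 : lam γ * lam γ⁻¹ = 1 := by rw [← map_mul]; simp
  have := h.pos γ
  have := h.pos γ⁻¹
  push Not at h1 h2
  nlinarith

end LS


namespace LS
open Filter Topology

theorem normalized_domain {W R G : Type*} [Group G] [AddCommGroup W] [Module ℝ W] [FiniteDimensional ℝ W] [Nontrivial W]
    [CommRing R] [Algebra ℝ R] [FiniteDimensional ℝ R] [Module R W] [IsScalarTower ℝ R W]
    (hfaith : ∀ r : R, (∀ w : W, r • w = 0) → r = 0) (σ : G →* Module.End ℝ W) (α : G → R →+* R)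
    (hα : ∀ g r w, σ g (r • w) = α g r • σ g w)
    (hirr : ∀ K : Subgroup G, K.FiniteIndex → ∀ W' : Submodule ℝ W, (∀ k ∈ K, ∀ w ∈ W', σ k w ∈ W') → W' = ⊥ ∨ W' = ⊤) :
    IsField R := by
  classical
  have hσ : ∀ g w, σ g (σ g⁻¹ w) = w := by
    intro g w
    change (σ g * σ g⁻¹) w = w
    rw [← map_mul]; simp
  have hext : ∀ r r' : R, (∀ w : W, r • w = r' • w) → r = r' := by
    intro r r' h
    rw [← sub_eq_zero]
    apply hfaith
    intro w
    rw [sub_smul, h, sub_self]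
  have hmul : ∀ g g' r, α (g * g') r = α g (α g' r) := by
    intro g g' r
    apply hext
    intro w
    rw [← hσ (g * g') w, ← hα, map_mul, Module.End.mul_apply, hα, hα]
    simp
  have hone : ∀ r, α 1 r = r := by
    intro r
    apply hext
    intro w
    have := hα 1 r w
    simpa using this.symm
  have hinv : ∀ g r, α g (α g⁻¹ r) = r := by
    intro g r; rw [← hmul]; simp [hone]
  have hinv' : ∀ g r, α g⁻¹ (α g r) = r := by
    intro g r; rw [← hmul]; simp [hone]
  have : Nontrivial R := by
    obtain ⟨w, hw⟩ := exists_ne (0 : W)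
    refine ⟨1, 0, fun h => hw ?_⟩
    rw [← one_smul R w, h, zero_smul]
  obtain ⟨m, hm⟩ := Ideal.exists_maximal R
  have : IsArtinianRing R := IsArtinianRing.of_finite ℝ R
  let H : Subgroup G :=
    { carrier := {g | ∀ r, r ∈ m ↔ α g r ∈ m}
      mul_mem' := by
        intro a b ha hb r
        rw [hmul, ← ha, ← hb]
      one_mem' := by intro r; rw [hone]
      inv_mem' := by
        intro a ha r
        rw [ha (α a⁻¹ r), hinv] }
  have hH : H.FiniteIndex := by
    let c : G → MaximalSpectrum R := fun g => ⟨m.comap (α g⁻¹),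
      Ideal.comap_isMaximal_of_surjective _ (fun r => ⟨α g r, hinv' g r⟩)⟩
    refine finiteIndex_of_color H c (Set.toFinite _) ?_
    intro g g' h r
    have h1 : m.comap (α g⁻¹) = m.comap (α g'⁻¹) := congrArg MaximalSpectrum.asIdeal h
    have h2 : α g' r ∈ m.comap (α g⁻¹) ↔ α g' r ∈ m.comap (α g'⁻¹) := by rw [h1]
    rw [Ideal.mem_comap, Ideal.mem_comap, hinv', ← hmul] at h2
    exact h2.symm
  have hfin : Module.Finite R W := Module.Finite.of_restrictScalars_finite ℝ R W
  rcases hirr H hH ((m • (⊤ : Submodule R W)).restrictScalars ℝ) (by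
    intro k hk w hw
    rw [Submodule.restrictScalars_mem] at hw ⊢
    refine Submodule.smul_induction_on (p := fun w => σ k w ∈ m • (⊤ : Submodule R W)) hw ?_ ?_
    · intro r hr n _
      rw [hα]
      exact Submodule.smul_mem_smul ((hk r).1 hr) Submodule.mem_top
    · intro x y hx hy
      rw [map_add]; exact Submodule.add_mem _ hx hy) with h | h
  · have hm0 : m = ⊥ := by
      rw [Submodule.eq_bot_iff]
      intro r hr
      apply hfaith
      intro w
      have h0 : r • w ∈ m • (⊤ : Submodule R W) := Submodule.smul_mem_smul hr Submodule.mem_top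
      have := (Submodule.restrictScalars_mem ℝ _ _).2 h0
      rw [h] at this
      simpa using this
    rw [hm0] at hm
    exact Ring.isField_iff_isSimpleOrder_ideal.2 (by
      have := hm.out
      exact ⟨fun I => by
        by_cases hI : I = ⊥
        · exact Or.inl hI
        · exact Or.inr (this.2 I (bot_lt_iff_ne_bot.2 hI))⟩)
  · exfalso
    obtain ⟨r, hr, hr0⟩ := Submodule.exists_sub_one_mem_and_smul_eq_zero_of_fg_of_le_smul m (⊤ : Submodule R W) hfin.fg_top (by
      intro w _
      have : w ∈ ((m • (⊤ : Submodule R W)).restrictScalars ℝ) := by rw [h]; exact Submodule.mem_top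
      exact (Submodule.restrictScalars_mem ℝ _ _).1 this)
    have : r = 0 := hfaith r (fun w => hr0 w Submodule.mem_top)
    rw [this, zero_sub] at hr
    exact hm.ne_top ((Ideal.eq_top_iff_one m).2 (by simpa using m.neg_mem hr))

/-- a skew element of a field acting on a Lorentz space vanishes -/
theorem skew_zero {V : Type*} [NormedAddCommGroup V] [NormedSpace ℝ V] [FiniteDimensional ℝ V] {B : V →L[ℝ] V →L[ℝ] ℝ}
    (hB : Lor B) (W : Submodule ℝ V) (hW : ∃ v ∈ W, B v v < 0) {R : Type*} [CommRing R] [IsDomain R] [Algebra ℝ R]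
    [FiniteDimensional ℝ R] (f : R →ₐ[ℝ] Module.End ℝ W) (hf : Function.Injective f) (s : R)
    (hs : ∀ x y : W, B (f s x : V) y = - B (x : V) (f s y : V)) : s = 0 := by
  obtain ⟨v, hvW, hv⟩ := hW
  have hIntg : IsIntegral ℝ s := Algebra.IsIntegral.isIntegral s
  have hirr := minpoly.irreducible hIntg
  have hsc : ∀ r : ℝ, s = algebraMap ℝ R r → s = 0 := by
    intro r hr
    have h1 := hs ⟨v, hvW⟩ ⟨v, hvW⟩
    have h2 : (f s ⟨v, hvW⟩ : W) = r • ⟨v, hvW⟩ := by rw [hr, AlgHom.commutes]; rfl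
    rw [h2] at h1
    simp only [Submodule.coe_smul, map_smul, smul_apply, smul_eq_mul] at h1
    have h3 : r * B v v = 0 := by linarith
    rcases mul_eq_zero.1 h3 with h4 | h4
    · rw [hr, h4, map_zero]
    · linarith
  by_cases hroot : ∃ r, (minpoly ℝ s).IsRoot r
  · obtain ⟨r, hr⟩ := hroot
    have h1 := minpoly.root hIntg hr
    exact hsc r h1.symm
  push Not at hroot
  have hmon := minpoly.monic hIntg
  have hdeg : (minpoly ℝ s).natDegree ≤ 2 := hirr.natDegree_le_two
  set P := minpoly ℝ s with hP
  have hpos : 0 < P.natDegree := minpoly.natDegree_pos hIntg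
  have h2 : P.natDegree = 2 := by
    by_contra hc
    have h1 : P.natDegree = 1 := by omega
    obtain ⟨r, hr⟩ := Polynomial.exists_root_of_degree_eq_one (p := P) (by
      rw [Polynomial.degree_eq_natDegree hmon.ne_zero, h1]; rfl)
    exact hroot r hr
  have hlead : P.coeff 2 = 1 := by rw [← h2]; exact hmon
  have hev : s * s + algebraMap ℝ R (P.coeff 1) * s + algebraMap ℝ R (P.coeff 0) = 0 := by
    have := minpoly.aeval ℝ s
    rw [← hP, Polynomial.aeval_eq_sum_range, h2] at this
    simp only [Finset.sum_range_succ, Finset.sum_range_zero, hlead, Algebra.smul_def, map_one] at this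
    rw [← this]; ring
  have hq : ∀ r : ℝ, r * r + P.coeff 1 * r + P.coeff 0 ≠ 0 := by
    intro r hr
    apply hroot r
    rw [Polynomial.IsRoot, Polynomial.eval_eq_sum_range, h2]
    simp only [Finset.sum_range_succ, Finset.sum_range_zero, hlead]
    linarith
  by_contra hs0
  let x : W := ⟨v, hvW⟩
  have hfx : f s (f s x) + P.coeff 1 • f s x + P.coeff 0 • x = 0 := by
    have := congrArg (fun z => f z x) hev
    simpa [Algebra.smul_def] using this
  have h3 : B v (f s x : V) = 0 := by
    have := hs x x
    rw [hB.symm] at this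
    change B v (f s x : V) = - B v (f s x : V) at this
    linarith
  have h4 : B (f s x : V) (f s x : V) = P.coeff 0 * B v v := by
    have h5 := hs (f s x) x
    have h6 : (f s (f s x) : V) = - (P.coeff 1 • (f s x : V)) - P.coeff 0 • v := by
      have := congrArg (fun z : W => (z : V)) hfx
      simp only [Submodule.coe_add, Submodule.coe_smul, Submodule.coe_zero] at this
      rw [eq_sub_iff_add_eq, eq_neg_iff_add_eq_zero, ← this]
      change _ + P.coeff 0 • (x : V) + _ = _
      abel
    rw [h6] at h5
    change B _ v = _ at h5
    simp only [map_sub, map_neg, map_smul, sub_apply, neg_apply, smul_apply, smul_eq_mul] at h5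
    rw [hB.symm (f s x : V) v, h3] at h5
    linarith
  have h5 : (0 : ℝ) ≤ B (f s x : V) (f s x : V) := hB.nonneg_of_orth hv h3
  have h6 : P.coeff 0 ≤ 0 := by
    by_contra hc; push Not at hc; nlinarith
  have hd : 0 ≤ P.coeff 1 ^ 2 - 4 * P.coeff 0 := by nlinarith [sq_nonneg (P.coeff 1)]
  apply hq ((- P.coeff 1 + √(P.coeff 1 ^ 2 - 4 * P.coeff 0)) / 2)
  nlinarith [Real.sq_sqrt hd]
end LS


namespace LS
open Filter Topology
universe u

theorem stab {E : Type*} [AddCommGroup E] [Module ℝ E] [FiniteDimensional ℝ E] (S : ℝ → Submodule ℝ E)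
    (hanti : ∀ ε ε', ε ≤ ε' → S ε' ≤ S ε) {ε1 : ℝ} (h1 : 0 < ε1) :
    ∃ ε0, 0 < ε0 ∧ ε0 ≤ ε1 ∧ ∀ ε, 0 < ε → ε ≤ ε0 → S ε = S ε0 := by
  let X : Set ℕ := {n | ∃ ε, 0 < ε ∧ ε ≤ ε1 ∧ Module.finrank ℝ (S ε) = n}
  have hne : X.Nonempty := ⟨_, ε1, h1, le_rfl, rfl⟩
  have hbd : BddAbove X := ⟨Module.finrank ℝ E, by
    rintro n ⟨ε, _, _, rfl⟩
    exact Submodule.finrank_le _⟩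
  obtain ⟨ε0, h2, h3, h4⟩ := Nat.sSup_mem hne hbd
  refine ⟨ε0, h2, h3, fun ε h5 h6 => ?_⟩
  refine (Submodule.eq_of_le_of_finrank_le (hanti _ _ h6) ?_).symm
  rw [h4]
  exact le_csSup hbd ⟨ε, h5, h6.trans h3, rfl⟩

theorem exists_commring {E : Type u} [Ring E] [Algebra ℝ E] [FiniteDimensional ℝ E] (Z : Subalgebra ℝ E)
    (hZ : ∀ x ∈ Z, ∀ y ∈ Z, x * y = y * x) :
    ∃ (R : Type u) (_ : CommRing R) (_ : Algebra ℝ R) (f : R →ₐ[ℝ] E), FiniteDimensional ℝ R ∧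
      Function.Injective f ∧ ∀ x, x ∈ Z ↔ ∃ r, f r = x := by
  letI i1 : CommRing Z := { (inferInstance : Ring Z) with mul_comm := fun x y => Subtype.ext (hZ x x.2 y y.2) }
  refine ⟨Z, i1, Z.algebra, Z.val, ?_, Subtype.val_injective, fun x => ?_⟩
  · exact (inferInstance : FiniteDimensional ℝ Z.toSubmodule)
  · exact ⟨fun h => ⟨⟨x, h⟩, rfl⟩, by rintro ⟨r, rfl⟩; exact r.2⟩

variable {V : Type*} [NormedAddCommGroup V] [NormedSpace ℝ V] [FiniteDimensional ℝ V]
variable {G : Type*} [Group G]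

/-- restriction of the linear part to an invariant subspace -/
def Aff.res (A : Aff G V) (W : Submodule ℝ V) (hW : ∀ g, ∀ w ∈ W, A.L g w ∈ W) : G →* Module.End ℝ W where
  toFun g := ((A.L g : V →L[ℝ] V) : V →ₗ[ℝ] V).restrict (hW g)
  map_one' := by ext x; simp
  map_mul' g g' := by ext x; simp [LinearMap.restrict_apply, A.L_mul]

theorem Aff.res_apply (A : Aff G V) (W : Submodule ℝ V) (hW : ∀ g, ∀ w ∈ W, A.L g w ∈ W) (g : G) (w : W) :
    ((A.res W hW g w : W) : V) = A.L g w := rfl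

theorem exists_small_t {α : Type*} (F : Set α) (hF : F.Finite) (u v : α → ℝ) (ε : ℝ) (hu : ∀ x ∈ F, u x < ε) :
    ∃ t : ℝ, 0 < t ∧ ∀ x ∈ F, u x + t * v x < ε := by
  have h : ∀ᶠ t in 𝓝[>] (0 : ℝ), ∀ x ∈ F, u x + t * v x < ε := by
    rw [hF.eventually_all]
    intro x hx
    have h1 : Tendsto (fun t => u x + t * v x) (𝓝[>] (0 : ℝ)) (𝓝 (u x + 0 * v x)) :=
      ((by fun_prop : Continuous fun t : ℝ => u x + t * v x).tendsto 0).mono_left nhdsWithin_le_nhds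
    rw [zero_mul, add_zero] at h1
    exact h1.eventually_lt_const (hu x hx)
  obtain ⟨t, ht, ht0⟩ := (h.and self_mem_nhdsWithin).exists
  exact ⟨t, ht0, ht⟩

theorem step1 {A : Aff G V} {B : V →L[ℝ] V →L[ℝ] ℝ} {lam : G →* ℝ} (h : Hyp A B lam) {W : Submodule ℝ V}
    (hW : SI A B W) : ∃ ε > 0, ∀ γ, ‖A.L γ - 1‖ < ε → ∀ w ∈ W, A.L γ w = w := by
  classical
  by_contra hcon
  push Not at hcon
  have hB := h.lor
  have hiso : ∀ g x y, B (A.L g x) (A.L g y) = B x y := by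
    intro g x y; rw [h.iso, lam_eq_one h hW]; ring
  obtain ⟨v, hvW, hv⟩ := hW.tl
  have hv0 : v ≠ 0 := by rintro rfl; simp at hv
  have : Nontrivial W := ⟨⟨v, hvW⟩, 0, fun hc => hv0 (congrArg Subtype.val hc)⟩
  let σ := A.res W hW.inv
  have hσmul : ∀ g w, σ g (σ g⁻¹ w) = w := by
    intro g w; apply Subtype.ext; exact A.L_L_inv g w
  have hσm : ∀ g, σ g * σ g⁻¹ = 1 := fun g => by rw [← map_mul]; simp
  have hσm' : ∀ g, σ g⁻¹ * σ g = 1 := fun g => by rw [← map_mul]; simp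
  let S : ℝ → Set G := fun ε => {γ | ‖A.L γ - 1‖ < ε}
  let C : ℝ → Subalgebra ℝ (Module.End ℝ W) := fun ε => Subalgebra.centralizer ℝ (σ '' S ε)
  have memC : ∀ ε x, x ∈ C ε ↔ ∀ γ, ‖A.L γ - 1‖ < ε → σ γ * x = x * σ γ := by
    intro ε x
    rw [Subalgebra.mem_centralizer_iff]
    constructor
    · intro h γ hγ; exact h _ ⟨γ, hγ, rfl⟩
    · rintro h _ ⟨γ, hγ, rfl⟩; exact h γ hγ
  obtain ⟨ε0, hε0, hε1, hst⟩ := stab (fun ε => Subalgebra.toSubmodule (C ε)) (by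
    intro ε ε' hle x hx
    rw [Subalgebra.mem_toSubmodule, memC] at hx ⊢
    exact fun γ hγ => hx γ (hγ.trans_le hle)) (ε1 := 1 / 16) (by norm_num)
  have hst' : ∀ ε, 0 < ε → ε ≤ ε0 → C ε = C ε0 := fun ε h1 h2 => Subalgebra.toSubmodule_injective (hst ε h1 h2)
  -- conjugation invariance
  have hCconj : ∀ g, ∀ x ∈ C ε0, σ g * x * σ g⁻¹ ∈ C ε0 := by
    intro g x hx
    rw [memC]
    intro γ hγ
    have hc : Continuous fun M : V →L[ℝ] V => A.L g⁻¹ * M * A.L g := by fun_prop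
    -- small δ
    rw [← hst' (ε0 / (‖A.L g‖ * ‖A.L g⁻¹‖ + 1)) (by positivity) (by
      apply div_le_self hε0.le
      have : 0 ≤ ‖A.L g‖ * ‖A.L g⁻¹‖ := by positivity
      linarith)] at hx
    clear hc
    rw [← sub_eq_zero]
    have key : σ g * x * σ g⁻¹ ∈ C (ε0 / (‖A.L g‖ * ‖A.L g⁻¹‖ + 1)) → σ γ * (σ g * x * σ g⁻¹) - σ g * x * σ g⁻¹ * σ γ = 0 := by
      intro hy
      rw [hst' _ (by positivity) (by
        apply div_le_self hε0.le
        have : 0 ≤ ‖A.L g‖ * ‖A.L g⁻¹‖ := by positivity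
        linarith), memC] at hy
      rw [hy γ hγ, sub_self]
    apply key
    rw [memC]
    intro η hη
    have hx0 : x ∈ C ε0 := by
      rwa [hst' _ (by positivity) (by
        apply div_le_self hε0.le
        have : 0 ≤ ‖A.L g‖ * ‖A.L g⁻¹‖ := by positivity
        linarith)] at hx
    rw [memC] at hx0
    have h1 : ‖A.L (g⁻¹ * η * g) - 1‖ < ε0 := by
      have e : A.L (g⁻¹ * η * g) - 1 = A.L g⁻¹ * (A.L η - 1) * A.L g := by
        rw [map_mul, map_mul, mul_sub, sub_mul, mul_one, ← map_mul A.L g⁻¹ g]; simp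
      rw [e]
      have h2 : ‖A.L g⁻¹ * (A.L η - 1) * A.L g‖ ≤ ‖A.L g⁻¹‖ * ‖A.L η - 1‖ * ‖A.L g‖ :=
        (norm_mul_le _ _).trans (by gcongr; exact norm_mul_le _ _)
      rw [lt_div_iff₀ (by positivity)] at hη
      have : 0 ≤ ‖A.L η - 1‖ := norm_nonneg _
      nlinarith
    have h2 := hx0 _ h1
    rw [map_mul, map_mul] at h2
    calc σ η * (σ g * x * σ g⁻¹) = (σ g * σ g⁻¹) * σ η * (σ g * x * σ g⁻¹) := by rw [hσm, one_mul]
      _ = σ g * (σ g⁻¹ * σ η * σ g * x) * σ g⁻¹ := by noncomm_ring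
      _ = σ g * x * σ g⁻¹ * σ η * (σ g * σ g⁻¹) := by rw [h2]; noncomm_ring
      _ = _ := by rw [hσm, mul_one]
  -- the central element
  obtain ⟨γ0, hγ0, w0, hw0, hγw⟩ := hcon ε0 hε0
  obtain ⟨F, hFfin, hFS, hFspan⟩ := exists_finite_span (S ε0) σ
  obtain ⟨t, ht, htF⟩ := exists_small_t (insert γ0 F) (hFfin.insert _) (fun γ => ‖A.L γ - 1‖) (fun γ => ‖A.a γ‖) ε0 (by
    intro x hx
    rcases hx with rfl | hx
    · exact hγ0
    · exact hFS hx)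
  let A' := A.scale t
  have hA' : ∀ γ ∈ insert γ0 F, ‖A'.toEnd γ - 1‖ < ε0 := by
    intro γ hγ
    refine (A'.norm_toEnd_sub_le γ).trans_lt ?_
    have : ‖A'.a γ‖ = t * ‖A.a γ‖ := by
      change ‖t • A.a γ‖ = _
      rw [norm_smul, Real.norm_of_nonneg ht.le]
    rw [this]
    exact htF γ hγ
  obtain ⟨a, habad, haε, hab⟩ := lemZ A'.toEnd Aff.norm_one_le hε1 (fun γ => σ γ ≠ 1) (by
      apply Set.Finite.image
      refine (h.proper.finite_of_ball (ε0 / t)).subset ?_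
      intro γ hγ
      have h1 := (A'.norm_a_le_sub γ).trans hγ.le
      change ‖t • A.a γ‖ ≤ _ at h1
      rw [norm_smul, Real.norm_of_nonneg ht.le] at h1
      change ‖A.a γ‖ ≤ ε0 / t
      rw [le_div_iff₀ ht]; linarith) (by
      intro γ hγ hc
      apply hγ
      have h1 : A.L γ = 1 := (A'.L_of_toEnd_eq_one hc).1
      ext w
      rw [A.res_apply, h1]; rfl) ⟨γ0, by
        intro hc
        apply hγw
        have := congrArg (fun f : Module.End ℝ W => (f ⟨w0, hw0⟩ : V)) hc
        exact this, hA' γ0 (Set.mem_insert _ _)⟩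
  have haL : ‖A.L a - 1‖ < ε0 := (A'.norm_L_sub_le a).trans_lt haε
  have haF : ∀ b ∈ F, σ a * σ b = σ b * σ a := by
    intro b hb
    have h1 := hab b (hA' b (Set.mem_insert_of_mem _ hb))
    push Not at h1
    rw [map_mul, map_mul, map_mul] at h1
    calc σ a * σ b = σ a * σ b * (σ a⁻¹ * (σ b⁻¹ * σ b) * σ a) := by rw [hσm', mul_one, hσm', mul_one]
      _ = (σ a * σ b * σ a⁻¹ * σ b⁻¹) * (σ b * σ a) := by noncomm_ring
      _ = _ := by rw [h1, one_mul]
  have haS : ∀ γ, ‖A.L γ - 1‖ < ε0 → σ a * σ γ = σ γ * σ a := by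
    intro γ hγ
    have h1 := hFspan γ hγ
    refine Submodule.span_induction (p := fun x _ => σ a * x = x * σ a) ?_ ?_ ?_ ?_ h1
    · rintro _ ⟨b, hb, rfl⟩; exact haF b hb
    · simp
    · intro x y _ _ hx hy; rw [mul_add, add_mul, hx, hy]
    · intro c x _ hx; rw [mul_smul_comm, smul_mul_assoc, hx]
  let Z : Subalgebra ℝ (Module.End ℝ W) := C ε0 ⊓ Subalgebra.centralizer ℝ (C ε0 : Set (Module.End ℝ W))
  have hZcomm : ∀ x ∈ Z, ∀ y ∈ Z, x * y = y * x := by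
    rintro x ⟨hx, hx'⟩ y ⟨hy, hy'⟩
    exact (Subalgebra.mem_centralizer_iff ℝ).1 hy' x hx
  have haC : σ a ∈ C ε0 := (memC _ _).2 fun γ hγ => (haS γ hγ).symm
  have haZ : σ a ∈ Z := by
    refine ⟨haC, (Subalgebra.mem_centralizer_iff ℝ).2 fun x hx => ?_⟩
    exact ((memC _ _).1 hx a haL).symm
  have hinvcomm : ∀ x : Module.End ℝ W, σ a * x = x * σ a → σ a⁻¹ * x = x * σ a⁻¹ := by
    intro x hx
    calc σ a⁻¹ * x = σ a⁻¹ * (x * σ a) * σ a⁻¹ := by rw [mul_assoc, mul_assoc, hσm, mul_one]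
      _ = (σ a⁻¹ * σ a) * x * σ a⁻¹ := by rw [← hx]; noncomm_ring
      _ = _ := by rw [hσm', one_mul]
  have haZ' : σ a⁻¹ ∈ Z := by
    refine ⟨(memC _ _).2 fun γ hγ => (hinvcomm _ (haS γ hγ)).symm, (Subalgebra.mem_centralizer_iff ℝ).2 fun x hx => ?_⟩
    exact (hinvcomm x ((memC _ _).1 hx a haL)).symm
  have hZconj : ∀ g, ∀ x ∈ Z, σ g * x * σ g⁻¹ ∈ Z := by
    rintro g x ⟨hx, hx'⟩
    refine ⟨hCconj g x hx, (Subalgebra.mem_centralizer_iff ℝ).2 fun y hy => ?_⟩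
    have h1 := (Subalgebra.mem_centralizer_iff ℝ).1 hx' _ (hCconj g⁻¹ y hy)
    rw [inv_inv] at h1
    calc y * (σ g * x * σ g⁻¹) = (σ g * σ g⁻¹) * y * (σ g * x * σ g⁻¹) := by rw [hσm, one_mul]
      _ = σ g * (σ g⁻¹ * y * σ g * x) * σ g⁻¹ := by noncomm_ring
      _ = σ g * x * σ g⁻¹ * y * (σ g * σ g⁻¹) := by rw [h1]; noncomm_ring
      _ = _ := by rw [hσm, mul_one]
  obtain ⟨R, iR, iA, f, hfd, hfinj, hfZ⟩ := exists_commring Z hZcomm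
  have hα : ∀ g r, ∃ r', f r' = σ g * f r * σ g⁻¹ := fun g r => (hfZ _).1 (hZconj g _ ((hfZ _).2 ⟨r, rfl⟩))
  choose α hα using hα
  let α' : G → R →+* R := fun g =>
    { toFun := α g
      map_one' := by apply hfinj; rw [hα, map_one, mul_one, hσm]
      map_mul' := by
        intro x y
        apply hfinj
        rw [map_mul, hα, hα, hα, map_mul]
        calc _ = σ g * f x * 1 * f y * σ g⁻¹ := by noncomm_ring
          _ = _ := by rw [← hσm' g]; noncomm_ring
      map_zero' := by apply hfinj; rw [hα, map_zero, mul_zero, zero_mul]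
      map_add' := by
        intro x y
        apply hfinj
        rw [map_add, hα, hα, hα, map_add]; noncomm_ring }
  letI iM : Module R W := Module.compHom W f.toRingHom
  have hsm : ∀ (r : R) (w : W), r • w = f r w := fun _ _ => rfl
  have : IsScalarTower ℝ R W := ⟨fun c r w => by rw [hsm, hsm, map_smul]; rfl⟩
  have hfield := normalized_domain (R := R) (W := W) (by
    intro r hr
    apply hfinj
    rw [map_zero]
    ext1 w
    exact hr w) σ α' (by
    intro g r w
    rw [hsm, hsm]
    change _ = f (α g r) (σ g w)
    rw [hα]
    change _ = σ g (f r (σ g⁻¹ (σ g w)))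
    have := hσmul g⁻¹ w
    rw [inv_inv] at this
    rw [this]) (by
    intro K hK W' hW'
    rcases hW.irr K hK (W'.map W.subtype) (Submodule.map_subtype_le _ _) (by
      rintro k hk _ ⟨w, hw, rfl⟩
      exact ⟨σ k w, hW' k hk w hw, rfl⟩) with h1 | h1
    · left
      rw [Submodule.eq_bot_iff]
      intro w hw
      have : (w : V) ∈ W'.map W.subtype := ⟨w, hw, rfl⟩
      rw [h1, Submodule.mem_bot] at this
      exact Subtype.ext this
    · right
      rw [Submodule.eq_top_iff']
      intro w
      have : (w : V) ∈ W'.map W.subtype := by rw [h1]; exact w.2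
      obtain ⟨w', hw', he⟩ := this
      have : w' = w := Subtype.ext he
      rwa [← this])
  have : IsDomain R := hfield.isDomain
  obtain ⟨a0, ha0⟩ := (hfZ _).1 haZ
  obtain ⟨b0, hb0⟩ := (hfZ _).1 haZ'
  have hab1 : a0 * b0 = 1 := by
    apply hfinj; rw [map_mul, ha0, hb0, hσm, map_one]
  have hs : a0 - b0 = 0 := by
    refine skew_zero hB W hW.tl f hfinj (a0 - b0) ?_
    intro x y
    rw [map_sub, ha0, hb0]
    simp only [LinearMap.sub_apply, Submodule.coe_sub, map_sub, sub_apply]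
    have e1 : B (σ a x : V) y = B (x : V) (σ a⁻¹ y : V) := by
      rw [A.res_apply, A.res_apply, ← hiso a x, A.L_L_inv]
    have e2 : B (σ a⁻¹ x : V) y = B (x : V) (σ a y : V) := by
      rw [A.res_apply, A.res_apply, ← hiso a, A.L_L_inv]
    rw [e1, e2]; ring
  have hsq : (a0 - 1) * (a0 + 1) = 0 := by
    rw [← sub_eq_zero.1 hs] at hab1
    linear_combination hab1
  rcases mul_eq_zero.1 hsq with h1 | h1
  · apply habad
    rw [← ha0, sub_eq_zero.1 h1, map_one]
  · have h2 : σ a = -1 := by rw [← ha0, eq_neg_of_add_eq_zero_left h1, map_neg, map_one]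
    have h3 : A.L a v = -v := by
      have := congrArg (fun f : Module.End ℝ W => (f ⟨v, hvW⟩ : V)) h2
      exact this
    have h4 := (A.L a - 1).le_opNorm v
    rw [sub_apply, h3] at h4
    change ‖-v - v‖ ≤ _ at h4
    have h5 : ‖-v - v‖ = 2 * ‖v‖ := by
      rw [show -v - v = (-2 : ℝ) • v by module, norm_smul]; norm_num
    have h6 : 0 < ‖v‖ := norm_pos_iff.2 hv0
    rw [h5] at h4
    nlinarith
end LS


namespace LS
open Filter Topology

variable {V : Type*} [NormedAddCommGroup V] [NormedSpace ℝ V] [FiniteDimensional ℝ V]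
variable {G : Type*} [Group G]

theorem conj_small {𝒜 : Type*} [NormedRing 𝒜] (ρ : G →* 𝒜) (g : G) {ε : ℝ} (hε : 0 < ε) :
    ∃ ε', 0 < ε' ∧ ε' ≤ ε ∧ ∀ η, ‖ρ η - 1‖ < ε' → ‖ρ (g⁻¹ * η * g) - 1‖ < ε := by
  have h0 : 0 ≤ ‖ρ g‖ * ‖ρ g⁻¹‖ := by positivity
  refine ⟨ε / (‖ρ g‖ * ‖ρ g⁻¹‖ + 1), by positivity, div_le_self hε.le (by linarith), fun η hη => ?_⟩
  have e : ρ (g⁻¹ * η * g) - 1 = ρ g⁻¹ * (ρ η - 1) * ρ g := by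
    rw [map_mul, map_mul, mul_sub, sub_mul, mul_one, hom_inv_mul]
  rw [e]
  have h2 : ‖ρ g⁻¹ * (ρ η - 1) * ρ g‖ ≤ ‖ρ g⁻¹‖ * ‖ρ η - 1‖ * ‖ρ g‖ :=
    (norm_mul_le _ _).trans (by gcongr; exact norm_mul_le _ _)
  rw [lt_div_iff₀ (by positivity)] at hη
  have : 0 ≤ ‖ρ η - 1‖ := norm_nonneg _
  nlinarith

theorem exists_unit {B : V →L[ℝ] V →L[ℝ] ℝ} {S : Submodule ℝ V} (hS : ∃ v ∈ S, B v v < 0) : ∃ v ∈ S, B v v = -1 := by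
  obtain ⟨v, hvS, hv⟩ := hS
  refine ⟨(Real.sqrt (-B v v))⁻¹ • v, S.smul_mem _ hvS, ?_⟩
  have hs : 0 < Real.sqrt (-B v v) := Real.sqrt_pos.2 (by linarith)
  simp only [map_smul, smul_apply, smul_eq_mul]
  have : Real.sqrt (-B v v) * Real.sqrt (-B v v) = -B v v := Real.mul_self_sqrt (by linarith)
  field_simp
  nlinarith

theorem IsPr.low {B : V →L[ℝ] V →L[ℝ] ℝ} {S : Submodule ℝ V} {p : V →L[ℝ] V} (h : IsPr B S p) (hB : Lor B)
    (hS : ∃ v ∈ S, B v v < 0) : ∃ c > 0, ∀ x, c * ‖p x‖ ^ 2 ≤ B (p x) (p x) := by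
  obtain ⟨v, hvS, hv⟩ := exists_unit hS
  obtain ⟨c, hc, hl⟩ := hB.exists_lower ‖v‖
  refine ⟨c, hc, fun x => ?_⟩
  have := hl v (p x) hv le_rfl
  rw [h.orth x v hvS] at this
  simpa using this

theorem IsPr.bdd {B : V →L[ℝ] V →L[ℝ] ℝ} {S : Submodule ℝ V} {p : V →L[ℝ] V} (h : IsPr B S p) (hB : Lor B)
    (hS : ∃ v ∈ S, B v v < 0) : ∃ C > 0, ∀ (M : V →L[ℝ] V), (∀ x y, B (M x) (M y) = B x y) → (∀ x, p (M x) = M (p x)) →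
      ∀ x, ‖M (p x)‖ ≤ C * ‖p x‖ := by
  obtain ⟨c, hc, hl⟩ := h.low hB hS
  refine ⟨Real.sqrt (‖B‖ / c) + 1, by positivity, fun M hM hcomm x => ?_⟩
  have h1 := hl (M x)
  rw [hcomm, hM] at h1
  have h2 : B (p x) (p x) ≤ ‖B‖ * ‖p x‖ * ‖p x‖ := (le_abs_self _).trans (B.le_opNorm₂ _ _)
  have h5 : ‖M (p x)‖ ^ 2 ≤ (‖B‖ / c) * ‖p x‖ ^ 2 := by
    rw [div_mul_eq_mul_div, le_div_iff₀ hc]; nlinarith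
  have h6 : ‖M (p x)‖ ≤ Real.sqrt (‖B‖ / c) * ‖p x‖ := by
    apply le_of_sq_le_sq _ (by positivity)
    rw [mul_pow, Real.sq_sqrt (by positivity)]
    exact h5
  nlinarith [norm_nonneg (p x)]

/-- composition of the translation part with a commuting projection -/
def Aff.proj (A : Aff G V) (p : V →L[ℝ] V) (hp : ∀ g x, p (A.L g x) = A.L g (p x)) : Aff G V where
  L := A.L
  a := fun g => p (A.a g)
  a_mul := fun g h => by rw [A.a_mul, map_add, hp]

/-- the standing assumptions in the irreducible case -/
structure Ctx (A : Aff G V) (B : V →L[ℝ] V →L[ℝ] ℝ) (W : Submodule ℝ V) (p : V →L[ℝ] V) : Prop where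
  lor : Lor B
  iso : ∀ g x y, B (A.L g x) (A.L g y) = B x y
  proper : A.Proper
  cocpt : A.Cocpt
  free : A.Free
  si : SI A B W
  pr : IsPr B W p
  comm : ∀ g x, p (A.L g x) = A.L g (p x)
  rigid : ∃ ε > 0, ∀ γ, ‖A.L γ - 1‖ < ε → ∀ w ∈ W, A.L γ w = w

theorem exists_ctx {A : Aff G V} {B : V →L[ℝ] V →L[ℝ] ℝ} {lam : G →* ℝ} (h : Hyp A B lam) {W : Submodule ℝ V}
    (hW : SI A B W) : ∃ p, Ctx A B W p := by
  obtain ⟨p, h1, h2, h3⟩ := h.lor.exists_proj W hW.tl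
  have hpr : IsPr B W p := ⟨h1, h2, h3⟩
  refine ⟨p, h.lor, ?_, h.proper, h.cocpt, h.free, hW, hpr, hpr.comm h.lor hW.tl A lam h.iso hW.inv, step1 h hW⟩
  intro g x y; rw [h.iso, lam_eq_one h hW]; ring

variable {A : Aff G V} {B : V →L[ℝ] V →L[ℝ] ℝ} {W : Submodule ℝ V} {p : V →L[ℝ] V}

/-- the projected representation -/
noncomputable def Ctx.T (c : Ctx A B W p) : G →* ((V × ℝ) →L[ℝ] (V × ℝ)) := (A.proj p c.comm).toEnd

theorem Ctx.norm_L_sub_le (c : Ctx A B W p) (g : G) : ‖A.L g - 1‖ ≤ ‖c.T g - 1‖ := (A.proj p c.comm).norm_L_sub_le g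
theorem Ctx.norm_pa_le_sub (c : Ctx A B W p) (g : G) : ‖p (A.a g)‖ ≤ ‖c.T g - 1‖ := (A.proj p c.comm).norm_a_le_sub g

/-- the W-component of the translation -/
theorem Ctx.q_mem (c : Ctx A B W p) (x : V) : x - p x ∈ W := c.pr.sub x

/-- small elements commute -/
theorem Ctx.small_comm (c : Ctx A B W p) : ∃ ε > 0, (∀ γ, ‖c.T γ - 1‖ < ε → ∀ w ∈ W, A.L γ w = w) ∧
    ∀ γ η, ‖c.T γ - 1‖ < ε → ‖c.T η - 1‖ < ε → γ * η = η * γ := by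
  obtain ⟨ε1, hε1, hr⟩ := c.rigid
  have hX : ({γ | ‖A.a γ‖ ≤ 1} ∩ {γ | c.T γ ≠ 1}).Finite := (c.proper.finite_of_ball 1).inter_of_left _
  obtain ⟨μ, hμ, hmin⟩ : ∃ μ > 0, ∀ γ, ‖A.a γ‖ ≤ 1 → c.T γ ≠ 1 → μ ≤ ‖c.T γ - 1‖ := by
    rcases Set.eq_empty_or_nonempty ({γ | ‖A.a γ‖ ≤ 1} ∩ {γ | c.T γ ≠ 1}) with h | h
    · refine ⟨1, one_pos, fun γ h1 h2 => ?_⟩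
      have : γ ∈ ({γ | ‖A.a γ‖ ≤ 1} ∩ {γ | c.T γ ≠ 1}) := ⟨h1, h2⟩
      rw [h] at this; exact this.elim
    · obtain ⟨γ0, h0, hmin⟩ := Set.exists_min_image _ (fun γ => ‖c.T γ - 1‖) hX h
      exact ⟨_, norm_pos_iff.2 (sub_ne_zero.2 h0.2), fun γ h1 h2 => hmin γ ⟨h1, h2⟩⟩
  refine ⟨min ε1 (min (1 / 16) μ), by positivity, fun γ hγ => hr γ ?_, fun γ η hγ hη => ?_⟩
  · exact (c.norm_L_sub_le γ).trans_lt (hγ.trans_le (min_le_left _ _))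
  have hγ1 : ∀ w ∈ W, A.L γ w = w := hr γ ((c.norm_L_sub_le γ).trans_lt (hγ.trans_le (min_le_left _ _)))
  have hη1 : ∀ w ∈ W, A.L η w = w := hr η ((c.norm_L_sub_le η).trans_lt (hη.trans_le (min_le_left _ _)))
  have hγ2 : ‖c.T γ - 1‖ ≤ 1 / 16 := (hγ.trans_le ((min_le_right _ _).trans (min_le_left _ _))).le
  have hη2 : ‖c.T η - 1‖ ≤ 1 / 16 := (hη.trans_le ((min_le_right _ _).trans (min_le_left _ _))).le
  have hγ3 : ‖c.T γ - 1‖ < μ := (hγ.trans_le ((min_le_right _ _).trans (min_le_right _ _)))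
  have hinv : ∀ g, (∀ w ∈ W, A.L g w = w) → ∀ w ∈ W, A.L g⁻¹ w = w := by
    intro g h w hw
    conv_lhs => rw [← h w hw]
    rw [A.L_inv_L]
  let q : G → V := fun g => A.a g - p (A.a g)
  have hqW : ∀ g, q g ∈ W := fun g => c.pr.sub _
  have hqmul : ∀ g g', q (g * g') = A.L g (q g') + q g := by
    intro g g'
    simp only [q, A.a_mul, map_add, map_sub, c.comm]; abel
  have hqadd : ∀ g g', (∀ w ∈ W, A.L g w = w) → q (g * g') = q g' + q g := by
    intro g g' h; rw [hqmul, h _ (hqW g')]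
  have hqinv : ∀ g, (∀ w ∈ W, A.L g w = w) → q g⁻¹ = - q g := by
    intro g h
    have h1 := hqadd g g⁻¹ h
    have h2 : q 1 = 0 := by simp [q, A.a_one]
    rw [mul_inv_cancel, h2] at h1
    exact eq_neg_of_add_eq_zero_left h1.symm
  have hq : q (γ * η * γ⁻¹ * η⁻¹) = 0 := by
    rw [mul_assoc, mul_assoc, hqadd _ _ hγ1, hqadd _ _ hη1, hqadd _ _ (hinv _ hγ1), hqinv _ hγ1, hqinv _ hη1]
    abel
  have hT := comm_bound c.T Aff.norm_one_le γ η hγ2 hη2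
  have h0 := norm_nonneg (c.T γ - 1)
  have h0' := norm_nonneg (c.T η - 1)
  have hT2 : ‖c.T (γ * η * γ⁻¹ * η⁻¹) - 1‖ < μ := by nlinarith
  have hT3 : ‖c.T (γ * η * γ⁻¹ * η⁻¹) - 1‖ ≤ 1 := by nlinarith
  have ha : A.a (γ * η * γ⁻¹ * η⁻¹) = p (A.a (γ * η * γ⁻¹ * η⁻¹)) := sub_eq_zero.1 hq
  have hT1 : c.T (γ * η * γ⁻¹ * η⁻¹) = 1 := by
    by_contra hc
    have := hmin _ (by rw [ha]; exact (c.norm_pa_le_sub _).trans hT3) hc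
    linarith
  have h1 : p (A.a (γ * η * γ⁻¹ * η⁻¹)) = 0 := ((A.proj p c.comm).L_of_toEnd_eq_one hT1).2
  have h2 := c.free (γ * η * γ⁻¹ * η⁻¹) 0 (by rw [Aff.act, map_zero, ha, h1, add_zero])
  rw [mul_inv_eq_one, mul_inv_eq_iff_eq_mul] at h2
  exact h2

theorem Ctx.step2 (c : Ctx A B W p) : ∃ ε > 0, ∀ γ, ‖c.T γ - 1‖ < ε → A.L γ = 1 := by
  classical
  obtain ⟨ε1, hε1, hW1, hcomm⟩ := c.small_comm
  have hB := c.lor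
  let R : ℝ → Submodule ℝ V := fun ε =>
    { carrier := {x | ∀ γ, ‖c.T γ - 1‖ < ε → A.L γ x = x}
      add_mem' := by
        intro x y hx hy γ hγ
        rw [map_add, hx γ hγ, hy γ hγ]
      zero_mem' := by intro γ _; simp
      smul_mem' := by
        intro t x hx γ hγ
        rw [map_smul, hx γ hγ] }
  have memR : ∀ ε x, x ∈ R ε ↔ ∀ γ, ‖c.T γ - 1‖ < ε → A.L γ x = x := fun _ _ => Iff.rfl
  obtain ⟨ε0, hε0, hε01, hst⟩ := stab R (by
    intro ε ε' hle x hx γ hγ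
    exact hx γ (hγ.trans_le hle)) hε1
  refine ⟨ε0, hε0, ?_⟩
  have hWR : W ≤ R ε0 := fun w hw γ hγ => hW1 γ (hγ.trans_le hε01) w hw
  have hRt : ∃ v ∈ R ε0, B v v < 0 := by
    obtain ⟨v, hv, hv'⟩ := c.si.tl
    exact ⟨v, hWR hv, hv'⟩
  have hRinv : ∀ g, ∀ x ∈ R ε0, A.L g x ∈ R ε0 := by
    intro g x hx
    obtain ⟨ε', h1, h2, h3⟩ := conj_small c.T g hε0
    rw [← hst ε' h1 h2]
    intro γ hγ
    have h4 := hx _ (h3 γ hγ)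
    rw [A.L_mul, A.L_mul] at h4
    conv_rhs => rw [← h4]
    rw [A.L_L_inv]
  obtain ⟨r, hr1, hr2, hr3⟩ := hB.exists_proj (R ε0) hRt
  have hr : IsPr B (R ε0) r := ⟨hr1, hr2, hr3⟩
  have hrc := hr.comm hB hRt A (fun _ => 1) (by intro g x y; rw [c.iso]; ring) hRinv
  let A' := A.proj r hrc
  have hA'act : ∀ g x, A'.act g x = A.L g x + r (A.a g) := fun _ _ => rfl
  obtain ⟨F, hFfin, hFS, hFspan⟩ := exists_finite_span {γ | ‖c.T γ - 1‖ < ε0} (fun γ => A.L γ - 1)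
  have hFR : ∀ x, (∀ δ ∈ F, A.L δ x = x) → x ∈ R ε0 := by
    intro x hx γ hγ
    have h1 : (A.L γ - 1) x = 0 := by
      refine Submodule.span_induction (p := fun (M : V →L[ℝ] V) _ => M x = 0) ?_ ?_ ?_ ?_ (hFspan γ hγ)
      · rintro _ ⟨b, hb, rfl⟩
        change A.L b x - x = 0
        rw [hx b hb, sub_self]
      · rfl
      · intro M N _ _ h1 h2; rw [add_apply, h1, h2, add_zero]
      · intro t M _ h1; rw [smul_apply, h1, smul_zero]
    exact sub_eq_zero.1 h1
  let Fs := hFfin.toFinset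
  have hpos : ∀ y, r y = y → ∑ δ ∈ Fs, (y - A.L δ y) = 0 → y = 0 := by
    intro y hy hsum
    have h1 : ∀ δ ∈ Fs, B y (y - A.L δ y) = 0 := by
      have h2 : ∑ δ ∈ Fs, B y (y - A.L δ y) = 0 := by rw [← map_sum, hsum, map_zero]
      refine (Finset.sum_eq_zero_iff_of_nonneg ?_).1 h2
      intro δ _
      have h3 : 0 ≤ B (y - A.L δ y) (y - A.L δ y) := by
        have : y - A.L δ y = r (y - A.L δ y) := by rw [map_sub, hrc, hy]
        rw [this]
        by_cases h0 : r (y - A.L δ y) = 0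
        · rw [h0]; simp
        · exact (hr.pos hB hRt h0).le
      simp only [map_sub, sub_apply, c.iso, hB.symm (A.L δ y) y] at h3 ⊢
      linarith
    have h2 : y ∈ R ε0 := by
      apply hFR
      intro δ hδ
      have h3 := h1 δ (hFfin.mem_toFinset.2 hδ)
      have h4 : y - A.L δ y = 0 := by
        have h5 : y - A.L δ y = r (y - A.L δ y) := by rw [map_sub, hrc, hy]
        by_contra h0
        rw [h5] at h0
        have h6 := hr.pos hB hRt h0
        rw [← h5] at h6
        simp only [map_sub, sub_apply, c.iso, hB.symm (A.L δ y) y] at h3 h6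
        linarith
      exact (sub_eq_zero.1 h4).symm
    rw [← hy, hr.zero y h2]
  let M : V →ₗ[ℝ] V := (LinearMap.id - (r : V →ₗ[ℝ] V)) + ∑ δ ∈ Fs, ((r : V →ₗ[ℝ] V) - ((A.L δ : V →L[ℝ] V) : V →ₗ[ℝ] V) ∘ₗ (r : V →ₗ[ℝ] V))
  have hM : ∀ x, M x = (x - r x) + ∑ δ ∈ Fs, (r x - A.L δ (r x)) := by
    intro x
    simp [M, LinearMap.sum_apply]
  have hrM : ∀ x, r (M x) = ∑ δ ∈ Fs, (r x - A.L δ (r x)) := by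
    intro x
    rw [hM, map_add, map_sub, hr.idem, sub_self, zero_add, map_sum]
    refine Finset.sum_congr rfl fun δ _ => ?_
    rw [map_sub, hrc, hr.idem]
  have hMinj : Function.Injective M := by
    rw [← LinearMap.ker_eq_bot, LinearMap.ker_eq_bot']
    intro x hx
    have h1 := hrM x
    rw [hx, map_zero] at h1
    have h2 := hpos (r x) (hr.idem x) h1.symm
    rw [hM, h2] at hx
    simpa using hx
  obtain ⟨x1, hx1⟩ := LinearMap.injective_iff_surjective.1 hMinj (∑ δ ∈ Fs, r (A.a δ))
  let x0 := r x1
  have hrx0 : r x0 = x0 := hr.idem x1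
  have hx0 : ∑ δ ∈ Fs, (A'.act δ x0 - x0) = 0 := by
    have h1 := hrM x1
    rw [hx1, map_sum] at h1
    simp only [hr.idem] at h1
    have h2 : ∑ δ ∈ Fs, (A'.act δ x0 - x0) = ∑ δ ∈ Fs, r (A.a δ) - ∑ δ ∈ Fs, (x0 - A.L δ x0) := by
      rw [← Finset.sum_sub_distrib]
      refine Finset.sum_congr rfl fun δ _ => ?_
      rw [hA'act]; abel
    rw [h2, h1, sub_self]
  have hract : ∀ g, r (A'.act g x0) = A'.act g x0 := by
    intro g
    rw [hA'act, map_add, hr.idem, hrc, hrx0]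
  have hfix : ∀ η, ‖c.T η - 1‖ < ε0 → A'.act η x0 = x0 := by
    intro η hη
    rw [← sub_eq_zero]
    apply hpos
    · rw [map_sub, hract, hrx0]
    · have h2 : ∀ δ ∈ Fs, (A'.act η x0 - x0) - A.L δ (A'.act η x0 - x0) =
          (A'.act δ x0 - x0) - A.L η (A'.act δ x0 - x0) := by
        intro δ hδ
        have hδ' : ‖c.T δ - 1‖ < ε0 := hFS (hFfin.mem_toFinset.1 hδ)
        have h3 := hcomm δ η (hδ'.trans_le hε01) (hη.trans_le hε01)
        have h4 : A'.act δ (A'.act η x0) = A'.act η (A'.act δ x0) := by rw [← A'.act_mul, h3, A'.act_mul]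
        have h5 : A.L δ (A'.act η x0 - x0) = A'.act δ (A'.act η x0) - A'.act δ x0 := (A'.act_sub _ _ _).symm
        have h6 : A.L η (A'.act δ x0 - x0) = A'.act η (A'.act δ x0) - A'.act η x0 := (A'.act_sub _ _ _).symm
        rw [h5, h6, h4]; abel
      rw [Finset.sum_congr rfl h2, Finset.sum_sub_distrib, ← map_sum, hx0, map_zero, sub_zero]
  have hfixall : ∀ g, A'.act g x0 = x0 := by
    intro g
    obtain ⟨ε', h1, h2, h3⟩ := conj_small c.T g hε0
    have h4 : A'.act g x0 - x0 ∈ R ε' := by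
      intro η hη
      have h5 := hfix _ (h3 η hη)
      rw [A'.act_mul, A'.act_mul] at h5
      have h6 : A'.act η (A'.act g x0) = A'.act g x0 := by
        conv_rhs => rw [← h5]
        rw [A'.act_act_inv]
      have h7 := hfix η (hη.trans_le h2)
      have h8 : A.L η (A'.act g x0 - x0) = A'.act η (A'.act g x0) - A'.act η x0 := (A'.act_sub _ _ _).symm
      rw [h8, h6, h7]
    rw [hst ε' h1 h2] at h4
    have h5 := hr.zero _ h4
    rw [map_sub, hract, hrx0] at h5
    exact sub_eq_zero.1 h5
  have hinvQ : ∀ g x, B (r (A.act g x) - x0) (r (A.act g x) - x0) = B (r x - x0) (r x - x0) := by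
    intro g x
    have h1 : r (A.act g x) - x0 = A.L g (r x - x0) := by
      conv_lhs => rw [← hfixall g, hA'act]
      rw [Aff.act, map_add, hrc, map_sub]; abel
    rw [h1, c.iso]
  obtain ⟨R0, hR0⟩ := c.cocpt
  have hbd : ∃ C, ∀ x, B (r x - x0) (r x - x0) ≤ C := by
    have : ProperSpace V := FiniteDimensional.proper ℝ V
    obtain ⟨C, hC⟩ := (isCompact_closedBall (0 : V) R0).bddAbove_image (f := fun x => B (r x - x0) (r x - x0)) (by fun_prop)
    refine ⟨C, fun x => ?_⟩
    obtain ⟨g, hg⟩ := hR0 x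
    rw [← hinvQ g x]
    exact hC ⟨_, by simpa using hg, rfl⟩
  obtain ⟨C, hC⟩ := hbd
  have hr0 : ∀ x, r x = 0 := by
    intro x
    by_contra hx
    have h1 := hr.pos hB hRt hx
    have h2 := hC (((|C| + 1) * (1 + (B (r x) (r x))⁻¹)) • x + x0)
    rw [map_add, hrx0, add_sub_cancel_right] at h2
    simp only [map_smul, smul_apply, smul_eq_mul] at h2
    have h3 : 1 ≤ (1 + (B (r x) (r x))⁻¹) := by have := inv_pos.2 h1; linarith
    have h4 : 1 ≤ (1 + (B (r x) (r x))⁻¹) * B (r x) (r x) := by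
      rw [add_mul, inv_mul_cancel₀ h1.ne']; linarith
    set s := (1 + (B (r x) (r x))⁻¹)
    have h5 : 1 ≤ |C| + 1 := by linarith [abs_nonneg C]
    have h6 : |C| + 1 ≤ (|C| + 1) * s * ((|C| + 1) * s * B (r x) (r x)) := by
      have e : (|C| + 1) * s * ((|C| + 1) * s * B (r x) (r x)) = (|C| + 1) * ((|C| + 1) * s * (s * B (r x) (r x))) := by ring
      rw [e]
      refine le_mul_of_one_le_right (by positivity) ?_
      exact one_le_mul_of_one_le_of_one_le (one_le_mul_of_one_le_of_one_le h5 h3) h4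
    linarith [le_abs_self C]
  intro γ hγ
  ext x
  exact hr.mem (hr0 x) γ hγ

end LS


namespace LS
open Filter Topology

variable {V : Type*} [NormedAddCommGroup V] [NormedSpace ℝ V] [FiniteDimensional ℝ V]
variable {G : Type*} [Group G]

theorem Aff.a_conj (A : Aff G V) {δ : G} (hδ : A.L δ = 1) (g : G) :
    A.a (g * δ * g⁻¹) = A.L g (A.a δ) ∧ A.L (g * δ * g⁻¹) = 1 := by
  constructor
  · rw [mul_assoc, A.a_mul, A.a_mul, hδ, map_add, A.a_inv]
    change A.L g (- A.L g⁻¹ (A.a g)) + _ + _ = _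
    rw [map_neg, A.L_L_inv]; abel
  · rw [map_mul, map_mul, hδ, mul_one, hom_mul_inv]

theorem Aff.trans_eq_one {A : Aff G V} (hf : A.Free) {δ : G} (ha : A.a δ = 0) : δ = 1 :=
  hf δ 0 (by rw [Aff.act, map_zero, ha, add_zero])

/-- the group of translation vectors -/
def Aff.lat (A : Aff G V) : AddSubgroup V where
  carrier := {x | ∃ δ, A.L δ = 1 ∧ A.a δ = x}
  add_mem' := by
    rintro _ _ ⟨δ, hδ, rfl⟩ ⟨η, hη, rfl⟩
    refine ⟨η * δ, by rw [map_mul, hδ, hη, one_mul], ?_⟩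
    rw [A.a_mul, hη]; rfl
  zero_mem' := ⟨1, map_one _, A.a_one⟩
  neg_mem' := by
    rintro _ ⟨δ, hδ, rfl⟩
    have h1 : A.L δ⁻¹ = 1 := by
      have := hom_inv_mul A.L δ
      rwa [hδ, mul_one] at this
    exact ⟨δ⁻¹, h1, by rw [A.a_inv, h1]; rfl⟩

theorem lat_approx (Λ : AddSubgroup V) : ∃ C, ∀ s ∈ Submodule.span ℝ (Λ : Set V), ∃ l ∈ Λ, ‖s - l‖ ≤ C := by
  classical
  obtain ⟨F, hF, hFΛ, hspan⟩ := exists_finite_span (Λ : Set V) (fun x : V => x)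
  refine ⟨∑ x ∈ hF.toFinset, ‖x‖, fun s hs => ?_⟩
  have h1 : s ∈ Submodule.span ℝ ((hF.toFinset : Finset V) : Set V) := by
    have h2 : Submodule.span ℝ (Λ : Set V) ≤ Submodule.span ℝ ((hF.toFinset : Finset V) : Set V) := by
      rw [Submodule.span_le]
      intro x hx
      have := hspan x hx
      simpa using this
    exact h2 hs
  obtain ⟨f, -, hf⟩ := Submodule.mem_span_finset.1 h1
  refine ⟨∑ x ∈ hF.toFinset, ⌊f x⌋ • x, ?_, ?_⟩
  · refine AddSubgroup.sum_mem _ fun x hx => ?_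
    exact AddSubgroup.zsmul_mem _ (hFΛ (hF.mem_toFinset.1 hx)) _
  · rw [← hf, ← Finset.sum_sub_distrib]
    refine (norm_sum_le _ _).trans (Finset.sum_le_sum fun x _ => ?_)
    have e : f x • x - ⌊f x⌋ • x = (Int.fract (f x)) • x := by
      rw [← Int.cast_smul_eq_zsmul ℝ, ← sub_smul]; rfl
    rw [e, norm_smul, Real.norm_of_nonneg (Int.fract_nonneg _)]
    have := (Int.fract_lt_one (f x)).le
    nlinarith [norm_nonneg x]

variable {A : Aff G V} {B : V →L[ℝ] V →L[ℝ] ℝ} {W : Submodule ℝ V} {p : V →L[ℝ] V}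

/-- the translations span a subspace containing a timelike vector -/
theorem vs_trans (hB : Lor B) (hiso : ∀ g x y, B (A.L g x) (A.L g y) = B x y) (hp : A.Proper) (hf : A.Free)
    (hS : ∃ v ∈ Submodule.span ℝ (A.lat : Set V), B v v < 0)
    (hinv : ∀ g, ∀ s ∈ Submodule.span ℝ (A.lat : Set V), A.L g s ∈ Submodule.span ℝ (A.lat : Set V)) : VS G := by
  set S := Submodule.span ℝ (A.lat : Set V) with hSdef
  obtain ⟨r, hr1, hr2, hr3⟩ := hB.exists_proj S hS
  have hr : IsPr B S r := ⟨hr1, hr2, hr3⟩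
  have hrc := hr.comm hB hS A (fun _ => 1) (by intro g x y; rw [hiso]; ring) hinv
  let A' : Aff G V :=
    { L :=
        { toFun := fun g => (1 - r) + A.L g * r
          map_one' := by rw [map_one, one_mul]; abel
          map_mul' := by
            intro g h
            ext x
            simp only [add_apply, mul_apply_eq_comp, sub_apply, one_apply_eq_self, map_add, map_sub, hrc, hr.idem, A.L_mul]
            simp only [← hrc, hr.idem]
            abel }
      a := fun g => r (A.a g)
      a_mul := by
        intro g h
        change _ = ((1 - r) + A.L g * r) (r (A.a h)) + _
        simp only [add_apply, mul_apply_eq_comp, sub_apply, one_apply_eq_self, hr.idem, A.a_mul, map_add, hrc]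
        abel }
  have hA'L : ∀ g, A'.L g = (1 - r) + A.L g * r := fun _ => rfl
  have hA'a : ∀ g, A'.a g = r (A.a g) := fun _ => rfl
  have hA'1 : ∀ δ, A.L δ = 1 → A'.toEnd δ = 1 := by
    intro δ hδ
    have h1 := A'.norm_toEnd_sub_le δ
    have h2 : A'.L δ = 1 := by rw [hA'L, hδ, one_mul]; abel
    have h3 : A'.a δ = 0 := by rw [hA'a]; exact hr.zero _ (Submodule.subset_span ⟨δ, hδ, rfl⟩)
    rw [h2, h3, sub_self, norm_zero, norm_zero, add_zero] at h1
    exact sub_eq_zero.1 (norm_le_zero_iff.1 h1)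
  obtain ⟨C, hC⟩ := lat_approx A.lat
  have happ : ∀ g, ∃ τ, A.L τ = 1 ∧ ‖A.a (τ⁻¹ * g)‖ ≤ ‖r (A.a g)‖ + C := by
    intro g
    obtain ⟨_, ⟨τ, hτ, rfl⟩, h1⟩ := hC _ (hr.sub (A.a g))
    refine ⟨τ, hτ, ?_⟩
    have h2 : A.L τ⁻¹ = 1 := by
      have := hom_inv_mul A.L τ
      rwa [hτ, mul_one] at this
    have h3 : A.a (τ⁻¹ * g) = r (A.a g) + (A.a g - r (A.a g) - A.a τ) := by
      rw [A.a_mul, A.a_inv, h2]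
      change A.a g + - A.a τ = _
      abel
    rw [h3]
    exact (norm_add_le _ _).trans (by gcongr)
  obtain ⟨C2, hC2, hbd⟩ := hr.bdd hB hS
  refine lemE_one A' (‖1 - r‖ + C2 * ‖r‖) ?_ ?_ ?_
  · intro g
    rw [hA'L]
    refine (norm_add_le _ _).trans ?_
    gcongr
    refine ContinuousLinearMap.opNorm_le_bound _ (by positivity) fun x => ?_
    calc ‖(A.L g * r) x‖ ≤ C2 * ‖r x‖ := hbd (A.L g) (hiso g) (hrc g) x
      _ ≤ C2 * (‖r‖ * ‖x‖) := by gcongr; exact r.le_opNorm x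
      _ = _ := by ring
  · intro R
    refine ((hp.finite_of_ball (R + C)).image A'.toEnd).subset ?_
    rintro _ ⟨g, hg, rfl⟩
    obtain ⟨τ, hτ, h1⟩ := happ g
    refine ⟨τ⁻¹ * g, ?_, ?_⟩
    · have h2 := (A'.norm_a_le g).trans hg
      rw [hA'a] at h2
      change ‖A.a (τ⁻¹ * g)‖ ≤ R + C
      linarith
    · have h2 := hom_inv_mul A'.toEnd τ
      rw [hA'1 τ hτ, mul_one] at h2
      rw [map_mul, h2, one_mul]
  · let N : Subgroup A'.toEnd.ker := (A.L.comp A'.toEnd.ker.subtype).ker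
    have hN : ∀ g : A'.toEnd.ker, g ∈ N ↔ A.L g = 1 := fun g => by
      rw [MonoidHom.mem_ker]; rfl
    choose τ hτ hτa using happ
    have hNf : N.FiniteIndex := by
      refine finiteIndex_of_color N (fun g => (τ (g : G))⁻¹ * (g : G)) ?_ ?_
      · refine (hp.finite_of_ball C).subset ?_
        rintro _ ⟨g, rfl⟩
        have h1 : A'.a g = 0 := (A'.L_of_toEnd_eq_one g.2).2
        have h2 := hτa (g : G)
        rw [← hA'a, h1, norm_zero, zero_add] at h2
        exact h2
      · intro g g' h
        rw [hN]
        have h' : (τ (g : G))⁻¹ * (g : G) = (τ (g' : G))⁻¹ * (g' : G) := h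
        have e : (((g⁻¹ * g' : A'.toEnd.ker)) : G) = (g' : G)⁻¹ * (τ (g' : G) * (τ (g : G))⁻¹) * (g' : G) := by
          have h3 : (g : G) = τ (g : G) * ((τ (g' : G))⁻¹ * (g' : G)) := by rw [← h']; group
          have h4 : (g : G)⁻¹ = (g' : G)⁻¹ * τ (g' : G) * (τ (g : G))⁻¹ := by
            conv_lhs => rw [h3]
            group
          change (g : G)⁻¹ * (g' : G) = _
          rw [h4]; group
        rw [e]
        have h5 : A.L (τ (g : G))⁻¹ = 1 := by
          have := hom_inv_mul A.L (τ (g : G))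
          rwa [hτ, mul_one] at this
        rw [map_mul, map_mul, map_mul, h5, hτ, mul_one, mul_one, hom_inv_mul]
    refine VS.of_finiteIndex hNf (VS.of_comm ?_)
    intro a b
    have ha : A.L (a : A'.toEnd.ker) = 1 := (hN _).1 a.2
    have hb : A.L (b : A'.toEnd.ker) = 1 := (hN _).1 b.2
    apply Subtype.ext
    apply Subtype.ext
    change ((a : A'.toEnd.ker) : G) * ((b : A'.toEnd.ker) : G) = ((b : A'.toEnd.ker) : G) * ((a : A'.toEnd.ker) : G)
    generalize ((a : A'.toEnd.ker) : G) = x at *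
    generalize ((b : A'.toEnd.ker) : G) = y at *
    have h1 : (x * y) * (y * x)⁻¹ = 1 := by
      apply Aff.trans_eq_one hf
      have h2 : A.L (y * x)⁻¹ = 1 := by
        have := hom_inv_mul A.L (y * x)
        rwa [map_mul A.L y x, ha, hb, mul_one, mul_one] at this
      rw [A.a_mul, A.a_inv, h2, map_mul, ha, hb, A.a_mul, A.a_mul, ha, hb]
      change - (A.a x + A.a y) + (A.a y + A.a x) = 0
      abel
    exact mul_inv_eq_one.1 h1

theorem Ctx.case_b (c : Ctx A B W p) (hb : ∀ ε > 0, ∃ γ, ‖c.T γ - 1‖ < ε ∧ A.a γ ≠ p (A.a γ)) : VS G := by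
  have hB := c.lor
  obtain ⟨ε, hε, hL⟩ := c.step2
  obtain ⟨γ0, hγ0, ht⟩ := hb ε hε
  have hγL := hL γ0 hγ0
  set t := A.a γ0 with htdef
  set S := Submodule.span ℝ (A.lat : Set V) with hSdef
  have hSinv : ∀ g, ∀ s ∈ S, A.L g s ∈ S := by
    intro g s hs
    refine Submodule.span_induction (p := fun x _ => A.L g x ∈ S) ?_ ?_ ?_ ?_ hs
    · rintro _ ⟨δ, hδ, rfl⟩
      exact Submodule.subset_span ⟨g * δ * g⁻¹, (A.a_conj hδ g).2, (A.a_conj hδ g).1⟩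
    · simp
    · intro x y _ _ h1 h2
      rw [map_add]; exact S.add_mem h1 h2
    · intro c x _ h1
      rw [map_smul]; exact S.smul_mem c h1
  rcases c.si.irr ⊤ inferInstance (S ⊓ W) inf_le_right (fun k _ w hw => ⟨hSinv k w hw.1, c.si.inv k w hw.2⟩) with h | h
  · exfalso
    -- p is injective on S
    let f : S →ₗ[ℝ] V := (p : V →ₗ[ℝ] V) ∘ₗ S.subtype
    have hfinj : LinearMap.ker f = ⊥ := by
      rw [LinearMap.ker_eq_bot']
      intro x hx
      have h1 : (x : V) ∈ S ⊓ W := ⟨x.2, c.pr.mem hx⟩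
      rw [h, Submodule.mem_bot] at h1
      exact Subtype.ext h1
    obtain ⟨K, hK, hanti⟩ := LinearMap.exists_antilipschitzWith f hfinj
    obtain ⟨C, hC, hbd⟩ := c.pr.bdd hB c.si.tl
    have hb2 : ∀ g, ‖A.L g t‖ ≤ K * (C * ‖p t‖) := by
      intro g
      have h1 := hanti.le_mul_dist (⟨A.L g t, hSinv g t (Submodule.subset_span ⟨γ0, hγL, rfl⟩)⟩ : S) 0
      rw [map_zero, dist_zero_right, dist_zero_right] at h1
      have h2 : ‖f ⟨A.L g t, hSinv g t (Submodule.subset_span ⟨γ0, hγL, rfl⟩)⟩‖ ≤ C * ‖p t‖ := by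
        change ‖p (A.L g t)‖ ≤ _
        rw [c.comm]
        exact hbd (A.L g) (c.iso g) (c.comm g) t
      refine h1.trans ?_
      gcongr
    let H : Subgroup G :=
      { carrier := {g | A.L g t = t}
        mul_mem' := by
          intro a b ha hb
          change A.L (a * b) t = t
          rw [A.L_mul, hb, ha]
        one_mem' := A.L_one t
        inv_mem' := by
          intro a ha
          change A.L a⁻¹ t = t
          conv_lhs => rw [← show A.L a t = t from ha]
          rw [A.L_inv_L] }
    have hH : H.FiniteIndex := by
      refine finiteIndex_of_color H (fun g => A.L g t) ?_ ?_
      · refine ((c.proper.finite_of_ball (K * (C * ‖p t‖))).image A.a).subset ?_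
        rintro _ ⟨g, rfl⟩
        refine ⟨g * γ0 * g⁻¹, ?_, (A.a_conj hγL g).1⟩
        change ‖A.a (g * γ0 * g⁻¹)‖ ≤ _
        rw [(A.a_conj hγL g).1]
        exact hb2 g
      · intro g g' he
        change A.L (g⁻¹ * g') t = t
        have he' : A.L g t = A.L g' t := he
        rw [A.L_mul, ← he', A.L_inv_L]
    have hne : t - p t ≠ 0 := sub_ne_zero.2 ht
    rcases c.si.irr H hH (Submodule.span ℝ {t - p t}) (by
      rw [Submodule.span_singleton_le_iff_mem]; exact c.pr.sub t) (by
      intro k hk x hx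
      obtain ⟨s, rfl⟩ := Submodule.mem_span_singleton.1 hx
      have hk' : A.L k t = t := hk
      rw [map_smul, map_sub, ← c.comm, hk']
      exact hx) with h2 | h2
    · exact hne (by simpa using h2)
    · have := c.si.dim
      rw [← h2, finrank_span_singleton hne] at this
      omega
  · have hWS : W ≤ S := by rw [← h]; exact inf_le_left
    refine vs_trans hB c.iso c.proper c.free ?_ hSinv
    obtain ⟨v, hv, hv'⟩ := c.si.tl
    exact ⟨v, hWS hv, hv'⟩

end LS


namespace LS
open Filter Topology

variable {V : Type*} [NormedAddCommGroup V] [NormedSpace ℝ V] [FiniteDimensional ℝ V]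
variable {G : Type*} [Group G]
variable {A : Aff G V} {B : V →L[ℝ] V →L[ℝ] ℝ} {W : Submodule ℝ V} {p : V →L[ℝ] V}

theorem Ctx.inv_bdd (c : Ctx A B W p) (R : ℝ) : ∃ M, 0 < M ∧ ∀ γ, ‖A.L γ‖ ≤ R → ‖A.L γ⁻¹‖ ≤ M := by
  obtain ⟨e, he, _⟩ := c.lor.ex
  obtain ⟨M, hM, h⟩ := c.lor.exists_bound (max (R * ‖e‖) ‖e‖)
  refine ⟨M, hM, fun γ hγ => h (A.L γ⁻¹) (A.L γ e) (c.iso _) (by rw [c.iso, he]) ?_ ?_⟩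
  · refine le_trans ?_ (le_max_left _ _)
    exact ((A.L γ).le_opNorm e).trans (by gcongr)
  · rw [A.L_inv_L]; exact le_max_right _ _

theorem Ctx.fin (c : Ctx A B W p) (ha : ∃ ε > 0, ∀ γ, ‖c.T γ - 1‖ < ε → A.a γ = p (A.a γ)) (R : ℝ) :
    {γ | ‖A.L γ‖ ≤ R ∧ ‖p (A.a γ)‖ ≤ R}.Finite := by
  classical
  obtain ⟨ε, hε, ha⟩ := ha
  obtain ⟨M, hM, hMi⟩ := c.inv_bdd R
  set S := {γ | ‖A.L γ‖ ≤ R ∧ ‖p (A.a γ)‖ ≤ R} with hS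
  have hT : ∀ γ ∈ S, ‖c.T γ‖ ≤ R + R + 1 := by
    rintro γ ⟨h1, h2⟩
    refine ((A.proj p c.comm).norm_toEnd_le γ).trans ?_
    change ‖A.L γ‖ + ‖p (A.a γ)‖ + 1 ≤ _
    linarith
  have hTi : ∀ γ ∈ S, ‖c.T γ⁻¹‖ ≤ M + M * |R| + 1 := by
    rintro γ ⟨h1, h2⟩
    refine ((A.proj p c.comm).norm_toEnd_le γ⁻¹).trans ?_
    change ‖A.L γ⁻¹‖ + ‖p (A.a γ⁻¹)‖ + 1 ≤ _
    have h3 := hMi γ h1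
    have h4 : ‖p (A.a γ⁻¹)‖ ≤ M * |R| := by
      rw [A.a_inv, map_neg, norm_neg, c.comm]
      exact ((A.L γ⁻¹).le_opNorm _).trans (mul_le_mul h3 (h2.trans (le_abs_self R)) (norm_nonneg _) hM.le)
    linarith
  set N := M + M * |R| + 1 with hN
  have hNp : 0 < N := by positivity
  obtain ⟨col, hfin, hcol⟩ := exists_color (fun γ => c.T γ) S _ hT (δ := ε / N) (by positivity)
  have hsub : S ⊆ ⋃ y ∈ Set.range col, S ∩ col ⁻¹' {y} := by
    intro γ hγ
    simp only [Set.mem_iUnion]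
    exact ⟨col γ, ⟨γ, rfl⟩, hγ, rfl⟩
  refine (hfin.biUnion fun y _ => ?_).subset hsub
  rcases Set.eq_empty_or_nonempty (S ∩ col ⁻¹' {y}) with h0 | ⟨γ0, h0, h0c⟩
  · rw [h0]; exact Set.finite_empty
  refine ((c.proper.finite_of_ball ε).image (fun δ => γ0 * δ)).subset ?_
  rintro γ ⟨hγ, hγc⟩
  refine ⟨γ0⁻¹ * γ, ?_, by simp⟩
  have h1 := hcol γ hγ γ0 h0 (by rw [hγc, h0c])
  have h2 : c.T (γ0⁻¹ * γ) - 1 = c.T γ0⁻¹ * (c.T γ - c.T γ0) := by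
    rw [mul_sub, ← map_mul, ← map_mul, inv_mul_cancel, map_one]
  have h3 : ‖c.T (γ0⁻¹ * γ) - 1‖ < ε := by
    rw [h2]
    calc _ ≤ ‖c.T γ0⁻¹‖ * ‖c.T γ - c.T γ0‖ := norm_mul_le _ _
      _ ≤ N * ‖c.T γ - c.T γ0‖ := by gcongr; exact hTi γ0 h0
      _ < N * (ε / N) := by gcongr
      _ = ε := by field_simp
  have h4 := c.norm_pa_le_sub (γ0⁻¹ * γ)
  rw [← ha _ h3] at h4
  exact h4.trans h3.le
end LS

namespace LS
open Filter Topology MeasureTheory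
variable {V : Type*} [NormedAddCommGroup V] [NormedSpace ℝ V] [FiniteDimensional ℝ V]

theorem interp {t0 : ℝ} (ht0 : 0 < t0) : ∃ (s : Finset ℝ) (w : ℝ → ℝ), (∀ t ∈ s, 0 < t ∧ t < t0) ∧ ∑ t ∈ s, w t = 1 ∧
    ∀ M : V →L[ℝ] V, ∑ t ∈ s, w t * (1 + t • M).det = (1 + M).det := by
  classical
  let n := Module.finrank ℝ V
  let b := Module.finBasis ℝ V
  obtain ⟨s, hs, hc⟩ := (Set.Ioo_infinite ht0).exists_subset_card_eq (n + 1)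
  refine ⟨s, fun t => (Lagrange.basis s id t).eval 1, fun t ht => hs ht, ?_, ?_⟩
  · have := Lagrange.sum_basis (s := s) (v := (id : ℝ → ℝ)) (Set.injOn_id _) (Finset.card_pos.1 (by omega))
    have h2 := congrArg (Polynomial.eval 1) this
    rw [Polynomial.eval_finset_sum] at h2
    simpa using h2
  · intro M
    let P := LinearMap.toMatrix b b (M : V →ₗ[ℝ] V)
    let f : Polynomial ℝ := Matrix.det ((Polynomial.X : Polynomial ℝ) • P.map Polynomial.C + (1 : Matrix (Fin n) (Fin n) ℝ).map Polynomial.C)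
    have hf : ∀ t : ℝ, f.eval t = (1 + t • M).det := by
      intro t
      have h1 : (1 + t • M).det = (1 + t • P).det := by
        rw [ContinuousLinearMap.det, ← LinearMap.det_toMatrix b]
        congr 1
        simp [P, map_add, LinearMap.toMatrix_one]
      rw [h1, ← Polynomial.coe_evalRingHom, RingHom.map_det]
      congr 1
      ext i j
      simp [Matrix.one_apply]
      split_ifs <;> simp <;> ring
    have hd : f.degree < s.card := by
      rw [hc]
      refine lt_of_le_of_lt Polynomial.degree_le_natDegree ?_
      have := Polynomial.natDegree_det_X_add_C_le P 1
      rw [Fintype.card_fin] at this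
      exact_mod_cast Nat.lt_succ_of_le this
    have h := Lagrange.eq_interpolate (s := s) (v := id) (Set.injOn_id _) hd
    have h2 := congrArg (Polynomial.eval 1) h
    rw [hf, one_smul, Lagrange.interpolate_apply, Polynomial.eval_finset_sum] at h2
    rw [h2]
    refine Finset.sum_congr rfl fun t ht => ?_
    simp [hf, mul_comm]

theorem det_iso {B : V →L[ℝ] V →L[ℝ] ℝ} (hB : Lor B) (M : V →L[ℝ] V) (h : ∀ x y, B (M x) (M y) = B x y) :
    |M.det| = 1 := by
  classical
  let b := Module.finBasis ℝ V
  let B' : V →ₗ[ℝ] V →ₗ[ℝ] ℝ := LinearMap.mk₂ ℝ (fun x y => B x y) (by simp) (by simp) (by simp) (by simp)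
  let N := LinearMap.toMatrix₂ b b B'
  have hN : N.det ≠ 0 := by
    rw [← LinearMap.separatingLeft_iff_det_ne_zero]
    intro x hx
    exact hB.nondeg hx
  have h1 : N = (LinearMap.toMatrix b b (M : V →ₗ[ℝ] V)).transpose * N * LinearMap.toMatrix b b (M : V →ₗ[ℝ] V) := by
    rw [← LinearMap.toMatrix₂_compl₁₂ b b b b]
    have h0 : B'.compl₁₂ (M : V →ₗ[ℝ] V) (M : V →ₗ[ℝ] V) = B' := LinearMap.ext₂ fun x y => h x y
    rw [h0]
  have h2 := congrArg Matrix.det h1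
  rw [Matrix.det_mul, Matrix.det_mul, Matrix.det_transpose, LinearMap.det_toMatrix] at h2
  have h3 : (LinearMap.det (M : V →ₗ[ℝ] V)) ^ 2 = 1 := by
    apply mul_right_cancel₀ hN
    linarith
  rw [ContinuousLinearMap.det]
  rcases mul_self_eq_one_iff.1 ((sq _).symm.trans h3) with h | h <;> simp [h]

variable {G : Type*} [Group G]

theorem Aff.Proper.countable {A : Aff G V} (h : A.Proper) : Countable G := by
  have h1 : (Set.univ : Set G) = ⋃ n : ℕ, {g | ‖A.a g‖ ≤ n} := by
    ext g
    simp only [Set.mem_univ, Set.mem_iUnion, Set.mem_setOf_eq, true_iff]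
    exact exists_nat_ge _
  rw [← Set.countable_univ_iff, h1]
  exact Set.countable_iUnion fun n => (h.finite_of_ball n).countable

theorem exists_fund [MeasurableSpace V] [BorelSpace V] {A : Aff G V} (hp : A.Proper) (hc : A.Cocpt) (hf : A.Free) :
    ∃ D : Set V, MeasurableSet D ∧ Bornology.IsBounded D ∧ (∀ x, ∃ γ, A.act γ x ∈ D) ∧
      ∀ γ, ∀ x ∈ D, A.act γ x ∈ D → γ = 1 := by
  have : ProperSpace V := FiniteDimensional.proper ℝ V
  have := hp.countable
  obtain ⟨R, hR⟩ := hc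
  have key : ∃ D : Set V, MeasurableSet D ∧ Bornology.IsBounded D ∧ (∀ x ∈ Metric.closedBall (0 : V) R, ∃ γ, A.act γ x ∈ D) ∧
      ∀ γ, ∀ x ∈ D, A.act γ x ∈ D → γ = 1 := by
    refine (isCompact_closedBall (0 : V) R).induction_on (p := fun K => ∃ D : Set V, MeasurableSet D ∧
      Bornology.IsBounded D ∧ (∀ x ∈ K, ∃ γ, A.act γ x ∈ D) ∧ ∀ γ, ∀ x ∈ D, A.act γ x ∈ D → γ = 1) ?_ ?_ ?_ ?_
    · exact ⟨∅, by simp⟩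
    · rintro s t hst ⟨D, h1, h2, h3, h4⟩
      exact ⟨D, h1, h2, fun x hx => h3 x (hst hx), h4⟩
    · rintro s t ⟨D, h1, h2, h3, h4⟩ ⟨E, k1, k2, k3, k4⟩
      refine ⟨D ∪ (E \ ⋃ γ, A.act γ ⁻¹' D), ?_, ?_, ?_, ?_⟩
      · exact h1.union (k1.diff (MeasurableSet.iUnion fun γ => (A.continuous_act γ).measurable h1))
      · exact h2.union (k2.subset Set.diff_subset)
      · rintro x (hx | hx)
        · obtain ⟨γ, hγ⟩ := h3 x hx
          exact ⟨γ, Or.inl hγ⟩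
        · obtain ⟨γ, hγ⟩ := k3 x hx
          by_cases hh : ∃ η, A.act η (A.act γ x) ∈ D
          · obtain ⟨η, hη⟩ := hh
            exact ⟨η * γ, Or.inl (by rw [A.act_mul]; exact hη)⟩
          · refine ⟨γ, Or.inr ⟨hγ, ?_⟩⟩
            simpa using hh
      · rintro γ x (hx | ⟨hx, hx'⟩) (hy | ⟨hy, hy'⟩)
        · exact h4 γ x hx hy
        · exfalso; apply hy'
          simp only [Set.mem_iUnion, Set.mem_preimage]
          exact ⟨γ⁻¹, by rw [A.act_inv_act]; exact hx⟩
        · exfalso; apply hx'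
          simp only [Set.mem_iUnion, Set.mem_preimage]
          exact ⟨γ, hy⟩
        · exact k4 γ x hx hy
    · intro x _
      have hS := hp (‖x‖ + 1)
      have hU : ∀ᶠ z in 𝓝 x ×ˢ 𝓝 x, ∀ γ ∈ {g | ∃ y, ‖y‖ ≤ ‖x‖ + 1 ∧ ‖A.act g y‖ ≤ ‖x‖ + 1}, γ ≠ 1 → A.act γ z.1 ≠ z.2 := by
        rw [Filter.eventually_all_finite hS]
        intro γ _
        by_cases h1 : γ = 1
        · simp [h1]
        have hne : A.act γ x ≠ x := fun h => h1 (hf γ x h)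
        have ht : Tendsto (fun z : V × V => (A.act γ z.1, z.2)) (𝓝 x ×ˢ 𝓝 x) (𝓝 (A.act γ x, x)) := by
          rw [← nhds_prod_eq]
          have : Continuous (fun z : V × V => (A.act γ z.1, z.2)) :=
            ((A.continuous_act γ).comp continuous_fst).prodMk continuous_snd
          exact this.tendsto (x, x)
        have ho : {z : V × V | z.1 ≠ z.2} ∈ 𝓝 (A.act γ x, x) :=
          (isOpen_ne_fun continuous_fst continuous_snd).mem_nhds hne
        filter_upwards [ht ho] with z hz _ using hz
      rw [Filter.eventually_prod_self_iff'] at hU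
      obtain ⟨t, ht, hU⟩ := hU
      let U := interior t ∩ Metric.ball x 1
      have hUx : U ∈ 𝓝 x := inter_mem (interior_mem_nhds.2 ht) (Metric.ball_mem_nhds x one_pos)
      have hn : ∀ y ∈ U, ‖y‖ ≤ ‖x‖ + 1 := by
        intro y hy
        have := hy.2
        rw [Metric.mem_ball, dist_eq_norm] at this
        have h2 := norm_sub_norm_le y x
        linarith
      refine ⟨U, mem_nhdsWithin_of_mem_nhds hUx, U, (isOpen_interior.inter Metric.isOpen_ball).measurableSet,
        Metric.isBounded_ball.subset Set.inter_subset_right, fun y hy => ⟨1, by rwa [A.act_one]⟩, ?_⟩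
      intro γ y hy hγy
      by_contra h1
      exact hU y (interior_subset hy.1) (A.act γ y) (interior_subset hγy.1) γ ⟨y, hn y hy, hn _ hγy⟩ h1 rfl
  obtain ⟨D, h1, h2, h3, h4⟩ := key
  refine ⟨D, h1, h2, fun x => ?_, h4⟩
  obtain ⟨g, hg⟩ := hR x
  obtain ⟨γ, hγ⟩ := h3 (A.act g x) (by simpa using hg)
  exact ⟨γ * g, by rw [A.act_mul]; exact hγ⟩
end LS

namespace LS
open Filter Topology MeasureTheory
variable {V : Type*} [NormedAddCommGroup V] [NormedSpace ℝ V] [FiniteDimensional ℝ V]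
variable {G : Type*} [Group G]

theorem act_preimage [MeasurableSpace V] [BorelSpace V] {A : Aff G V} (hd : ∀ γ, |(A.L γ).det| = 1) (μ : Measure V) [μ.IsAddHaarMeasure]
    (γ : G) (s : Set V) : μ (A.act γ ⁻¹' s) = μ s := by
  have h1 : A.act γ ⁻¹' s = (A.L γ : V →ₗ[ℝ] V) ⁻¹' ((fun x => x + A.a γ) ⁻¹' s) := rfl
  have h2 : LinearMap.det (A.L γ : V →ₗ[ℝ] V) ≠ 0 := by
    intro h
    have := hd γ
    rw [ContinuousLinearMap.det, h] at this
    simp at this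
  have h3 := hd γ
  rw [ContinuousLinearMap.det] at h3
  rw [h1, Measure.addHaar_preimage_linearMap μ h2, measure_preimage_add_right, abs_inv, h3]
  simp

theorem fund_measure [MeasurableSpace V] [BorelSpace V] {A : Aff G V} (hp : A.Proper) (hd : ∀ γ, |(A.L γ).det| = 1)
    (μ : Measure V) [μ.IsAddHaarMeasure]
    {D E : Set V} (hD : MeasurableSet D) (hE : MeasurableSet E) (hD1 : ∀ x, ∃ γ, A.act γ x ∈ D) (hE1 : ∀ x, ∃ γ, A.act γ x ∈ E)
    (hD2 : ∀ γ, ∀ x ∈ D, A.act γ x ∈ D → γ = 1) (hE2 : ∀ γ, ∀ x ∈ E, A.act γ x ∈ E → γ = 1) : μ D = μ E := by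
  have := hp.countable
  letI : MulAction G V := { smul := A.act, one_smul := A.act_one, mul_smul := A.act_mul }
  have hsm : ∀ (g : G) (x : V), g • x = A.act g x := fun _ _ => rfl
  letI : MeasurableSpace G := ⊤
  haveI : MeasurableConstSMul G V := ⟨fun g => (A.continuous_act g).measurable⟩
  haveI : SMulInvariantMeasure G V μ := ⟨fun g s _ => act_preimage hd μ g s⟩
  have mk : ∀ D : Set V, MeasurableSet D → (∀ x, ∃ γ, A.act γ x ∈ D) → (∀ γ, ∀ x ∈ D, A.act γ x ∈ D → γ = 1) →
      IsFundamentalDomain G D μ := by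
    intro D h1 h2 h3
    refine IsFundamentalDomain.mk'' h1.nullMeasurableSet (Eventually.of_forall h2) ?_ ?_
    · intro g hg
      apply Disjoint.aedisjoint
      rw [Set.disjoint_left]
      rintro _ ⟨x, hx, rfl⟩ hy
      exact hg (h3 g x hx hy)
    · intro g
      exact (measurePreserving_smul g μ).quasiMeasurePreserving
  exact (mk D hD hD1 hD2).measure_eq (mk E hE hE1 hE2)

theorem exists_lip (E : V → V) (hE : ContDiff ℝ 1 E) (R : ℝ) : ∃ C > 0, (∀ x, ‖x‖ ≤ R → ‖E x‖ ≤ C ∧ ‖fderiv ℝ E x‖ ≤ C) ∧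
    ∀ x y, ‖x‖ ≤ R → ‖y‖ ≤ R → ‖E x - E y‖ ≤ C * ‖x - y‖ := by
  have : ProperSpace V := FiniteDimensional.proper ℝ V
  obtain ⟨C1, h1⟩ := (isCompact_closedBall (0 : V) R).exists_bound_of_continuousOn hE.continuous.continuousOn
  obtain ⟨C2, h2⟩ := (isCompact_closedBall (0 : V) R).exists_bound_of_continuousOn (hE.continuous_fderiv one_ne_zero).continuousOn
  have hb : ∀ x : V, ‖x‖ ≤ R → x ∈ Metric.closedBall (0 : V) R := fun x hx => by simpa using hx
  refine ⟨max (max C1 C2) 1, by positivity, fun x hx => ⟨(h1 x (hb x hx)).trans (by simp), (h2 x (hb x hx)).trans (by simp)⟩, ?_⟩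
  intro x y hx hy
  refine (convex_closedBall (0 : V) R).norm_image_sub_le_of_norm_fderiv_le (𝕜 := ℝ) (fun z _ => (hE.differentiable one_ne_zero) z)
    (fun z hz => (h2 z hz).trans (by simp)) (hb y hy) (hb x hx)

theorem deform {A : Aff G V} (hp : A.Proper) (hc : A.Cocpt) (E : V → V) (hE : ContDiff ℝ 1 E)
    (heq : ∀ γ x, E (A.act γ x) = A.L γ (E x)) : ∃ t0 > (0 : ℝ), ∀ t : ℝ, 0 < t → t < t0 →
      Function.Bijective (fun x => x + t • E x) ∧ ∀ x, 0 < (1 + t • fderiv ℝ E x).det := by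
  obtain ⟨R0, hR0⟩ := hc
  set R := max R0 0 with hRdef
  have hR : ∀ x, ∃ g, ‖A.act g x‖ ≤ R := fun x => by
    obtain ⟨g, hg⟩ := hR0 x
    exact ⟨g, hg.trans (le_max_left _ _)⟩
  have hRn : 0 ≤ R := le_max_right _ _
  have hφ : ∀ (t : ℝ) γ x, A.act γ x + t • E (A.act γ x) = A.act γ (x + t • E x) := by
    intro t γ x
    rw [heq]; simp only [Aff.act, map_add, map_smul]; abel
  obtain ⟨C, hC, hCb, hCl⟩ := exists_lip E hE (R + 1)
  -- uniform bound
  obtain ⟨R', hR'⟩ : ∃ R', ∀ (t : ℝ) x y, 0 < t → t < 1 → ‖x‖ ≤ R → x + t • E x = y + t • E y → ‖y‖ ≤ R' := by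
    have hF := hp (R + C)
    obtain ⟨N, hN⟩ : ∃ N, ∀ g ∈ {g | ∃ x, ‖x‖ ≤ R + C ∧ ‖A.act g x‖ ≤ R + C}, ‖A.L g‖ * R + ‖A.a g‖ ≤ N := by
      obtain ⟨N, hN⟩ := (hF.image (fun g => ‖A.L g‖ * R + ‖A.a g‖)).bddAbove
      exact ⟨N, fun g hg => hN ⟨g, hg, rfl⟩⟩
    refine ⟨N, fun t x y ht0 ht1 hx hxy => ?_⟩
    obtain ⟨g, hg⟩ := hR y
    have hb : ∀ z, ‖z‖ ≤ R → ‖z + t • E z‖ ≤ R + C := by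
      intro z hz
      refine (norm_add_le _ _).trans (add_le_add hz ?_)
      rw [norm_smul, Real.norm_eq_abs, abs_of_pos ht0]
      have := (hCb z (by linarith)).1
      nlinarith [norm_nonneg (E z)]
    have hy : A.act g⁻¹ (A.act g y) = y := A.act_inv_act g y
    have h2 : ‖A.act g⁻¹ (A.act g y + t • E (A.act g y))‖ ≤ R + C := by
      rw [← hφ, hy, ← hxy]; exact hb x hx
    have h3 := hN g⁻¹ ⟨_, hb _ hg, h2⟩
    calc ‖y‖ = ‖A.act g⁻¹ (A.act g y)‖ := by rw [hy]
      _ ≤ ‖A.L g⁻¹‖ * ‖A.act g y‖ + ‖A.a g⁻¹‖ := A.norm_act_le _ _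
      _ ≤ ‖A.L g⁻¹‖ * R + ‖A.a g⁻¹‖ := by gcongr
      _ ≤ N := h3
  obtain ⟨C', hC', -, hCl'⟩ := exists_lip E hE (max R R')
  -- determinant
  obtain ⟨δ, hδ, hdet⟩ : ∃ δ > 0, ∀ M : V →L[ℝ] V, ‖M‖ < δ → 0 < (1 + M).det := by
    have hcont : Continuous fun M : V →L[ℝ] V => (1 + M).det :=
      ContinuousLinearMap.continuous_det.comp (continuous_const.add continuous_id)
    have h1 : {M : V →L[ℝ] V | 0 < (1 + M).det} ∈ 𝓝 (0 : V →L[ℝ] V) := by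
      apply (isOpen_lt continuous_const hcont).mem_nhds
      have : (1 : V →L[ℝ] V).det = 1 := by
        rw [ContinuousLinearMap.det]
        exact LinearMap.det_id
      simp [this]
    obtain ⟨δ, hδ, h⟩ := Metric.mem_nhds_iff.1 h1
    exact ⟨δ, hδ, fun M hM => h (by simpa using hM)⟩
  refine ⟨min (min 1 (1 / C')) (min (1 / C) (δ / C)), by positivity, fun t ht0 ht => ?_⟩
  rw [lt_min_iff, lt_min_iff, lt_min_iff] at ht
  obtain ⟨⟨ht1, ht2⟩, ht3, ht4⟩ := ht
  rw [lt_div_iff₀ hC'] at ht2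
  rw [lt_div_iff₀ hC] at ht3 ht4
  refine ⟨⟨?_, ?_⟩, ?_⟩
  · -- injective
    have hinj : ∀ x y, ‖x‖ ≤ R → x + t • E x = y + t • E y → x = y := by
      intro x y hx hxy
      have hy := hR' t x y ht0 ht1 hx hxy
      have h1 := hCl' x y (hx.trans (le_max_left _ _)) (hy.trans (le_max_right _ _))
      have h2 : x - y = -(t • (E x - E y)) := by
        rw [smul_sub]
        have := sub_eq_zero.2 hxy
        rw [← sub_eq_zero, ← this]; abel
      have h3 : ‖x - y‖ = t * ‖E x - E y‖ := by
        conv_lhs => rw [h2]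
        rw [norm_neg, norm_smul, Real.norm_eq_abs, abs_of_pos ht0]
      by_contra hne
      have h4 : 0 < ‖x - y‖ := norm_pos_iff.2 (sub_ne_zero.2 hne)
      have h5 : t * ‖E x - E y‖ ≤ t * (C' * ‖x - y‖) := by gcongr
      nlinarith
    intro x y hxy
    obtain ⟨g, hg⟩ := hR x
    have := hinj (A.act g x) (A.act g y) hg (by rw [hφ, hφ]; exact congrArg _ hxy)
    have h2 := congrArg (A.act g⁻¹) this
    rwa [A.act_inv_act, A.act_inv_act] at h2
  · -- surjective
    have hsurj : ∀ z, ‖z‖ ≤ R → ∃ x, x + t • E x = z := by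
      intro z hz
      let f : V → V := fun x => z - t • E x
      let s : Set V := Metric.closedBall 0 (R + 1)
      have hs : ∀ x ∈ s, ‖x‖ ≤ R + 1 := fun x hx => by simpa [s] using hx
      have hmaps : Set.MapsTo f s s := by
        intro x hx
        have h1 := (hCb x (hs x hx)).1
        have h2 : ‖t • E x‖ ≤ 1 := by
          rw [norm_smul, Real.norm_eq_abs, abs_of_pos ht0]
          nlinarith
        have h3 : ‖f x‖ ≤ R + 1 := (norm_sub_le _ _).trans (add_le_add hz h2)
        simpa [s] using h3
      have hcw : ContractingWith (⟨t * C, by positivity⟩ : NNReal) (hmaps.restrict f s s) := by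
        refine ⟨by exact_mod_cast ht3, ?_⟩
        apply LipschitzWith.of_dist_le_mul
        rintro ⟨x, hx⟩ ⟨y, hy⟩
        change dist (f x) (f y) ≤ t * C * dist x y
        rw [dist_eq_norm, dist_eq_norm]
        have : f x - f y = -(t • (E x - E y)) := by simp only [f, smul_sub]; abel
        rw [this, norm_neg, norm_smul, Real.norm_eq_abs, abs_of_pos ht0, mul_assoc]
        gcongr
        exact hCl x y (hs x hx) (hs y hy)
      have : CompleteSpace V := FiniteDimensional.complete ℝ V
      obtain ⟨x, _, hx, _⟩ := hcw.exists_fixedPoint' (Metric.isClosed_closedBall.isComplete) hmaps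
        (x := 0) (by simp [s]; linarith) (edist_ne_top _ _)
      refine ⟨x, ?_⟩
      have hx' : z - t • E x = x := hx
      exact (sub_eq_iff_eq_add.1 hx').symm
    intro z
    obtain ⟨g, hg⟩ := hR z
    obtain ⟨x, hx⟩ := hsurj _ hg
    refine ⟨A.act g⁻¹ x, ?_⟩
    change A.act g⁻¹ x + t • E (A.act g⁻¹ x) = z
    rw [hφ, hx, A.act_inv_act]
  · intro x
    obtain ⟨g, hg⟩ := hR x
    have h1 : 0 < (1 + t • fderiv ℝ E (A.act g x)).det := by
      apply hdet
      rw [norm_smul, Real.norm_eq_abs, abs_of_pos ht0]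
      have := (hCb _ (hg.trans (by linarith : R ≤ R + 1))).2
      nlinarith
    have h2 : (fderiv ℝ E (A.act g x)).comp (A.L g) = (A.L g).comp (fderiv ℝ E x) := by
      have hd := hE.differentiable one_ne_zero
      have e1 : HasFDerivAt (fun y => E (A.act g y)) ((fderiv ℝ E (A.act g x)).comp (A.L g)) x := by
        refine HasFDerivAt.comp x (hd _).hasFDerivAt ?_
        exact (A.L g).hasFDerivAt.add_const _
      have e2 : HasFDerivAt (fun y => E (A.act g y)) ((A.L g).comp (fderiv ℝ E x)) x := by
        simp_rw [heq]
        exact (A.L g).hasFDerivAt.comp x (hd x).hasFDerivAt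
      exact e1.unique e2
    have h3 : (1 + t • fderiv ℝ E x) = (A.L g⁻¹) * ((1 + t • fderiv ℝ E (A.act g x)) * A.L g) := by
      have h4 : (1 + t • fderiv ℝ E (A.act g x)) * A.L g = A.L g * (1 + t • fderiv ℝ E x) := by
        rw [add_mul, mul_add, one_mul, mul_one, smul_mul_assoc, mul_smul_comm]
        congr 2
      rw [h4, ← mul_assoc, ← map_mul, inv_mul_cancel, map_one, one_mul]
    have hdm : ∀ M N : V →L[ℝ] V, (M * N).det = M.det * N.det := fun M N => by
      simp only [ContinuousLinearMap.det]
      exact LinearMap.det_comp _ _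
    have h5 : (A.L g⁻¹).det * (A.L g).det = 1 := by
      rw [← hdm, ← map_mul, inv_mul_cancel, map_one, ContinuousLinearMap.det]
      exact LinearMap.det_id
    rw [h3, hdm, hdm]
    calc (0 : ℝ) < (1 + t • fderiv ℝ E (A.act g x)).det * ((A.L g⁻¹).det * (A.L g).det) := by rw [h5, mul_one]; exact h1
      _ = _ := by ring
end LS

namespace LS
open Filter Topology MeasureTheory
variable {V : Type*} [NormedAddCommGroup V] [NormedSpace ℝ V] [FiniteDimensional ℝ V]
variable {G : Type*} [Group G]

/-- an equivariant C¹ map cannot be everywhere degenerate -/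
theorem degree {A : Aff G V} (hp : A.Proper) (hc : A.Cocpt) (hf : A.Free) (hd : ∀ γ, |(A.L γ).det| = 1)
    (q : V → V) (hq : ContDiff ℝ 1 q) (heq : ∀ γ x, q (A.act γ x) = A.act γ (q x))
    (h0 : ∀ x, (fderiv ℝ q x).det = 0) : False := by
  letI : MeasurableSpace V := borel V
  haveI : BorelSpace V := ⟨rfl⟩
  have : ProperSpace V := FiniteDimensional.proper ℝ V
  let μ : Measure V := Measure.addHaar
  let E : V → V := fun x => q x - x
  have hE : ContDiff ℝ 1 E := hq.sub contDiff_id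
  have hEeq : ∀ γ x, E (A.act γ x) = A.L γ (E x) := by
    intro γ x; simp only [E, heq, A.act_sub]
  have hDE : ∀ x, 1 + fderiv ℝ E x = fderiv ℝ q x := by
    intro x
    have h1 : HasFDerivAt E (fderiv ℝ q x - ContinuousLinearMap.id ℝ V) x :=
      ((hq.differentiable one_ne_zero) x).hasFDerivAt.sub (hasFDerivAt_id x)
    rw [h1.fderiv]
    change ContinuousLinearMap.id ℝ V + _ = _
    abel
  obtain ⟨t0, ht0, hdef⟩ := deform hp hc E hE hEeq
  obtain ⟨s, w, hs, hw, hIntg⟩ := interp (V := V) ht0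
  obtain ⟨D, hD, hDb, hD1, hD2⟩ := exists_fund hp hc hf
  have hφ : ∀ (t : ℝ) γ x, A.act γ x + t • E (A.act γ x) = A.act γ (x + t • E x) := by
    intro t γ x
    rw [hEeq]; simp only [Aff.act, map_add, map_smul]; abel
  have hI : ∀ t ∈ s, ∫ x in D, (1 + t • fderiv ℝ E x).det ∂μ = μ.real D := by
    intro t ht
    obtain ⟨⟨hinj, hsurj⟩, hpos⟩ := hdef t (hs t ht).1 (hs t ht).2
    set f : V → V := fun x => x + t • E x with hfdef
    have hf' : ∀ x ∈ D, HasFDerivWithinAt f (1 + t • fderiv ℝ E x) D x := by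
      intro x _
      refine HasFDerivAt.hasFDerivWithinAt ?_
      exact (hasFDerivAt_id x).add (((hE.differentiable one_ne_zero) x).hasFDerivAt.const_smul t)
    have h1 := integral_image_eq_integral_abs_det_fderiv_smul μ hD hf' hinj.injOn (fun _ => (1 : ℝ))
    have h2 : MeasurableSet (f '' D) := measurable_image_of_fderivWithin hD hf' hinj.injOn
    have h3 : μ D = μ (f '' D) := by
      refine fund_measure hp hd μ hD h2 hD1 ?_ hD2 ?_
      · intro y
        obtain ⟨x, rfl⟩ := hsurj y
        obtain ⟨γ, hγ⟩ := hD1 x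
        exact ⟨γ, A.act γ x, hγ, hφ t γ x⟩
      · rintro γ _ ⟨x, hx, rfl⟩ ⟨y, hy, hyx⟩
        have : f y = f (A.act γ x) := hyx.trans (hφ t γ x).symm
        rw [hinj this] at hy
        exact hD2 γ x hx hy
    have h4 : ∀ x, |(1 + t • fderiv ℝ E x).det| • (1 : ℝ) = (1 + t • fderiv ℝ E x).det := fun x => by
      rw [abs_of_pos (hpos x), smul_eq_mul, mul_one]
    simp only [h4] at h1
    rw [← h1]
    simp [Measure.real, h3]
  have hcont : ∀ t : ℝ, Continuous fun x => (1 + t • fderiv ℝ E x).det := fun t =>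
    ContinuousLinearMap.continuous_det.comp (continuous_const.add ((hE.continuous_fderiv one_ne_zero).const_smul t))
  have hInt : ∀ t : ℝ, IntegrableOn (fun x => (1 + t • fderiv ℝ E x).det) D μ := by
    intro t
    obtain ⟨r, hr⟩ := hDb.subset_closedBall (0 : V)
    exact ((hcont t).continuousOn.integrableOn_compact (isCompact_closedBall (0 : V) r)).mono_set hr
  have hz : μ.real D = 0 := by
    calc μ.real D = ∑ t ∈ s, w t * μ.real D := by rw [← Finset.sum_mul, hw, one_mul]
      _ = ∑ t ∈ s, ∫ x in D, w t * (1 + t • fderiv ℝ E x).det ∂μ := by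
          refine Finset.sum_congr rfl fun t ht => ?_
          rw [integral_const_mul, hI t ht]
      _ = ∫ x in D, ∑ t ∈ s, w t * (1 + t • fderiv ℝ E x).det ∂μ := by
          rw [integral_finset_sum]
          intro t _
          exact (hInt t).const_mul _
      _ = ∫ x in D, (0 : ℝ) ∂μ := by
          refine integral_congr_ae (Eventually.of_forall fun x => ?_)
          change ∑ t ∈ s, w t * (1 + t • fderiv ℝ E x).det = 0
          rw [hIntg, hDE, h0]
      _ = 0 := by simp
  have hfin : μ D ≠ ⊤ := (hDb.measure_lt_top).ne
  have hz2 : μ D = 0 := by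
    rcases (ENNReal.toReal_eq_zero_iff _).1 hz with h | h
    · exact h
    · exact absurd h hfin
  have := hp.countable
  have hu : (Set.univ : Set V) = ⋃ γ, A.act γ ⁻¹' D := by
    ext x; simpa using hD1 x
  have hmu : μ Set.univ = 0 := by
    rw [hu, measure_iUnion_null_iff]
    intro γ
    rw [act_preimage hd, hz2]
  have hne : μ ≠ 0 := NeZero.ne μ
  exact hne (Measure.measure_univ_eq_zero.1 hmu)
end LS

namespace LS
open Filter Topology
variable {V : Type*} [NormedAddCommGroup V] [NormedSpace ℝ V] [FiniteDimensional ℝ V]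
variable {G : Type*} [Group G]

theorem exists_cut (R : ℝ) : ∃ φ : V → ℝ, ContDiff ℝ 1 φ ∧ (∀ x, 0 ≤ φ x) ∧ (∀ x, ‖x‖ ≤ R → φ x = 1) ∧
    ∃ R', ∀ x, φ x ≠ 0 → ‖x‖ ≤ R' := by
  let f : ContDiffBump (0 : V) := ⟨|R| + 1, |R| + 2, by positivity, by linarith⟩
  refine ⟨f, f.contDiff, fun x => f.nonneg, fun x hx => f.one_of_mem_closedBall ?_, |R| + 2, fun x hx => ?_⟩
  · rw [mem_closedBall_zero_iff]
    change ‖x‖ ≤ |R| + 1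
    linarith [le_abs_self R]
  · have : x ∈ Function.support f := hx
    rw [f.support_eq, mem_ball_zero_iff] at this
    exact this.le

/-- averaging -/
noncomputable def avg {E : Type*} [AddCommGroup E] [Module ℝ E] (A : Aff G V) (θ : V → ℝ) (f : G → E) (x : V) : E :=
  ∑ᶠ γ, θ (A.act γ x) • f γ

/-- local finiteness -/
def LF (A : Aff G V) (θ : V → ℝ) : Prop := ∀ r : ℝ, {γ | ∃ y, ‖y‖ ≤ r ∧ θ (A.act γ y) ≠ 0}.Finite

section
variable {E : Type*} [AddCommGroup E] [Module ℝ E]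

theorem LF.loc {A : Aff G V} {θ : V → ℝ} (h : LF A θ) (x : V) : ∃ S : Finset G, ∀ᶠ y in 𝓝 x,
    (∀ γ, θ (A.act γ y) ≠ 0 → γ ∈ S) := by
  refine ⟨(h (‖x‖ + 1)).toFinset, ?_⟩
  filter_upwards [Metric.ball_mem_nhds x one_pos] with y hy γ hγ
  rw [Set.Finite.mem_toFinset]
  refine ⟨y, ?_, hγ⟩
  rw [Metric.mem_ball, dist_eq_norm] at hy
  have h2 := norm_sub_norm_le y x
  linarith

theorem avg_eq {A : Aff G V} {θ : V → ℝ} {y : V} {S : Finset G} (hS : ∀ γ, θ (A.act γ y) ≠ 0 → γ ∈ S) (f : G → E) :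
    avg A θ f y = ∑ γ ∈ S, θ (A.act γ y) • f γ := by
  apply finsum_eq_sum_of_support_subset
  intro γ hγ
  apply hS
  intro h0
  apply hγ
  simp [h0]

theorem avg_act (A : Aff G V) (θ : V → ℝ) (f : G → E) (η : G) (x : V) :
    avg A θ f (A.act η x) = avg A θ (fun γ => f (γ * η⁻¹)) x := by
  unfold avg
  refine finsum_eq_of_bijective (fun γ => γ * η) (Group.mulRight_bijective η) fun γ => ?_
  simp [A.act_mul]

theorem LF.avg_pos {A : Aff G V} {θ : V → ℝ} (h : LF A θ) (h0 : ∀ x, 0 ≤ θ x) {x : V} (hx : ∃ γ, 0 < θ (A.act γ x)) :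
    0 < avg A θ (fun _ => (1 : ℝ)) x := by
  obtain ⟨S, hS⟩ := h.loc x
  have hS := hS.self_of_nhds
  rw [avg_eq hS]
  obtain ⟨γ, hγ⟩ := hx
  refine Finset.sum_pos' (fun γ _ => by simpa using h0 _) ⟨γ, hS γ hγ.ne', by simpa using hγ⟩

end

theorem LF.contDiff {E : Type*} [NormedAddCommGroup E] [NormedSpace ℝ E] {A : Aff G V} {θ : V → ℝ} (h : LF A θ)
    (hθ : ContDiff ℝ 1 θ) (f : G → E) : ContDiff ℝ 1 (avg A θ f) := by
  rw [contDiff_iff_contDiffAt]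
  intro x
  obtain ⟨S, hS⟩ := h.loc x
  have h1 : ContDiff ℝ 1 (fun y => ∑ γ ∈ S, θ (A.act γ y) • f γ) := by
    apply ContDiff.sum
    intro γ _
    refine ContDiff.smul (hθ.comp ?_) contDiff_const
    unfold Aff.act
    fun_prop
  refine h1.contDiffAt.congr_of_eventuallyEq ?_
  filter_upwards [hS] with y hy
  exact avg_eq hy f

/-- an equivariant field of unit timelike vectors -/
theorem exists_field {A : Aff G V} {B : V →L[ℝ] V →L[ℝ] ℝ} {W : Submodule ℝ V} (hB : Lor B)
    (iso : ∀ g x y, B (A.L g x) (A.L g y) = B x y) (hp : A.Proper) (hc : A.Cocpt)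
    (inv : ∀ g, ∀ w ∈ W, A.L g w ∈ W) {w0 : V} (hw0 : w0 ∈ W) (hww : B w0 w0 < 0)
    (hor : ∀ γ, B w0 (A.L γ w0) < 0) :
    ∃ h : V → V, ContDiff ℝ 1 h ∧ (∀ x, h x ∈ W) ∧ (∀ x, B (h x) (h x) = -1) ∧ ∀ γ x, h (A.act γ x) = A.L γ (h x) := by
  obtain ⟨R, hR⟩ := hc
  obtain ⟨φ, hφ, hφ0, hφ1, R', hφR⟩ := exists_cut (V := V) R
  have hLF : LF A φ := by
    intro r
    refine (hp (max r R')).subset ?_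
    rintro γ ⟨y, hy, hγ⟩
    exact ⟨y, hy.trans (le_max_left _ _), (hφR _ hγ).trans (le_max_right _ _)⟩
  let f : G → V := fun γ => A.L γ⁻¹ w0
  let h0 := avg A φ f
  have h0c : ContDiff ℝ 1 h0 := hLF.contDiff hφ f
  have h0W : ∀ x, h0 x ∈ W := by
    intro x
    obtain ⟨S, hS⟩ := hLF.loc x
    change avg A φ f x ∈ W
    rw [avg_eq hS.self_of_nhds]
    exact W.sum_mem fun γ _ => W.smul_mem _ (inv _ _ hw0)
  have h0e : ∀ η x, h0 (A.act η x) = A.L η (h0 x) := by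
    intro η x
    obtain ⟨S, hS⟩ := hLF.loc x
    change avg A φ f (A.act η x) = A.L η (avg A φ f x)
    rw [avg_act, avg_eq hS.self_of_nhds, avg_eq hS.self_of_nhds, map_sum]
    refine Finset.sum_congr rfl fun γ _ => ?_
    simp only [f, map_smul, mul_inv_rev, inv_inv, A.L_mul]
  have hff : ∀ γ η, B (f γ) (f η) < 0 := fun γ η =>
    hB.cone (by simp only [f, iso]; exact hww) (by simp only [f, iso]; exact hww) hww (hor _) (hor _)
  have h0t : ∀ x, B (h0 x) (h0 x) < 0 := by
    intro x
    obtain ⟨S, hS⟩ := hLF.loc x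
    have hS := hS.self_of_nhds
    have e : h0 x = ∑ γ ∈ S, φ (A.act γ x) • f γ := avg_eq hS f
    rw [e]
    simp only [map_sum, sum_apply, map_smul, smul_apply, smul_eq_mul]
    obtain ⟨γ, hγ⟩ := hR x
    have hγ1 := hφ1 _ hγ
    have hγS : γ ∈ S := hS γ (by rw [hγ1]; exact one_ne_zero)
    have hterm : ∀ γ η, φ (A.act γ x) * (φ (A.act η x) * B (f η) (f γ)) ≤ 0 := fun γ η =>
      mul_nonpos_of_nonneg_of_nonpos (hφ0 _) (mul_nonpos_of_nonneg_of_nonpos (hφ0 _) (hff _ _).le)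
    have hterm' : ∀ γ, ∑ η ∈ S, φ (A.act γ x) * (φ (A.act η x) * B (f η) (f γ)) ≤ 0 := fun γ =>
      Finset.sum_nonpos fun η _ => hterm γ η
    simp only [Finset.mul_sum]
    refine Finset.sum_neg' (fun γ _ => hterm' γ) ⟨γ, hγS, ?_⟩
    refine Finset.sum_neg' (fun η _ => hterm γ η) ⟨γ, hγS, ?_⟩
    rw [hγ1]
    simpa using hff γ γ
  let N : V → ℝ := fun x => Real.sqrt (-B (h0 x) (h0 x))
  have hN : ∀ x, 0 < N x := fun x => Real.sqrt_pos.2 (by linarith [h0t x])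
  have hNsq : ∀ x, N x ^ 2 = -B (h0 x) (h0 x) := fun x => Real.sq_sqrt (by linarith [h0t x])
  have hNe : ∀ γ x, N (A.act γ x) = N x := fun γ x => by simp only [N, h0e, iso]
  have hNc : ContDiff ℝ 1 N := by
    refine ContDiff.sqrt ?_ fun x => by linarith [h0t x]
    exact ((B.contDiff.comp h0c).clm_apply h0c).neg
  refine ⟨fun x => (N x)⁻¹ • h0 x, (hNc.inv fun x => (hN x).ne').smul h0c, fun x => W.smul_mem _ (h0W x), fun x => ?_, fun γ x => ?_⟩
  · simp only [map_smul, smul_apply, smul_eq_mul]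
    have := hNsq x
    have h3 := (hN x).ne'
    field_simp
    linarith
  · simp only [hNe, h0e, map_smul]
end LS

namespace LS
open Filter Topology
variable {V : Type*} [NormedAddCommGroup V] [NormedSpace ℝ V] [FiniteDimensional ℝ V]
variable {G : Type*} [Group G]

theorem step4 {A : Aff G V} {B : V →L[ℝ] V →L[ℝ] ℝ} {W : Submodule ℝ V} {p : V →L[ℝ] V} (hB : Lor B)
    (iso : ∀ g x y, B (A.L g x) (A.L g y) = B x y) (hp : A.Proper) (hc : A.Cocpt) (hf : A.Free)
    (inv : ∀ g, ∀ w ∈ W, A.L g w ∈ W) (pr : IsPr B W p) (comm : ∀ g x, p (A.L g x) = A.L g (p x))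
    {w0 : V} (hw0 : w0 ∈ W) (hww : B w0 w0 < 0) (hor : ∀ γ, B w0 (A.L γ w0) < 0)
    (fin : ∀ R : ℝ, {γ | ‖A.L γ‖ ≤ R ∧ ‖p (A.a γ)‖ ≤ R}.Finite) : False := by
  have : ProperSpace V := FiniteDimensional.proper ℝ V
  obtain ⟨h, hhc, hhW, hhB, hhe⟩ := exists_field hB iso hp hc inv hw0 hww hor
  let F : V → V := fun x => p x + h x
  have hFc : ContDiff ℝ 1 F := p.contDiff.add hhc
  let Ap := A.proj p comm
  have hFe : ∀ γ x, F (A.act γ x) = Ap.act γ (F x) := by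
    intro γ x
    change p (A.act γ x) + h (A.act γ x) = A.L γ (p x + h x) + p (A.a γ)
    rw [hhe, Aff.act, map_add, comm, map_add]; abel
  have hFh : ∀ x, F x - p (F x) = h x := by
    intro x
    change p x + h x - p (p x + h x) = h x
    rw [map_add, pr.idem, pr.zero _ (hhW x)]; abel
  obtain ⟨R0, hR0⟩ := hc
  have hFb : ∀ r : ℝ, ∃ r', ∀ x, ‖x‖ ≤ r → ‖F x‖ ≤ r' := by
    intro r
    obtain ⟨C, hC⟩ := (isCompact_closedBall (0 : V) r).exists_bound_of_continuousOn hFc.continuous.continuousOn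
    exact ⟨C, fun x hx => hC x (by simpa using hx)⟩
  obtain ⟨R1, hR1⟩ := hFb R0
  obtain ⟨ψ, hψ, hψ0, hψ1, R2, hψR⟩ := exists_cut (V := V) R1
  let θ : V → ℝ := fun x => ψ (F x)
  have hθ : ContDiff ℝ 1 θ := hψ.comp hFc
  have hLF : LF A θ := by
    intro r
    obtain ⟨r', hr'⟩ := hFb r
    have hhn : ∀ x s, ‖F x‖ ≤ s → ‖h x‖ ≤ (1 + ‖p‖) * s := by
      intro x s hx
      rw [← hFh]
      have h1 := p.le_opNorm (F x)
      have h2 : ‖p‖ * ‖F x‖ ≤ ‖p‖ * s := by gcongr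
      linarith [norm_sub_le (F x) (p (F x))]
    obtain ⟨M, hM, hbd⟩ := hB.exists_bound (max ((1 + ‖p‖) * r') ((1 + ‖p‖) * R2))
    refine (fin (max M (R2 + M * r'))).subset ?_
    rintro γ ⟨x, hx, hγ⟩
    have h1 := hr' x hx
    have h2 : ‖F (A.act γ x)‖ ≤ R2 := hψR _ hγ
    have h3 : ‖A.L γ‖ ≤ M := by
      refine hbd (A.L γ) (h x) (iso γ) (hhB x) ((hhn x _ h1).trans (le_max_left _ _)) ?_
      rw [← hhe]
      exact (hhn _ _ h2).trans (le_max_right _ _)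
    refine ⟨h3.trans (le_max_left _ _), le_trans ?_ (le_max_right _ _)⟩
    have h4 : p (A.a γ) = F (A.act γ x) - A.L γ (F x) := by
      rw [hFe]
      change _ = A.L γ (F x) + p (A.a γ) - _
      abel
    rw [h4]
    refine (norm_sub_le _ _).trans (add_le_add h2 ?_)
    exact ((A.L γ).le_opNorm _).trans (mul_le_mul h3 h1 (norm_nonneg _) hM.le)
  let σ : V → ℝ := avg A θ (fun _ => (1 : ℝ))
  have hσ : ∀ x, 0 < σ x := by
    intro x
    apply hLF.avg_pos (fun x => hψ0 _)
    obtain ⟨γ, hγ⟩ := hR0 x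
    refine ⟨γ, ?_⟩
    change 0 < ψ _
    rw [hψ1 _ (hR1 _ hγ)]
    exact one_pos
  let f : G → V := fun γ => A.a γ⁻¹
  let q0 : V → V := avg A θ f
  let q : V → V := fun x => (σ x)⁻¹ • q0 x
  have hqc : ContDiff ℝ 1 q := ((hLF.contDiff hθ _).inv fun x => (hσ x).ne').smul (hLF.contDiff hθ _)
  have hσe : ∀ η x, σ (A.act η x) = σ x := fun η x => avg_act A θ _ η x
  have hq0e : ∀ η x, q0 (A.act η x) = A.L η (q0 x) + σ x • A.a η := by
    intro η x
    obtain ⟨S, hS⟩ := hLF.loc x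
    have hS := hS.self_of_nhds
    change avg A θ f (A.act η x) = A.L η (avg A θ f x) + (avg A θ (fun _ => (1 : ℝ)) x) • A.a η
    rw [avg_act, avg_eq hS, avg_eq hS, avg_eq hS, map_sum, Finset.sum_smul, ← Finset.sum_add_distrib]
    refine Finset.sum_congr rfl fun γ _ => ?_
    simp only [f, map_smul, mul_inv_rev, inv_inv, A.a_mul, smul_add, smul_eq_mul, mul_one]
  have hqe : ∀ η x, q (A.act η x) = A.act η (q x) := by
    intro η x
    change (σ (A.act η x))⁻¹ • q0 (A.act η x) = A.L η ((σ x)⁻¹ • q0 x) + A.a η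
    rw [hσe, hq0e, smul_add, map_smul, smul_smul, inv_mul_cancel₀ (hσ x).ne', one_smul]
  refine degree hp ⟨R0, hR0⟩ hf (fun γ => det_iso hB _ (iso γ)) q hqc hqe fun x => ?_
  -- q factors locally through F
  obtain ⟨S, hS⟩ := hLF.loc x
  let g : G → V → ℝ := fun γ y => ψ (Ap.act γ y)
  have hg : ∀ γ, ContDiff ℝ 1 (g γ) := fun γ => hψ.comp (by unfold Aff.act; fun_prop)
  have hθg : ∀ γ y, θ (A.act γ y) = g γ (F y) := fun γ y => by
    change ψ (F (A.act γ y)) = ψ (Ap.act γ (F y))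
    rw [hFe]
  let Q : V → V := fun y => (∑ γ ∈ S, g γ y * 1)⁻¹ • ∑ γ ∈ S, g γ y • f γ
  have hqQ : ∀ y, (∀ γ, θ (A.act γ y) ≠ 0 → γ ∈ S) → σ y = ∑ γ ∈ S, g γ (F y) * 1 ∧ q y = Q (F y) := by
    intro y hy
    have e1 : σ y = ∑ γ ∈ S, g γ (F y) * 1 := by
      change avg A θ _ y = _
      rw [avg_eq hy]
      exact Finset.sum_congr rfl fun γ _ => by rw [hθg, smul_eq_mul]
    refine ⟨e1, ?_⟩
    change (σ y)⁻¹ • avg A θ f y = _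
    rw [e1, avg_eq hy]
    simp only [Q, hθg]
  have hQd : DifferentiableAt ℝ Q (F x) := by
    have h1 := (hqQ x hS.self_of_nhds).1
    have h2 := (hσ x).ne'
    rw [h1] at h2
    have hgd : ∀ γ, DifferentiableAt ℝ (g γ) (F x) := fun γ => (hg γ).differentiable one_ne_zero _
    refine DifferentiableAt.smul (DifferentiableAt.inv ?_ h2) ?_
    · exact DifferentiableAt.fun_sum fun γ _ => (hgd γ).mul_const 1
    · exact DifferentiableAt.fun_sum fun γ _ => (hgd γ).smul_const _
  have hFd : DifferentiableAt ℝ F x := hFc.differentiable one_ne_zero x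
  have hev : q =ᶠ[𝓝 x] Q ∘ F := by
    filter_upwards [hS] with y hy using (hqQ y hy).2
  have hder : fderiv ℝ q x = (fderiv ℝ Q (F x)).comp (fderiv ℝ F x) := by
    rw [hev.fderiv_eq]
    exact fderiv_comp x hQd hFd
  have hdet : (fderiv ℝ F x).det = 0 := by
    by_contra hne
    let ℓ : V →L[ℝ] ℝ := (B (h x)).comp (ContinuousLinearMap.id ℝ V - p)
    have hℓ : ∀ v, ℓ v = B (h x) (v - p v) := fun v => rfl
    have hz : ∀ v, ℓ (fderiv ℝ F x v) = 0 := by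
      intro v
      have hhd : HasFDerivAt h ((ContinuousLinearMap.id ℝ V - p).comp (fderiv ℝ F x)) x := by
        have e : h = fun y => (ContinuousLinearMap.id ℝ V - p) (F y) := by
          funext y; exact (hFh y).symm
        have h1 := (ContinuousLinearMap.id ℝ V - p).hasFDerivAt.comp x hFd.hasFDerivAt
        exact h1.congr_of_eventuallyEq (Eventually.of_forall fun y => congrFun e y)
      have h1 : HasFDerivAt (fun y => B (h y) (h y)) _ x := (B.hasFDerivAt.comp x hhd).clm_apply hhd
      have h2 : HasFDerivAt (fun y => B (h y) (h y)) (0 : V →L[ℝ] ℝ) x := by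
        simp only [hhB]; exact hasFDerivAt_const _ _
      have h3 := congrArg (fun M : V →L[ℝ] ℝ => M v) (h1.unique h2)
      simp at h3
      have h4 := hB.symm (fderiv ℝ F x v - p (fderiv ℝ F x v)) (h x)
      rw [hℓ]
      simp only [map_sub, sub_apply] at h3 h4 ⊢
      linarith
    have hx1 : ℓ (h x) = -1 := by rw [hℓ, pr.zero _ (hhW x), sub_zero, hhB]
    have hsurj : Function.Surjective (fderiv ℝ F x : V →ₗ[ℝ] V) :=
      (LinearMap.equivOfDetNeZero _ hne).surjective
    obtain ⟨v, hv⟩ := hsurj (h x)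
    have := hz v
    have hv' : fderiv ℝ F x v = h x := hv
    rw [hv', hx1] at this
    norm_num at this
  rw [hder, ContinuousLinearMap.det, ContinuousLinearMap.toLinearMap_comp, LinearMap.det_comp]
  have : LinearMap.det (fderiv ℝ F x : V →ₗ[ℝ] V) = 0 := hdet
  rw [this, mul_zero]

variable {A : Aff G V} {B : V →L[ℝ] V →L[ℝ] ℝ} {W : Submodule ℝ V} {p : V →L[ℝ] V}

/-- case a is impossible -/
theorem Ctx.case_a (c : Ctx A B W p) (ha : ∃ ε > 0, ∀ γ, ‖c.T γ - 1‖ < ε → A.a γ = p (A.a γ)) : False := by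
  classical
  obtain ⟨w0, hw0, hww⟩ := c.si.tl
  have hB := c.lor
  have hne : ∀ γ, B w0 (A.L γ w0) ≠ 0 := by
    intro γ h
    have h1 : B (A.L γ w0) (A.L γ w0) < 0 := by rw [c.iso]; exact hww
    have h2 := hB.eq_zero_of_orth hww h h1.le
    rw [h2] at h1
    simp at h1
  have hinv : ∀ γ, B w0 (A.L γ⁻¹ w0) = B w0 (A.L γ w0) := by
    intro γ
    rw [← c.iso γ w0, A.L_L_inv, hB.symm]
  have htl : ∀ γ, B (A.L γ w0) (A.L γ w0) < 0 := fun γ => by rw [c.iso]; exact hww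
  have hmul : ∀ γ η, B w0 (A.L (γ⁻¹ * η) w0) = B (A.L γ w0) (A.L η w0) := by
    intro γ η
    rw [A.L_mul, ← c.iso γ w0, A.L_L_inv]
  let H : Subgroup G :=
    { carrier := {γ | B w0 (A.L γ w0) < 0}
      one_mem' := by simpa [A.L_one] using hww
      mul_mem' := by
        intro γ η hγ hη
        have := hmul γ⁻¹ η
        rw [inv_inv] at this
        change B w0 (A.L (γ * η) w0) < 0
        rw [this]
        refine hB.cone (htl _) (htl _) hww ?_ hη
        rw [hinv]; exact hγ
      inv_mem' := by
        intro γ hγ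
        change B w0 (A.L γ⁻¹ w0) < 0
        rw [hinv]; exact hγ }
  have hH : H.FiniteIndex := by
    refine finiteIndex_of_color H (fun γ => decide (B w0 (A.L γ w0) < 0)) (Set.toFinite _) ?_
    intro γ η hγη
    change B w0 (A.L (γ⁻¹ * η) w0) < 0
    rw [hmul]
    by_cases h1 : B w0 (A.L γ w0) < 0
    · have h2 : B w0 (A.L η w0) < 0 := by simpa [h1] using hγη
      exact hB.cone (htl _) (htl _) hww h1 h2
    · have h2 : ¬ B w0 (A.L η w0) < 0 := by simpa [h1] using hγη
      have h3 := lt_of_le_of_ne (not_lt.1 h1) (hne γ).symm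
      have h4 := lt_of_le_of_ne (not_lt.1 h2) (hne η).symm
      refine hB.cone (htl _) (htl _) (w := -w0) (by simpa using hww) (by simpa using h3) (by simpa using h4)
  have hfin := c.fin ha
  refine step4 (A := A.restrict H) hB (fun g => c.iso g) (c.proper.restrict H) (c.cocpt.restrict hH) (c.free.restrict H)
    (fun g => c.si.inv g) c.pr (fun g => c.comm g) hw0 hww (fun γ => γ.2) fun R => ?_
  exact (hfin R).preimage Subtype.val_injective.injOn

theorem Ctx.vs (c : Ctx A B W p) : VS G := by
  by_cases hb : ∀ ε > 0, ∃ γ, ‖c.T γ - 1‖ < ε ∧ A.a γ ≠ p (A.a γ)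
  · exact c.case_b hb
  · push Not at hb
    exact (c.case_a hb).elim

theorem Hyp.vs {lam : G →* ℝ} (h : Hyp A B lam) : VS G := by
  rcases reduction h with h1 | ⟨K, W, hK, hW⟩
  · exact h1
  · obtain ⟨p, c⟩ := exists_ctx (h.restrict hK) hW
    exact VS.of_finiteIndex hK c.vs
end LS

namespace LS

/-- the polarization of the Lorentz form -/
def lorB (m : ℕ) : Vec (m + 2) →L[ℝ] Vec (m + 2) →L[ℝ] ℝ :=
  (∑ i : Fin (m + 1), (ContinuousLinearMap.proj (R := ℝ) (φ := fun _ : Fin (m + 2) => ℝ) i.castSucc).smulRight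
      (ContinuousLinearMap.proj (R := ℝ) (φ := fun _ : Fin (m + 2) => ℝ) i.castSucc)) -
    (ContinuousLinearMap.proj (R := ℝ) (φ := fun _ : Fin (m + 2) => ℝ) (Fin.last (m + 1))).smulRight
      (ContinuousLinearMap.proj (R := ℝ) (φ := fun _ : Fin (m + 2) => ℝ) (Fin.last (m + 1)))

theorem lorB_apply (m : ℕ) (x y : Vec (m + 2)) : lorB m x y =
    (∑ i : Fin (m + 1), x i.castSucc * y i.castSucc) - x (Fin.last (m + 1)) * y (Fin.last (m + 1)) := by
  simp [lorB]

theorem lorB_self (m : ℕ) (x : Vec (m + 2)) : lorB m x x = lorentzQ m x := by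
  rw [lorB_apply, lorentzQ]
  simp only [sq]

theorem lorB_lor (m : ℕ) : Lor (lorB m) := by
  refine ⟨fun x y => ?_, Pi.single (Fin.last (m + 1)) 1, ?_, ?_⟩
  · simp only [lorB_apply, mul_comm]
  · rw [lorB_apply]
    simp
  · intro x hx hx0
    rw [lorB_apply] at hx
    simp at hx
    rw [lorB_self, lorentzQ, hx]
    by_contra hc
    have h1 : ∑ i : Fin (m + 1), x i.castSucc ^ 2 ≤ 0 := by simpa using hc
    have h2 : ∑ i : Fin (m + 1), x i.castSucc ^ 2 = 0 := le_antisymm h1 (Finset.sum_nonneg fun i _ => sq_nonneg _)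
    rw [Finset.sum_eq_zero_iff_of_nonneg (fun i _ => sq_nonneg _)] at h2
    apply hx0
    funext i
    refine Fin.lastCases hx (fun j => ?_) i
    simpa using h2 j (Finset.mem_univ j)

/-- the affine structure of a subgroup of the affine group -/
def toAff {n : ℕ} (Γ : Subgroup (AffGroup n)) : Aff ↥Γ (Vec n) where
  L :=
    { toFun := fun γ => LinearMap.toContinuousLinearMap (γ.1.linear : Vec n →ₗ[ℝ] Vec n)
      map_one' := by ext1 x; rfl
      map_mul' := fun g h => by ext1 x; rfl }
  a := fun γ => γ.1 0
  a_mul := fun g h => by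
    have := g.1.map_vadd 0 (h.1 0)
    simpa using this

theorem toAff_L {n : ℕ} (Γ : Subgroup (AffGroup n)) (γ : ↥Γ) (x : Vec n) : (toAff Γ).L γ x = γ.1.linear x := rfl

theorem toAff_act {n : ℕ} (Γ : Subgroup (AffGroup n)) (γ : ↥Γ) (x : Vec n) : (toAff Γ).act γ x = γ.1 x := by
  have h : γ.1.linear x + γ.1 0 = γ.1 x := by
    have := γ.1.map_vadd 0 x
    simpa using this.symm
  exact h

theorem main_hyp (m : ℕ) (Γ : Subgroup (AffGroup (m + 2)))
    (hSim : ∀ γ ∈ Γ, InSimL m γ)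
    (hFree : FreeAction Γ) (hPD : ProperlyDisc Γ) (hCC : CocompactAction Γ) :
    ∃ lam : ↥Γ →* ℝ, Hyp (toAff Γ) (lorB m) lam := by
  obtain ⟨e, he, -⟩ := (lorB_lor m).ex
  let l : ↥Γ → ℝ := fun γ => Real.sqrt (-lorB m ((toAff Γ).L γ e) ((toAff Γ).L γ e))
  have hl : ∀ γ, 0 < l γ ∧ ∀ v, lorB m ((toAff Γ).L γ v) ((toAff Γ).L γ v) = l γ ^ 2 * lorB m v v := by
    intro γ
    obtain ⟨c, A, hc, hA, hγ⟩ := hSim γ.1 γ.2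
    have h1 : ∀ v, lorB m ((toAff Γ).L γ v) ((toAff Γ).L γ v) = c ^ 2 * lorB m v v := by
      intro v
      rw [toAff_L, hγ]
      simp only [map_smul, smul_apply, smul_eq_mul]
      rw [lorB_self, lorB_self, hA]; ring
    have h2 : l γ = c := by
      simp only [l, h1, he]
      rw [mul_neg_one, neg_neg, Real.sqrt_sq hc.le]
    rw [h2]
    exact ⟨hc, h1⟩
  let lam : ↥Γ →* ℝ :=
    { toFun := l
      map_one' := by simp [l, he]
      map_mul' := fun g h => by
        have h1 := (hl (g * h)).2 e
        have h2 := (hl g).2 ((toAff Γ).L h e)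
        rw [(hl h).2 e, he] at h2
        rw [(toAff Γ).L_mul, h2, he] at h1
        have h3 : l (g * h) ^ 2 = (l g * l h) ^ 2 := by linarith
        exact (pow_left_inj₀ (hl _).1.le (mul_pos (hl g).1 (hl h).1).le two_ne_zero).1 h3 }
  refine ⟨lam, lorB_lor m, fun g => (hl g).1, ?_, ?_, ?_, ?_⟩
  · intro g x y
    have h1 := (hl g).2 (x + y)
    have h2 := (hl g).2 x
    have h3 := (hl g).2 y
    have h4 := (lorB_lor m).symm x y
    have h5 := (lorB_lor m).symm ((toAff Γ).L g x) ((toAff Γ).L g y)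
    simp only [map_add, add_apply] at h1
    change _ = l g ^ 2 * _
    rw [h2, h3, ← h5, ← h4] at h1
    linarith
  · intro R
    have h1 := hPD (Metric.closedBall 0 R) (isCompact_closedBall _ _)
    refine (h1.preimage (f := (Subtype.val : ↥Γ → AffGroup (m + 2))) Subtype.val_injective.injOn).subset ?_
    rintro g ⟨x, hx, hgx⟩
    rw [toAff_act] at hgx
    exact ⟨g.2, g.1 x, ⟨x, by simpa using hx, rfl⟩, by simpa using hgx⟩
  · obtain ⟨K, hK, hcov⟩ := hCC
    obtain ⟨R, hR⟩ := hK.isBounded.subset_closedBall 0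
    refine ⟨R, fun x => ?_⟩
    obtain ⟨γ, hγ, hx⟩ := hcov x
    refine ⟨⟨γ, hγ⟩, ?_⟩
    rw [toAff_act]
    simpa using hR hx
  · intro g x hx
    rw [toAff_act] at hx
    exact Subtype.ext (hFree g.1 g.2 ⟨x, hx⟩)

end LS

/-- A compact complete Lorentzian similarity manifold has virtually solvable
fundamental group: if `Γ ≤ Sim_L(ℝ^{m+2})` acts freely, properly discontinuously and
cocompactly on `ℝ^{m+2}`, then `Γ` contains a solvable subgroup of finite index. -/
theorem statement2 (m : ℕ) (Γ : Subgroup (AffGroup (m + 2)))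
    (hSim : ∀ γ ∈ Γ, InSimL m γ)
    (hFree : FreeAction Γ) (hPD : ProperlyDisc Γ) (hCC : CocompactAction Γ) :
    ∃ H : Subgroup ↥Γ, H.FiniteIndex ∧ IsSolvable ↥H := by
  obtain ⟨lam, h⟩ := LS.main_hyp m Γ hSim hFree hPD hCC
  exact h.vs
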